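/- The set of pairs (x,y) ∈ ℚ × ℚ satisfying y² = (x² + 1)(x² − 2x − 1)(x⁶ − 3x⁴ − 16x³ + 3x² − 1) is exactly {(0, 1), (0, −1), (1, 8), (1, −8), (−1, 8), (−1, −8), (3, 40), (3, −40), (−1/3, 40/243), (−1/3, −40/243)}. -/

import Mathlib

/-- The ring `ℤ[c]`, `c³ = 2`; `⟨r, s, t⟩` stands for `r + s c + t c²`. -/
@[ext] structure CR where
  r : ℤ
  s : ℤ
  t : ℤ

namespace CR

instance : DecidableEq CR := fun a b =>
  decidable_of_iff (a.r = b.r ∧ a.s = b.s ∧ a.t = b.t) (by rw [CR.ext_iff])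

instance : Zero CR := ⟨⟨0, 0, 0⟩⟩
instance : One CR := ⟨⟨1, 0, 0⟩⟩
instance : Add CR := ⟨fun a b => ⟨a.r + b.r, a.s + b.s, a.t + b.t⟩⟩
instance : Neg CR := ⟨fun a => ⟨-a.r, -a.s, -a.t⟩⟩
instance : Sub CR := ⟨fun a b => ⟨a.r - b.r, a.s - b.s, a.t - b.t⟩⟩
instance : Mul CR := ⟨fun a b => ⟨a.r * b.r + 2 * (a.s * b.t + a.t * b.s),
  a.r * b.s + a.s * b.r + 2 * (a.t * b.t), a.r * b.t + a.t * b.r + a.s * b.s⟩⟩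
instance : NatCast CR := ⟨fun n => ⟨n, 0, 0⟩⟩
instance : IntCast CR := ⟨fun n => ⟨n, 0, 0⟩⟩
instance : SMul ℕ CR := ⟨fun n a => ⟨n * a.r, n * a.s, n * a.t⟩⟩
instance : SMul ℤ CR := ⟨fun n a => ⟨n * a.r, n * a.s, n * a.t⟩⟩

@[simp] lemma zero_r : (0 : CR).r = 0 := rfl
@[simp] lemma zero_s : (0 : CR).s = 0 := rfl
@[simp] lemma zero_t : (0 : CR).t = 0 := rfl
@[simp] lemma one_r : (1 : CR).r = 1 := rfl
@[simp] lemma one_s : (1 : CR).s = 0 := rfl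
@[simp] lemma one_t : (1 : CR).t = 0 := rfl
@[simp] lemma add_r (a b : CR) : (a + b).r = a.r + b.r := rfl
@[simp] lemma add_s (a b : CR) : (a + b).s = a.s + b.s := rfl
@[simp] lemma add_t (a b : CR) : (a + b).t = a.t + b.t := rfl
@[simp] lemma neg_r (a : CR) : (-a).r = -a.r := rfl
@[simp] lemma neg_s (a : CR) : (-a).s = -a.s := rfl
@[simp] lemma neg_t (a : CR) : (-a).t = -a.t := rfl
@[simp] lemma sub_r (a b : CR) : (a - b).r = a.r - b.r := rfl
@[simp] lemma sub_s (a b : CR) : (a - b).s = a.s - b.s := rfl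
@[simp] lemma sub_t (a b : CR) : (a - b).t = a.t - b.t := rfl
@[simp] lemma mul_r (a b : CR) : (a * b).r = a.r * b.r + 2 * (a.s * b.t + a.t * b.s) := rfl
@[simp] lemma mul_s (a b : CR) : (a * b).s = a.r * b.s + a.s * b.r + 2 * (a.t * b.t) := rfl
@[simp] lemma mul_t (a b : CR) : (a * b).t = a.r * b.t + a.t * b.r + a.s * b.s := rfl
@[simp] lemma natCast_r (n : ℕ) : (n : CR).r = n := rfl
@[simp] lemma natCast_s (n : ℕ) : (n : CR).s = 0 := rfl
@[simp] lemma natCast_t (n : ℕ) : (n : CR).t = 0 := rfl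
@[simp] lemma intCast_r (n : ℤ) : (n : CR).r = n := rfl
@[simp] lemma intCast_s (n : ℤ) : (n : CR).s = 0 := rfl
@[simp] lemma intCast_t (n : ℤ) : (n : CR).t = 0 := rfl

instance : CommRing CR where
  add_assoc a b c := by ext <;> simp <;> ring
  zero_add a := by ext <;> simp
  add_zero a := by ext <;> simp
  add_comm a b := by ext <;> simp <;> ring
  neg_add_cancel a := by ext <;> simp
  sub_eq_add_neg a b := by ext <;> simp <;> ring
  left_distrib a b c := by ext <;> simp <;> ring
  right_distrib a b c := by ext <;> simp <;> ring
  zero_mul a := by ext <;> simp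
  mul_zero a := by ext <;> simp
  mul_assoc a b c := by ext <;> simp <;> ring
  one_mul a := by ext <;> simp
  mul_one a := by ext <;> simp
  mul_comm a b := by ext <;> simp <;> ring
  nsmul n a := n • a
  nsmul_zero a := by ext <;> simp [HSMul.hSMul, SMul.smul]
  nsmul_succ n a := by
    ext <;> simp [HSMul.hSMul, SMul.smul] <;> ring
  zsmul n a := n • a
  zsmul_zero' a := by ext <;> simp [HSMul.hSMul, SMul.smul]
  zsmul_succ' n a := by
    ext <;> simp [HSMul.hSMul, SMul.smul] <;> ring
  zsmul_neg' n a := by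
    ext <;> simp [HSMul.hSMul, SMul.smul, Int.negSucc_eq] <;> ring
  natCast_zero := by ext <;> simp
  natCast_succ n := by ext <;> simp
  intCast_ofNat n := by ext <;> simp
  intCast_negSucc n := by ext <;> simp [Int.negSucc_eq] <;> ring

@[simp] lemma ofNat_r (n : ℕ) [n.AtLeastTwo] : (OfNat.ofNat n : CR).r = OfNat.ofNat n := rfl
@[simp] lemma ofNat_s (n : ℕ) [n.AtLeastTwo] : (OfNat.ofNat n : CR).s = 0 := rfl
@[simp] lemma ofNat_t (n : ℕ) [n.AtLeastTwo] : (OfNat.ofNat n : CR).t = 0 := rfl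

/-- the norm -/
def nm (a : CR) : ℤ := a.r ^ 3 + 2 * a.s ^ 3 + 4 * a.t ^ 3 - 6 * a.r * a.s * a.t

lemma nm_mul (a b : CR) : nm (a * b) = nm a * nm b := by
  simp [nm]; ring

/-- the adjugate -/
def adj (a : CR) : CR := ⟨a.r ^ 2 - 2 * a.s * a.t, 2 * a.t ^ 2 - a.r * a.s, a.s ^ 2 - a.r * a.t⟩

lemma mul_adj (a : CR) : a * adj a = (nm a : CR) := by
  ext
  · rw [intCast_r]; simp only [nm, adj, mul_r]; ring
  · rw [intCast_s]; simp only [adj, mul_s]; ring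
  · rw [intCast_t]; simp only [adj, mul_t]; ring

lemma nm_adj (a : CR) : nm (adj a) = nm a ^ 2 := by
  simp [nm, adj]; ring

/-- cube descent: the norm form is anisotropic -/
lemma nm_eq_zero_aux : ∀ (n : ℕ) (a : CR), a.r.natAbs + a.s.natAbs + a.t.natAbs ≤ n →
    nm a = 0 → a = 0 := by
  intro n
  induction n with
  | zero =>
    intro a h _
    ext <;> simp <;> omega
  | succ n ih =>
    intro a h h0
    have h1 : (2 : ℤ) ∣ a.r := by
      have : (2 : ℤ) ∣ a.r ^ 3 := ⟨-(a.s ^ 3 + 2 * a.t ^ 3 - 3 * a.r * a.s * a.t), by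
        unfold nm at h0; linarith⟩
      exact Int.prime_two.dvd_of_dvd_pow this
    obtain ⟨r, hr⟩ := h1
    have key : nm ⟨a.s, a.t, r⟩ = 0 := by
      unfold nm at h0 ⊢; rw [hr] at h0; simp only; linarith
    by_cases hz : a.r = 0
    · -- then r = 0 and repeat on s
      have hr0 : r = 0 := by omega
      have h2 : a.s ^ 3 + 2 * a.t ^ 3 = 0 := by
        unfold nm at h0; rw [hz] at h0; linarith
      have h3 : (2 : ℤ) ∣ a.s := by
        have : (2 : ℤ) ∣ a.s ^ 3 := ⟨-(a.t ^ 3), by linarith⟩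
        exact Int.prime_two.dvd_of_dvd_pow this
      obtain ⟨s, hs⟩ := h3
      by_cases hs0 : a.s = 0
      · have : a.t ^ 3 = 0 := by rw [hs0] at h2; linarith
        have ht : a.t = 0 := by simpa using this
        ext <;> simp [hz, hs0, ht]
      · have := ih ⟨a.t, 0, s⟩ (by simp only; omega) (by
          unfold nm; simp only; rw [hs] at h2; linarith)
        have hh := congrArg CR.t this
        simp at hh
        omega
    · have := ih ⟨a.s, a.t, r⟩ (by simp only; omega) key
      have hh := congrArg CR.t this
      simp at hh
      omega

lemma nm_eq_zero {a : CR} (h : nm a = 0) : a = 0 := nm_eq_zero_aux _ a le_rfl h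

lemma nm_zero : nm 0 = 0 := by simp [nm]

instance : Nontrivial CR := ⟨0, 1, by intro h; simpa using congrArg CR.r h⟩

instance : NoZeroDivisors CR := ⟨by
  intro a b h
  have h1 : nm a * nm b = 0 := by rw [← nm_mul, h, nm_zero]
  rcases mul_eq_zero.1 h1 with h | h
  · exact Or.inl (nm_eq_zero h)
  · exact Or.inr (nm_eq_zero h)⟩

instance : IsDomain CR := NoZeroDivisors.to_isDomain CR

/-- inequality behind the Euclidean algorithm -/
lemma euc_ineq (r s t : ℚ) (hr : |r| ≤ 1/2) (hs : |s| ≤ 1/2) (ht : |t| ≤ 1/2) :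
    ∃ e : ℤ, |(r + e) ^ 3 + 2 * s ^ 3 + 4 * t ^ 3 - 6 * (r + e) * s * t| < 1 := by
  -- reduce to t ≥ 0
  have main : ∀ r s t : ℚ, |r| ≤ 1/2 → |s| ≤ 1/2 → 0 ≤ t → t ≤ 1/2 →
      ∃ e : ℤ, |(r + e) ^ 3 + 2 * s ^ 3 + 4 * t ^ 3 - 6 * (r + e) * s * t| < 1 := by
    clear hr hs ht r s t
    intro r s t hr hs ht0 ht
    have t3 : t ^ 3 ≤ 1/8 := by
      calc t ^ 3 ≤ (1/2) ^ 3 := pow_le_pow_left₀ ht0 ht 3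
        _ = 1/8 := by norm_num
    have t30 : 0 ≤ t ^ 3 := by positivity
    have cube : ∀ x : ℚ, 0 ≤ x → x ≤ 1/2 → x ^ 3 ≤ 1/8 := fun x h0 h => by
      calc x ^ 3 ≤ (1/2) ^ 3 := pow_le_pow_left₀ h0 h 3
        _ = 1/8 := by norm_num
    rcases le_total 0 r with r0 | r0 <;> rcases le_total 0 s with s0 | s0
    · rw [abs_of_nonneg r0] at hr; rw [abs_of_nonneg s0] at hs
      refine ⟨0, ?_⟩
      have h1 := cube r r0 hr
      have h2 := cube s s0 hs
      have h3 : 0 ≤ r * s * t := by positivity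
      have h4 : r * s ≤ 1/4 := by nlinarith
      have h5 : r * s * t ≤ 1/8 := by nlinarith [mul_nonneg r0 s0]
      have h6 : 0 ≤ r ^ 3 := by positivity
      have h7 : 0 ≤ s ^ 3 := by positivity
      push_cast
      rw [abs_lt]; constructor <;> nlinarith
    · -- r ≥ 0, s ≤ 0
      rw [abs_of_nonneg r0] at hr; rw [abs_of_nonpos s0] at hs
      obtain ⟨b, rfl⟩ : ∃ b, s = -b := ⟨-s, by ring⟩
      have b0 : 0 ≤ b := by linarith
      have hb : b ≤ 1/2 := by linarith
      have h1 := cube r r0 hr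
      have h2 := cube b b0 hb
      have h6 : 0 ≤ r ^ 3 := by positivity
      have h7 : 0 ≤ b ^ 3 := by positivity
      have bt : b * t ≤ 1/4 := by nlinarith
      have bt0 : 0 ≤ b * t := by positivity
      have rbt0 : 0 ≤ r * (b * t) := by positivity
      by_cases hN : r ^ 3 - 2 * b ^ 3 + 4 * t ^ 3 + 6 * (r * (b * t)) < 1
      · refine ⟨0, ?_⟩
        push_cast
        rw [abs_lt]; constructor <;> nlinarith
      · rw [not_lt] at hN
        have rb : r * (b * t) ≤ r * (1/4) := mul_le_mul_of_nonneg_left bt r0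
        have ra : 1/4 ≤ r := by nlinarith
        refine ⟨-1, ?_⟩
        push_cast
        have e1 : (1 - r) * (b * t) ≥ 0 := by
          apply mul_nonneg <;> linarith
        have e2 : (1 - r) ^ 3 ≥ 0 := by
          apply pow_nonneg; linarith
        have e3 : r ^ 3 + (1 - r) ^ 3 < 1/2 := by nlinarith
        rw [abs_lt]; constructor
        · nlinarith
        · nlinarith
    · -- r ≤ 0, s ≥ 0
      rw [abs_of_nonpos r0] at hr; rw [abs_of_nonneg s0] at hs
      obtain ⟨a, rfl⟩ : ∃ a, r = -a := ⟨-r, by ring⟩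
      have a0 : 0 ≤ a := by linarith
      have ha : a ≤ 1/2 := by linarith
      have h1 := cube a a0 ha
      have h2 := cube s s0 hs
      have h6 : 0 ≤ a ^ 3 := by positivity
      have h7 : 0 ≤ s ^ 3 := by positivity
      have bt : s * t ≤ 1/4 := by nlinarith
      have bt0 : 0 ≤ s * t := by positivity
      have rbt0 : 0 ≤ a * (s * t) := by positivity
      by_cases hN : - a ^ 3 + 2 * s ^ 3 + 4 * t ^ 3 + 6 * (a * (s * t)) < 1
      · refine ⟨0, ?_⟩
        push_cast
        rw [abs_lt]; constructor <;> nlinarith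
      · rw [not_lt] at hN
        have rb : a * (s * t) ≤ a * (1/4) := mul_le_mul_of_nonneg_left bt a0
        have ra : 1/6 ≤ a := by nlinarith
        have st1 : s * t ≥ 1/12 := by nlinarith
        refine ⟨1, ?_⟩
        push_cast
        have e2 : (1 - a) ^ 3 ≥ 0 := by
          apply pow_nonneg; linarith
        rw [abs_lt]; constructor
        · nlinarith
        · have e3 : 6 * (a * (s * t)) ≥ 1/4 + a ^ 3 := by linarith
          have e4 : (1 - a) * (s * t) * 6 ≥ 1/4 + a ^ 3 := by nlinarith
          have e5 : (1 - a) ^ 3 < 1/2 + a ^ 3 + (1/4) := by nlinarith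
          nlinarith
    · rw [abs_of_nonpos r0] at hr; rw [abs_of_nonpos s0] at hs
      obtain ⟨a, rfl⟩ : ∃ a, r = -a := ⟨-r, by ring⟩
      obtain ⟨b, rfl⟩ : ∃ b, s = -b := ⟨-s, by ring⟩
      have a0 : 0 ≤ a := by linarith
      have ha : a ≤ 1/2 := by linarith
      have b0 : 0 ≤ b := by linarith
      have hb : b ≤ 1/2 := by linarith
      have h1 := cube a a0 ha
      have h2 := cube b b0 hb
      have h6 : 0 ≤ a ^ 3 := by positivity
      have h7 : 0 ≤ b ^ 3 := by positivity
      have ab : a * b ≤ 1/4 := by nlinarith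
      have ab0 : 0 ≤ a * b := by positivity
      have abt : a * b * t ≤ 1/4 * t := mul_le_mul_of_nonneg_right ab ht0
      have abt0 : 0 ≤ a * b * t := by positivity
      refine ⟨0, ?_⟩
      push_cast
      have : 4 * t ^ 3 - 3/2 * t > -(5/8) := by nlinarith [sq_nonneg (t - 1/3)]
      rw [abs_lt]; constructor <;> nlinarith
  rcases le_total 0 t with h | h
  · exact main r s t hr hs h (by rw [abs_of_nonneg h] at ht; exact ht)
  · obtain ⟨e, he⟩ := main (-r) (-s) (-t) (by rwa [abs_neg]) (by rwa [abs_neg]) (by linarith)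
      (by rw [abs_of_nonpos h] at ht; exact ht)
    refine ⟨-e, ?_⟩
    rw [← abs_neg] at he
    convert he using 2
    push_cast; ring

lemma euc (a b : CR) (hb : b ≠ 0) : ∃ q : CR, (nm (a - b * q)).natAbs < (nm b).natAbs := by
  have hn : nm b ≠ 0 := fun h => hb (nm_eq_zero h)
  set n := nm b with hnd
  set x := a * adj b with hx
  have hnq : (n : ℚ) ≠ 0 := by exact_mod_cast hn
  have hrd : ∀ z : ℚ, |z - round z| ≤ 1/2 := fun z => abs_sub_round z
  obtain ⟨e, he⟩ := euc_ineq _ _ _ (hrd ((x.r : ℚ) / n)) (hrd ((x.s : ℚ) / n)) (hrd ((x.t : ℚ) / n))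
  set q1 := round ((x.r : ℚ) / n)
  set q2 := round ((x.s : ℚ) / n)
  set q3 := round ((x.t : ℚ) / n)
  refine ⟨⟨q1 - e, q2, q3⟩, ?_⟩
  set q : CR := ⟨q1 - e, q2, q3⟩ with hq
  have h1 : (a - b * q) * adj b = x - (n : CR) * q := by
    rw [hx, ← mul_adj b]; ring
  have h2 : nm (a - b * q) * n ^ 2 = nm (x - (n : CR) * q) := by
    rw [← h1, nm_mul, nm_adj]
  have h3 : ((nm (x - (n : CR) * q) : ℤ) : ℚ) = n ^ 3 *
      (((x.r : ℚ) / n - q1 + e) ^ 3 + 2 * ((x.s : ℚ) / n - q2) ^ 3 + 4 * ((x.t : ℚ) / n - q3) ^ 3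
       - 6 * ((x.r : ℚ) / n - q1 + e) * ((x.s : ℚ) / n - q2) * ((x.t : ℚ) / n - q3)) := by
    simp [nm, hq]
    field_simp
    ring
  have h4 : |((nm (a - b * q) : ℤ) : ℚ)| < |(n : ℚ)| := by
    have h5 : ((nm (a - b * q) : ℤ) : ℚ) = n *
      (((x.r : ℚ) / n - q1 + e) ^ 3 + 2 * ((x.s : ℚ) / n - q2) ^ 3 + 4 * ((x.t : ℚ) / n - q3) ^ 3
       - 6 * ((x.r : ℚ) / n - q1 + e) * ((x.s : ℚ) / n - q2) * ((x.t : ℚ) / n - q3)) := by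
      have h6 : ((nm (a - b * q) : ℤ) : ℚ) * n ^ 2 = ((nm (x - (n : CR) * q) : ℤ) : ℚ) := by
        rw [← h2]; push_cast; ring
      rw [h3] at h6
      have : (n : ℚ) ^ 2 ≠ 0 := pow_ne_zero _ hnq
      apply mul_right_cancel₀ this
      rw [h6]; ring
    rw [h5, abs_mul]
    calc _ < |(n : ℚ)| * 1 := mul_lt_mul_of_pos_left he (abs_pos.2 hnq)
      _ = _ := mul_one _
  have h5 : |nm (a - b * q)| < |n| := by exact_mod_cast h4
  rw [Int.abs_eq_natAbs, Int.abs_eq_natAbs] at h5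
  exact_mod_cast h5

instance : IsPrincipalIdealRing CR := ⟨by
  intro I
  by_cases h0 : I = ⊥
  · rw [h0]; exact ⟨0, by simp⟩
  · have hex : ∃ k : ℕ, ∃ b ∈ I, b ≠ 0 ∧ (nm b).natAbs = k := by
      obtain ⟨b, hb, hb0⟩ := Submodule.exists_mem_ne_zero_of_ne_bot h0
      exact ⟨_, b, hb, hb0, rfl⟩
    classical
    obtain ⟨b, hb, hb0, hbk⟩ := Nat.find_spec hex
    refine ⟨b, le_antisymm ?_ ?_⟩
    · intro a ha
      obtain ⟨q, hq⟩ := euc a b hb0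
      by_cases hz : a - b * q = 0
      · have : a = q • b := by rw [smul_eq_mul]; linear_combination hz
        rw [this]
        exact Submodule.smul_mem _ _ (Submodule.mem_span_singleton_self b)
      · exfalso
        have := Nat.find_min' hex ⟨a - b * q, I.sub_mem ha (I.mul_mem_right _ hb), hz, rfl⟩
        omega
    · rw [Submodule.span_singleton_le_iff_mem]
      exact hb⟩

end CR

namespace CR

/-- the cube root of two -/
def c : CR := ⟨0, 1, 0⟩
/-- the prime of norm 5 -/
def pp : CR := ⟨1, 0, 1⟩
/-- the prime of norm 25 -/
def qq : CR := ⟨1, 2, -1⟩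

lemma hc : c ^ 3 = 2 := by decide
lemma hpp : pp = 1 + c ^ 2 := by decide
lemma hqq : qq = 1 + 2 * c - c ^ 2 := by decide
lemma pq5 : pp * qq = 5 := by decide

lemma nm_unit_iff (x : CR) : IsUnit x ↔ (nm x = 1 ∨ nm x = -1) := by
  constructor
  · intro h
    obtain ⟨y, hy⟩ := h.exists_right_inv
    have h1 : nm x * nm y = 1 := by rw [← nm_mul, hy]; simp [nm]
    exact Int.isUnit_iff.1 (IsUnit.of_mul_eq_one _ h1)
  · rintro (h | h)
    · exact IsUnit.of_mul_eq_one (adj x) (by rw [mul_adj, h]; simp)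
    · exact IsUnit.of_mul_eq_one (-adj x) (by rw [mul_neg, mul_adj, h]; simp)

lemma c_dvd (x : CR) : c ∣ x ↔ 2 ∣ x.r := by
  constructor
  · rintro ⟨y, rfl⟩; simp [c]
  · rintro ⟨k, hk⟩
    exact ⟨⟨x.s, x.t, k⟩, by ext <;> simp [c, hk]⟩

lemma two_dvd (n : ℤ) (x : CR) : (n : CR) ∣ x ↔ n ∣ x.r ∧ n ∣ x.s ∧ n ∣ x.t := by
  constructor
  · rintro ⟨y, rfl⟩; simp
  · rintro ⟨⟨a, ha⟩, ⟨b, hb⟩, ⟨d, hd⟩⟩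
    exact ⟨⟨a, b, d⟩, by ext <;> simp [ha, hb, hd]⟩

lemma pp_dvd (x : CR) : pp ∣ x ↔ 5 ∣ x.r + 3 * x.s + 4 * x.t := by
  constructor
  · rintro ⟨y, rfl⟩; simp only [pp, mul_r, mul_s, mul_t]; omega
  · intro h
    refine ⟨⟨(x.r - 2 * x.s + 4 * x.t) / 5, (2 * x.r + x.s - 2 * x.t) / 5,
      (-x.r + 2 * x.s + x.t) / 5⟩, ?_⟩
    ext <;> simp only [pp, mul_r, mul_s, mul_t] <;> omega

lemma qq_dvd (x : CR) : qq ∣ x ↔ 5 ∣ x.r + x.t ∧ 5 ∣ x.s + 2 * x.t := by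
  constructor
  · rintro ⟨y, rfl⟩; simp only [qq, mul_r, mul_s, mul_t]; omega
  · rintro ⟨h, h'⟩
    refine ⟨⟨(x.r + 2 * x.s) / 5, (x.s + 2 * x.t) / 5, (x.r + x.t) / 5⟩, ?_⟩
    ext <;> simp only [qq, mul_r, mul_s, mul_t] <;> omega

lemma c_prime : Prime c := by
  refine ⟨by decide, ?_, ?_⟩
  · rw [nm_unit_iff]; decide
  · intro a b h
    rw [c_dvd] at *
    rw [c_dvd]
    simp only [mul_r] at h
    have : (2 : ℤ) ∣ a.r * b.r := by omega
    exact Int.prime_two.dvd_or_dvd this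

lemma pp_prime : Prime pp := by
  refine ⟨by decide, ?_, ?_⟩
  · rw [nm_unit_iff]; decide
  · intro a b h
    rw [pp_dvd] at *
    rw [pp_dvd]
    have h5 : Prime (5 : ℤ) := Int.prime_iff_natAbs_prime.2 (by norm_num)
    apply h5.dvd_or_dvd
    simp only [mul_r, mul_s, mul_t] at h
    obtain ⟨k, hk⟩ := h
    refine ⟨k + a.s * b.s + a.s * b.t * 2 + a.t * b.s * 2 + 2 * a.t * b.t, ?_⟩
    linear_combination hk

lemma z5 (n : ℤ) : (5 : ℤ) ∣ n ↔ (n : ZMod 5) = 0 := by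
  rw [ZMod.intCast_zmod_eq_zero_iff_dvd]; simp

lemma qq_prime : Prime qq := by
  refine ⟨by decide, ?_, ?_⟩
  · rw [nm_unit_iff]; decide
  · intro a b h
    rw [qq_dvd, z5, z5] at *
    rw [qq_dvd, z5, z5]
    simp only [mul_r, mul_s, mul_t] at h
    push_cast at *
    generalize (a.r : ZMod 5) = a1 at *
    generalize (a.s : ZMod 5) = a2 at *
    generalize (a.t : ZMod 5) = a3 at *
    generalize (b.r : ZMod 5) = b1 at *
    generalize (b.s : ZMod 5) = b2 at *
    generalize (b.t : ZMod 5) = b3 at *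
    have key : ∀ A B A' B' : ZMod 5, A * A' + B * B' = 0 → A * B' + A' * B + 2 * (B * B') = 0 →
      (A = 0 ∧ B = 0) ∨ (A' = 0 ∧ B' = 0) := by decide
    have e5 : (5 : ZMod 5) = 0 := by decide
    apply key
    · linear_combination h.1 + a3 * b3 * e5
    · linear_combination h.2 + 2 * a3 * b3 * e5 + (a3 * b2 + b3 * a2) * e5

/-- `pp` is not a square modulo `qq` (both signs, as `-1` is a square) -/
lemma ns (x y : CR) (h : qq ∣ x ^ 2 - pp * y ^ 2 ∨ qq ∣ x ^ 2 + pp * y ^ 2) : qq ∣ x ∧ qq ∣ y := by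
  have key : ∀ A B A' B' : ZMod 5,
      ((A * A + B * B - (2 * (A' * A' + B' * B') + 2 * (2 * (A' * B') + 2 * (B' * B'))) = 0 ∧
      2 * (A * B) + 2 * (B * B) - (2 * (A' * A' + B' * B') + 6 * (2 * (A' * B') + 2 * (B' * B'))) = 0)
      ∨ (A * A + B * B + (2 * (A' * A' + B' * B') + 2 * (2 * (A' * B') + 2 * (B' * B'))) = 0 ∧
      2 * (A * B) + 2 * (B * B) + (2 * (A' * A' + B' * B') + 6 * (2 * (A' * B') + 2 * (B' * B'))) = 0))
      → (A = 0 ∧ B = 0) ∧ (A' = 0 ∧ B' = 0) := by decide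
  have e5 : (5 : ZMod 5) = 0 := by decide
  rw [qq_dvd, qq_dvd, z5, z5, z5, z5] at h
  rw [qq_dvd, qq_dvd, z5, z5, z5, z5]
  simp only [pow_two, pp, mul_r, mul_s, mul_t, sub_r, sub_s, sub_t, add_r, add_s, add_t] at h
  push_cast at *
  generalize (x.r : ZMod 5) = a1 at *
  generalize (x.s : ZMod 5) = a2 at *
  generalize (x.t : ZMod 5) = a3 at *
  generalize (y.r : ZMod 5) = b1 at *
  generalize (y.s : ZMod 5) = b2 at *
  generalize (y.t : ZMod 5) = b3 at *
  apply key
  rcases h with ⟨h, h'⟩ | ⟨h, h'⟩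
  · left
    ring_nf at h h' ⊢
    constructor
    · linear_combination h + (a3^2 - 6*b3^2 - 2*b1*b3-4*b2*b3-b2^2)*e5
    · linear_combination h' + (2*a2*a3+2*a3^2-2*b1*b2-4*b1*b3-12*b2*b3-2*b2^2-16*b3^2)*e5
  · right
    constructor
    · linear_combination h + (a3^2 + 6*b3^2 + 2*b1*b3+4*b2*b3+b2^2)*e5
    · linear_combination h' + (2*a2*a3+2*a3^2+2*b1*b2+4*b1*b3+12*b2*b3+2*b2^2+16*b3^2)*e5

end CR

namespace CR

/-- real cube root of two -/
noncomputable def cr : ℝ := (2 : ℝ) ^ ((1 : ℝ) / 3)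

lemma cr3 : cr ^ 3 = 2 := by
  unfold cr
  rw [← Real.rpow_natCast, ← Real.rpow_mul (by norm_num)]
  norm_num

lemma cr_pos : 0 < cr := by unfold cr; positivity

lemma cr_lo : 1.25 < cr := by
  by_contra h
  rw [not_lt] at h
  have := pow_le_pow_left₀ cr_pos.le h 3
  rw [cr3] at this; norm_num at this

lemma cr_hi : cr < 1.26 := by
  by_contra h
  rw [not_lt] at h
  have := pow_le_pow_left₀ (by norm_num) h 3
  rw [cr3] at this; norm_num at this

/-- real embedding -/
noncomputable def phi : CR →+* ℝ where
  toFun x := x.r + x.s * cr + x.t * cr ^ 2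
  map_one' := by simp
  map_zero' := by simp
  map_add' x y := by simp; ring
  map_mul' x y := by
    simp only [mul_r, mul_s, mul_t]; push_cast
    have := cr3
    linear_combination (-(x.s * y.t : ℝ) - x.t * y.s - x.t * y.t * cr) * this

lemma phi_apply (x : CR) : phi x = x.r + x.s * cr + x.t * cr ^ 2 := rfl

/-- the fundamental unit -/
def uu : CRˣ := ⟨⟨1, 1, 1⟩, ⟨-1, 1, 0⟩, by decide, by decide⟩

lemma unit_small (x : CR) (h : nm x = 1) (h1 : 1 ≤ phi x) (h2 : phi x < 3.85) :
    x = 1 ∨ x = ⟨1, 1, 1⟩ := by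
  obtain ⟨a, b, d⟩ := x
  rw [phi_apply] at h1 h2
  simp only at h1 h2
  have hN : ((a : ℝ) + b * cr + d * cr ^ 2) * (((a : ℝ) - b * cr) ^ 2 + ((a : ℝ) - d * cr ^ 2) ^ 2 +
      ((b : ℝ) * cr - d * cr ^ 2) ^ 2) = 2 := by
    have : (a : ℝ) ^ 3 + 2 * b ^ 3 + 4 * d ^ 3 - 6 * a * b * d = 1 := by
      have : a ^ 3 + 2 * b ^ 3 + 4 * d ^ 3 - 6 * a * b * d = 1 := h
      exact_mod_cast this
    have h3 := cr3
    linear_combination 2 * this + (2 * (b : ℝ) ^ 3 + 2 * d ^ 3 * (cr ^ 3 + 2) - 6 * a * b * d) * h3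
  set S := (((a : ℝ) - b * cr) ^ 2 + ((a : ℝ) - d * cr ^ 2) ^ 2 +
      ((b : ℝ) * cr - d * cr ^ 2) ^ 2) with hS
  have hS0 : 0 ≤ S := by positivity
  have hS2 : S ≤ 2 := by nlinarith
  have l1 := cr_lo
  have l2 := cr_hi
  have q1 : 1.5625 < cr ^ 2 := by nlinarith
  have q2 : cr ^ 2 < 1.5876 := by nlinarith
  generalize hX : (a : ℝ) - b * cr = X at *
  generalize hY : (a : ℝ) - d * cr ^ 2 = Y at *
  generalize hZ : (b : ℝ) * cr - d * cr ^ 2 = Z at *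
  have bd : ∀ A B C : ℝ, A ^ 2 + B ^ 2 + C ^ 2 ≤ 2 → A + B ≤ 2 ∧ -2 ≤ A + B := by
    intro A B C h
    constructor <;> nlinarith [sq_nonneg (A - B), sq_nonneg C, sq_nonneg (A + B - 2), sq_nonneg (A + B + 2), sq_nonneg (A - 1), sq_nonneg (B - 1), sq_nonneg (A + 1), sq_nonneg (B + 1)]
  have b1 := bd X Y Z (by linarith)
  have b2 := bd (-X) Z Y (by nlinarith)
  have b3 := bd (-Y) (-Z) X (by nlinarith)
  have ha1 : (a : ℝ) < 2 := by linarith [b1.1]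
  have ha0 : (-1 : ℝ) < a := by linarith [b1.2]
  have hb1 : (b : ℝ) < 2 := by
    have : (b : ℝ) * cr < 2 := by linarith [b2.1]
    nlinarith
  have hb0 : (-1 : ℝ) < b := by
    have : (b : ℝ) * cr > -1/2 := by linarith [b2.2]
    nlinarith
  have hd1 : (d : ℝ) < 2 := by
    have : (d : ℝ) * cr ^ 2 < 2 := by linarith [b3.1]
    nlinarith
  have hd0 : (-1 : ℝ) < d := by
    have : (d : ℝ) * cr ^ 2 > -1/2 := by linarith [b3.2]
    nlinarith
  have ha1 : a < 2 := by exact_mod_cast ha1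
  have ha0 : -1 < a := by exact_mod_cast ha0
  have hb1 : b < 2 := by exact_mod_cast hb1
  have hb0 : -1 < b := by exact_mod_cast hb0
  have hd1 : d < 2 := by exact_mod_cast hd1
  have hd0 : -1 < d := by exact_mod_cast hd0
  clear * - h ha1 ha0 hb1 hb0 hd1 hd0
  interval_cases a <;> interval_cases b <;> interval_cases d <;> revert h <;> decide

lemma phi_pos (x : CR) (h : nm x = 1) : 0 < phi x := by
  obtain ⟨a, b, d⟩ := x
  rw [phi_apply]
  simp only
  have hN : ((a : ℝ) + b * cr + d * cr ^ 2) * (((a : ℝ) - b * cr) ^ 2 + ((a : ℝ) - d * cr ^ 2) ^ 2 +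
      ((b : ℝ) * cr - d * cr ^ 2) ^ 2) = 2 := by
    have : (a : ℝ) ^ 3 + 2 * b ^ 3 + 4 * d ^ 3 - 6 * a * b * d = 1 := by
      have : a ^ 3 + 2 * b ^ 3 + 4 * d ^ 3 - 6 * a * b * d = 1 := h
      exact_mod_cast this
    have h3 := cr3
    linear_combination 2 * this + (2 * (b : ℝ) ^ 3 + 2 * d ^ 3 * (cr ^ 3 + 2) - 6 * a * b * d) * h3
  by_contra hh
  rw [not_lt] at hh
  have := mul_nonpos_of_nonpos_of_nonneg hh (show (0:ℝ) ≤ (((a : ℝ) - b * cr) ^ 2 + ((a : ℝ) - d * cr ^ 2) ^ 2 +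
      ((b : ℝ) * cr - d * cr ^ 2) ^ 2) by positivity)
  linarith

lemma nm_uu_zpow (n : ℤ) : nm ((uu ^ n : CRˣ) : CR) = 1 := by
  let f : CR →* ℤ := ⟨⟨nm, by simp [nm]⟩, nm_mul⟩
  have h : Units.map f uu = 1 := by ext; rfl
  have : Units.map f (uu ^ n) = 1 := by rw [map_zpow, h, one_zpow]
  exact congrArg Units.val this

lemma units_pos (x : CR) (h : nm x = 1) : ∃ n : ℤ, x = ((uu ^ n : CRˣ) : CR) := by
  have hw : (1 : ℝ) < phi (uu : CR) := by
    show (1 : ℝ) < phi ⟨1, 1, 1⟩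
    rw [phi_apply]; simp only; push_cast; nlinarith [cr_pos]
  obtain ⟨n, hn1, hn2⟩ := exists_mem_Ico_zpow (phi_pos x h) hw
  have hz : ∀ n : ℤ, phi ((uu ^ n : CRˣ) : CR) = phi (uu : CR) ^ n := by
    intro n
    have : Units.map (phi : CR →* ℝ) (uu ^ n) = Units.map (phi : CR →* ℝ) uu ^ n := map_zpow _ _ _
    have := congrArg Units.val this
    rw [Units.val_zpow_eq_zpow_val] at this
    exact this
  set y : CR := x * ((uu ^ (-n) : CRˣ) : CR) with hy
  have hny : nm y = 1 := by rw [hy, nm_mul, h, nm_uu_zpow, one_mul]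
  have hwp : 0 < phi (uu : CR) := by linarith
  have hphi : phi y = phi x * phi (uu : CR) ^ (-n) := by rw [hy, map_mul, hz]
  have hpn : 0 < phi (uu : CR) ^ n := zpow_pos hwp n
  have hxy : x = y * ((uu ^ n : CRˣ) : CR) := by
    rw [hy, mul_assoc, ← Units.val_mul, ← zpow_add]; simp
  have e1 : 1 ≤ phi y := by
    rw [hphi, zpow_neg, ← div_eq_mul_inv, le_div_iff₀ hpn]; linarith
  have e2 : phi y < 3.85 := by
    rw [hphi, zpow_neg, ← div_eq_mul_inv, div_lt_iff₀ hpn]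
    rw [zpow_add_one₀ hwp.ne'] at hn2
    have : phi (uu : CR) < 3.85 := by
      show phi ⟨1, 1, 1⟩ < 3.85
      rw [phi_apply]; simp
      have := cr_hi
      have := cr_pos
      nlinarith
    nlinarith
  rcases unit_small y hny e1 e2 with h | h
  · exact ⟨n, by rw [hxy, h, one_mul]⟩
  · refine ⟨1 + n, ?_⟩
    rw [hxy, h, zpow_add, zpow_one, Units.val_mul]; rfl

/-- the eight square classes -/
def G4 : List CR := [1, -1, ⟨-1, 1, 0⟩, ⟨1, -1, 0⟩]

lemma units_cls (x : CR) (h : IsUnit x) : ∃ w ∈ G4, ∃ v, x = w * v ^ 2 := by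
  have pos : ∀ x : CR, nm x = 1 → ∃ w : CR, (w = 1 ∨ w = ⟨-1, 1, 0⟩) ∧ ∃ v, x = w * v ^ 2 := by
    intro x hx
    obtain ⟨n, rfl⟩ := units_pos x hx
    rcases Int.even_or_odd' n with ⟨m, rfl | rfl⟩
    · refine ⟨1, Or.inl rfl, ((uu ^ m : CRˣ) : CR), ?_⟩
      rw [one_mul, ← Units.val_pow_eq_pow_val, ← zpow_natCast, ← zpow_mul, mul_comm]; rfl
    · refine ⟨_, Or.inr rfl, ((uu ^ m : CRˣ) : CR) * uu, ?_⟩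
      rw [zpow_add, zpow_one, Units.val_mul, mul_pow, ← Units.val_pow_eq_pow_val (uu ^ m), ← zpow_natCast, ← zpow_mul, mul_comm (2 : ℤ)]
      have : (uu : CR) = ⟨-1, 1, 0⟩ * (uu : CR) ^ 2 := by decide
      conv_lhs => rw [this]
      push_cast; ring
  rcases (nm_unit_iff x).1 h with h | h
  · obtain ⟨w, hw, v, hv⟩ := pos x h
    refine ⟨w, ?_, v, hv⟩
    rcases hw with rfl | rfl <;> decide
  · obtain ⟨w, hw, v, hv⟩ := pos (-x) (by simp only [nm, neg_r, neg_s, neg_t] at h ⊢; linarith)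
    refine ⟨-w, ?_, v, by linear_combination -hv⟩
    rcases hw with rfl | rfl <;> decide

end CR

namespace CR

/-- representatives of the square classes generated by `-1, u, π` -/
def G8 : List CR := [1, -1, ⟨-1, 1, 0⟩, ⟨1, -1, 0⟩, ⟨1, 0, 1⟩, ⟨-1, 0, -1⟩, ⟨1, 1, -1⟩, ⟨-1, -1, 1⟩]

/-- lies in the group generated by `-1, u, π` and squares -/
def Cls (a : CR) : Prop := ∃ g ∈ G8, ∃ t, a = g * t ^ 2

lemma pp_factor (a : CR) (ha : a ≠ 0) : ∃ n x, ¬ pp ∣ x ∧ a = pp ^ n * x :=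
  WfDvdMonoid.max_power_factor ha pp_prime.irreducible

lemma cls_of {a b s E : CR} (hE : E = 1 ∨ E = pp) (h : a * b = E * s ^ 2) (hs : s ≠ 0)
    (hp : ∀ p, Prime p → p ∣ a → p ∣ b → p ∣ pp) : Cls a := by
  have hE' : ∃ e : ℕ, E = pp ^ e := by
    rcases hE with rfl | rfl
    · exact ⟨0, by simp⟩
    · exact ⟨1, by simp⟩
  obtain ⟨e, rfl⟩ := hE'
  have hpp0 := pp_prime.ne_zero
  have hne : a * b ≠ 0 := by
    rw [h]; exact mul_ne_zero (pow_ne_zero _ hpp0) (pow_ne_zero _ hs)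
  obtain ⟨i, a', ha', rfl⟩ := pp_factor a (left_ne_zero_of_mul hne)
  obtain ⟨j, b', hb', rfl⟩ := pp_factor b (right_ne_zero_of_mul hne)
  obtain ⟨k, s', hs', rfl⟩ := pp_factor s hs
  have h1 : pp ^ (i + j) * (a' * b') = pp ^ (e + 2 * k) * s' ^ 2 := by
    rw [pow_add, pow_add, pow_mul]; linear_combination h
  have nab : ¬ pp ∣ a' * b' := fun hh => by
    rcases pp_prime.dvd_or_dvd hh with h | h
    · exact ha' h
    · exact hb' h
  have nss : ¬ pp ∣ s' ^ 2 := fun hh => hs' (pp_prime.dvd_of_dvd_pow hh)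
  have hij : i + j = e + 2 * k := by
    have d1 : pp ^ (i + j) ∣ pp ^ (e + 2 * k) := by
      apply pp_prime.pow_dvd_of_dvd_mul_right _ nss
      rw [← h1]; exact dvd_mul_right _ _
    have d2 : pp ^ (e + 2 * k) ∣ pp ^ (i + j) := by
      apply pp_prime.pow_dvd_of_dvd_mul_right _ nab
      rw [h1]; exact dvd_mul_right _ _
    rw [pow_dvd_pow_iff hpp0 pp_prime.not_isUnit] at d1 d2
    omega
  rw [hij] at h1
  have h2 : a' * b' = s' ^ 2 := mul_left_cancel₀ (pow_ne_zero _ hpp0) h1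
  have hcop : IsCoprime a' b' := by
    apply isCoprime_of_prime_dvd
    · rintro ⟨rfl, _⟩; exact ha' (dvd_zero _)
    · intro z hz hza hzb
      have hzp := hp z hz (dvd_mul_of_dvd_right hza _) (dvd_mul_of_dvd_right hzb _)
      have := (hz.associated_of_dvd pp_prime hzp)
      exact ha' (this.symm.dvd.trans hza)
  obtain ⟨d, v, hv⟩ := exists_associated_pow_of_mul_eq_pow' hcop h2
  obtain ⟨w, hw, y, hy⟩ := units_cls v v.isUnit
  have ha : a' = w * (d * y) ^ 2 := by rw [← hv, hy]; ring
  rcases Nat.even_or_odd' i with ⟨m, rfl | rfl⟩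
  · refine ⟨w, ?_, pp ^ m * (d * y), ?_⟩
    · clear hy ha; revert w; decide
    · rw [ha, pow_mul, mul_pow (pp ^ m), ← pow_mul, ← pow_mul, mul_comm 2 m]; ring
  · refine ⟨w * pp, ?_, pp ^ m * (d * y), ?_⟩
    · clear hy ha; revert w; decide
    · rw [ha]; ring

lemma c3_dvd (x : CR) : c ^ 3 ∣ x ↔ 2 ∣ x.r ∧ 2 ∣ x.s ∧ 2 ∣ x.t := by
  rw [show c ^ 3 = ((2 : ℤ) : CR) by decide, two_dvd]
lemma c6_dvd (x : CR) : c ^ 6 ∣ x ↔ 4 ∣ x.r ∧ 4 ∣ x.s ∧ 4 ∣ x.t := by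
  rw [show c ^ 6 = ((4 : ℤ) : CR) by decide, two_dvd]
lemma c9_dvd (x : CR) : c ^ 9 ∣ x ↔ 8 ∣ x.r ∧ 8 ∣ x.s ∧ 8 ∣ x.t := by
  rw [show c ^ 9 = ((8 : ℤ) : CR) by decide, two_dvd]
lemma c7_dvd (x : CR) : c ^ 7 ∣ x ↔ 8 ∣ x.r ∧ 4 ∣ x.s ∧ 4 ∣ x.t := by
  rw [show c ^ 7 = ⟨0, 4, 0⟩ by decide]
  constructor
  · rintro ⟨y, rfl⟩; simp only [mul_r, mul_s, mul_t]; omega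
  · rintro ⟨⟨a, ha⟩, ⟨b, hb⟩, ⟨d, hd⟩⟩
    exact ⟨⟨b, d, a⟩, by ext <;> simp [ha, hb, hd]; ring⟩
lemma c10_dvd (x : CR) : c ^ 10 ∣ x ↔ 16 ∣ x.r ∧ 8 ∣ x.s ∧ 8 ∣ x.t := by
  rw [show c ^ 10 = ⟨0, 8, 0⟩ by decide]
  constructor
  · rintro ⟨y, rfl⟩; simp only [mul_r, mul_s, mul_t]; omega
  · rintro ⟨⟨a, ha⟩, ⟨b, hb⟩, ⟨d, hd⟩⟩
    exact ⟨⟨b, d, a⟩, by ext <;> simp [ha, hb, hd]; ring⟩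

instance (x : CR) : Decidable (c ∣ x) := decidable_of_iff _ (c_dvd x).symm
instance (x : CR) : Decidable (c ^ 3 ∣ x) := decidable_of_iff _ (c3_dvd x).symm
instance (x : CR) : Decidable (c ^ 6 ∣ x) := decidable_of_iff _ (c6_dvd x).symm
instance (x : CR) : Decidable (c ^ 7 ∣ x) := decidable_of_iff _ (c7_dvd x).symm
instance (x : CR) : Decidable (c ^ 9 ∣ x) := decidable_of_iff _ (c9_dvd x).symm
instance (x : CR) : Decidable (c ^ 10 ∣ x) := decidable_of_iff _ (c10_dvd x).symm

/-- quotient map modulo `c ^ n` -/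
def md (n : ℕ) : CR →+* CR ⧸ Ideal.span {c ^ n} := Ideal.Quotient.mk _

lemma md_eq {n : ℕ} {x y : CR} : md n x = md n y ↔ c ^ n ∣ x - y := by
  unfold md; rw [Ideal.Quotient.eq, Ideal.mem_span_singleton]

lemma md_zero {n : ℕ} {x : CR} : md n x = 0 ↔ c ^ n ∣ x := by
  rw [← map_zero (md n), md_eq, sub_zero]

lemma md_mono {n m : ℕ} (h : m ≤ n) {x y : CR} (hx : md n x = md n y) : md m x = md m y := by
  rw [md_eq] at *; exact (pow_dvd_pow c h).trans hx

lemma md_c (n : ℕ) : md n c ^ n = 0 := by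
  rw [← map_pow, md_zero]

/-- odd elements -/
def Od (x : CR) : Prop := ¬ c ∣ x

lemma od_r {x : CR} : Od x ↔ x.r % 2 = 1 := by unfold Od; rw [c_dvd]; omega
instance (x : CR) : Decidable (Od x) := decidable_of_iff _ od_r.symm

lemma Od.mul {x y : CR} (hx : Od x) (hy : Od y) : Od (x * y) := fun h =>
  (c_prime.dvd_or_dvd h).elim hx hy
lemma Od.pow {x : CR} (hx : Od x) (n : ℕ) : Od (x ^ n) := fun h =>
  hx (c_prime.dvd_of_dvd_pow h)
lemma Od.left {x y : CR} (h : Od (x * y)) : Od x := fun hh => h (dvd_mul_of_dvd_left hh _)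
lemma Od.right {x y : CR} (h : Od (x * y)) : Od y := fun hh => h (dvd_mul_of_dvd_right hh _)
lemma Od.of_pow {x : CR} {n : ℕ} (hn : n ≠ 0) (h : Od (x ^ n)) : Od x := fun hh => h (dvd_pow hh hn)
lemma Od.ne_zero {x : CR} (h : Od x) : x ≠ 0 := by rintro rfl; exact h (dvd_zero _)
lemma Od.neg {x : CR} (h : Od x) : Od (-x) := fun hh => h ((dvd_neg).1 hh)
lemma Od.congr {x y : CR} (h : Od x) (hxy : c ∣ x - y) : Od y := fun hh =>
  h (by simpa using dvd_add hxy hh)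
lemma Od.congr_md {x y : CR} {n : ℕ} (h : Od x) (hn : n ≠ 0) (hxy : md n x = md n y) : Od y :=
  h.congr ((dvd_pow_self c hn).trans (md_eq.1 hxy))

lemma od_inv (n : ℕ) {x : CR} (h : Od x) : ∃ y, Od y ∧ md n x * md n y = 1 := by
  have : IsCoprime x (c ^ (n + 1)) := by
    apply IsCoprime.pow_right
    exact ((Prime.coprime_iff_not_dvd c_prime).2 h).symm
  obtain ⟨a, b, hab⟩ := this
  refine ⟨a, ?_, ?_⟩
  · intro ha
    have : c ∣ 1 := by
      rw [← hab]
      exact dvd_add (dvd_mul_of_dvd_left ha _) (dvd_mul_of_dvd_right (dvd_pow_self c (by omega)) _)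
    exact c_prime.not_dvd_one this
  · rw [← map_mul, ← map_one (md n), md_eq]
    exact ⟨-(b * c), by linear_combination hab⟩

/-- representatives of odd classes modulo `c ^ 7` -/
def O64 : List CR := [1, 3, 5, 7].flatMap fun r => [0, 1, 2, 3].flatMap fun s =>
  [0, 1, 2, 3].map fun t => ⟨r, s, t⟩

/-- odd squares modulo `c ^ 7` -/
def SQ4 : List CR := [⟨1, 0, 0⟩, ⟨1, 2, 2⟩, ⟨1, 2, 1⟩, ⟨5, 0, 3⟩]

lemma rep64 {x : CR} (h : Od x) : ∃ y ∈ O64, md 7 x = md 7 y := by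
  rw [od_r] at h
  refine ⟨⟨x.r % 8, x.s % 4, x.t % 4⟩, ?_, ?_⟩
  · have h1 : x.r % 8 = 1 ∨ x.r % 8 = 3 ∨ x.r % 8 = 5 ∨ x.r % 8 = 7 := by omega
    have h2 : x.s % 4 = 0 ∨ x.s % 4 = 1 ∨ x.s % 4 = 2 ∨ x.s % 4 = 3 := by omega
    have h3 : x.t % 4 = 0 ∨ x.t % 4 = 1 ∨ x.t % 4 = 2 ∨ x.t % 4 = 3 := by omega
    simp only [O64, List.mem_flatMap, List.mem_map, List.mem_cons, List.not_mem_nil, or_false]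
    exact ⟨_, h1, _, h2, _, h3, rfl⟩
  · rw [md_eq, c7_dvd]; simp only [sub_r, sub_s, sub_t]; omega

lemma sq_rep10 {x : CR} (h : Od x) : ∃ y ∈ O64, md 10 x ^ 2 = md 10 y ^ 2 ∧ md 7 x = md 7 y := by
  obtain ⟨y, hy, hxy⟩ := rep64 h
  refine ⟨y, hy, ?_, hxy⟩
  rw [md_eq] at hxy
  obtain ⟨w, hw⟩ := hxy
  rw [← map_pow, ← map_pow, md_eq]
  refine ⟨w * (y + c ^ 4 * w), ?_⟩
  have hx : x = y + c ^ 7 * w := by linear_combination hw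
  have := hc
  subst hx
  linear_combination (-w * y * c ^ 7 - w ^ 2 * c ^ 11 * 0) * this

lemma sq_rep7 {x : CR} (h : Od x) : ∃ s ∈ SQ4, md 7 x ^ 2 = md 7 s := by
  obtain ⟨y, hy, hxy⟩ := rep64 h
  have key : ∀ y ∈ O64, ∃ s ∈ SQ4, c ^ 7 ∣ y ^ 2 - s := by decide +kernel
  obtain ⟨s, hs, hys⟩ := key y hy
  exact ⟨s, hs, by rw [hxy, ← map_pow, md_eq]; exact hys⟩

/-- square roots: equality of squares modulo `c ^ (n + 6)` -/
lemma sqrt_md {n : ℕ} {s t : CR} (ht : Od t) (h : md (n + 6) s ^ 2 = md (n + 6) t ^ 2) :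
    md (n + 3) s = md (n + 3) t ∨ md (n + 3) s = md (n + 3) (-t) := by
  rw [← map_pow, ← map_pow, md_eq] at h
  have h0 : c ^ (n + 6) ∣ (s - t) * ((s - t) + c ^ 3 * t) := by
    convert h using 1; rw [hc]; ring
  have step : ∀ (m i : ℕ) (x : CR), i ≥ 1 → c ^ (m + 2) ∣ x * (x + c ^ i * t) →
      ∃ y, x = c * y ∧ c ^ m ∣ y * (y + c ^ (i - 1) * t) := by
    intro m i x hi hx
    obtain ⟨i, rfl⟩ : ∃ j, i = j + 1 := ⟨i - 1, by omega⟩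
    have hcx : c ∣ x := by
      have h1 : c ∣ x * (x + c ^ (i + 1) * t) := (dvd_pow_self c (by omega)).trans hx
      rcases c_prime.dvd_or_dvd h1 with h | h
      · exact h
      · have : c ∣ c ^ (i + 1) * t := dvd_mul_of_dvd_left (dvd_pow_self c (by omega)) _
        exact (dvd_add_left this).1 h
    obtain ⟨y, rfl⟩ := hcx
    refine ⟨y, rfl, ?_⟩
    have : c ^ 2 * c ^ m ∣ c ^ 2 * (y * (y + c ^ i * t)) := by
      convert hx using 1 <;> ring
    exact (mul_dvd_mul_iff_left (pow_ne_zero 2 c_prime.ne_zero)).1 this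
  obtain ⟨x1, e1, h1⟩ := step (n + 4) 3 _ (by omega) h0
  obtain ⟨x2, e2, h2⟩ := step (n + 2) 2 _ (by omega) h1
  obtain ⟨x3, e3, h3⟩ := step n 1 _ (by omega) h2
  simp only [Nat.sub_self, pow_zero, one_mul] at h3
  have hst : s - t = c ^ 3 * x3 := by rw [e1, e2, e3]; ring
  by_cases hx : c ∣ x3
  · left
    have : ¬ c ∣ x3 + t := fun hh => ht ((dvd_add_right hx).1 hh)
    have := c_prime.pow_dvd_of_dvd_mul_right n this h3
    rw [md_eq, hst, pow_add, mul_comm]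
    exact mul_dvd_mul_left _ this
  · right
    have := c_prime.pow_dvd_of_dvd_mul_left n hx h3
    rw [md_eq, show s - -t = c ^ 3 * (x3 + t) by rw [mul_add, ← hst, hc]; ring, pow_add, mul_comm]
    exact mul_dvd_mul_left _ this

lemma two_md3 (x : CR) : md 3 (-x) = md 3 x := by
  rw [md_eq]; exact ⟨-x, by rw [hc]; ring⟩

lemma sqrt_md3 {n : ℕ} {s t : CR} (ht : Od t) (h : md (n + 6) s ^ 2 = md (n + 6) t ^ 2) :
    md 3 s = md 3 t := by
  rcases sqrt_md ht h with h | h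
  · exact md_mono (by omega) h
  · rw [← two_md3 t]; exact md_mono (by omega) h

/-- local information on an odd element of a known class -/
lemma cls_const {a k e : CR} (h : Cls a) (ha : Od a) (hk : Od k) (he : md 7 a = md 7 (e * k ^ 2)) :
    ∃ g ∈ G8, ∃ s ∈ SQ4, ∃ t, a = g * t ^ 2 ∧ Od t ∧ c ^ 7 ∣ g * s - e ∧
      md 7 t ^ 2 = md 7 (s * k ^ 2) := by
  obtain ⟨g, hg, t, rfl⟩ := h
  have ht : Od t := ha.right.of_pow (by norm_num)
  obtain ⟨y, hy, hky⟩ := od_inv 7 hk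
  obtain ⟨s, hs, hts⟩ := sq_rep7 (ht.mul hy)
  have e2 : md 7 t ^ 2 = md 7 (s * k ^ 2) := by
    rw [map_mul, ← hts, map_mul, map_pow]
    linear_combination (-md 7 t ^ 2) * (md 7 k * md 7 y + 1) * hky
  refine ⟨g, hg, s, hs, t, rfl, ht, ?_, e2⟩
  rw [← md_eq]
  simp only [map_mul, map_pow] at he e2 ⊢
  linear_combination (md 7 y) ^ 2 * he - md 7 g * md 7 y ^ 2 * e2 - (md 7 g * md 7 s - md 7 e) * (md 7 k * md 7 y + 1) * hky

/-- class is trivial -/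
lemma cls_one {a k : CR} (h : Cls a) (ha : Od a) (hk : Od k) (he : md 7 a = md 7 (k ^ 2)) :
    ∃ t, a = t ^ 2 ∧ Od t := by
  obtain ⟨g, hg, s, hs, t, h1, h2, h3, h4⟩ := cls_const (e := 1) h ha hk (by rw [one_mul]; exact he)
  have key : ∀ g ∈ G8, ∀ s ∈ SQ4, c ^ 7 ∣ g * s - 1 → g = 1 := by decide +kernel
  rw [key g hg s hs h3, one_mul] at h1
  exact ⟨t, h1, h2⟩

lemma gcd_rm (k l : CR) (h : k ≠ 0 ∨ l ≠ 0) : ∃ g k' l', k = g * k' ∧ l = g * l' ∧ IsCoprime k' l' ∧ g ≠ 0 := by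
  obtain ⟨k', hk⟩ := IsBezout.gcd_dvd_left k l
  obtain ⟨l', hl⟩ := IsBezout.gcd_dvd_right k l
  obtain ⟨a, b, hab⟩ := IsBezout.gcd_eq_sum k l
  set g := IsBezout.gcd k l
  have hg : g ≠ 0 := by
    intro h0; rw [h0, zero_mul] at hk hl; tauto
  refine ⟨g, k', l', hk, hl, ⟨a, b, ?_⟩, hg⟩
  apply mul_left_cancel₀ hg
  rw [mul_one]
  conv_rhs => rw [← hab, hk, hl]
  ring

lemma sq_div {g x y : CR} (h : x ^ 2 = g ^ 2 * y) : ∃ z, x = g * z :=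
  (IsIntegrallyClosed.pow_dvd_pow_iff (n := 2) (by norm_num)).1 ⟨y, h⟩

end CR

namespace CR

lemma split {n : ℕ} {X M N : CR} (hM : Od M) (h : X ^ 2 = M ^ 2 - 4 * N) (hN : c ^ n ∣ N) :
    ∃ a, a * (M - a) = N ∧ c ^ n ∣ M - a := by
  have main : ∀ X : CR, X ^ 2 = M ^ 2 - 4 * N → md (n + 3) X = md (n + 3) M →
      ∃ a, a * (M - a) = N ∧ c ^ n ∣ M - a := by
    intro X h h1
    rw [md_eq] at h1
    obtain ⟨w, hw⟩ := h1
    refine ⟨M + c ^ n * w, ?_, ⟨-w, by ring⟩⟩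
    have h4 : (4 : CR) ≠ 0 := by decide
    apply mul_left_cancel₀ h4
    have hX : X = M + 2 * (c ^ n * w) := by
      rw [pow_add, hc] at hw; linear_combination hw
    rw [hX] at h
    linear_combination -h
  have h2 : md (n + 6) X ^ 2 = md (n + 6) M ^ 2 := by
    rw [← map_pow, ← map_pow, md_eq]
    obtain ⟨w, hw⟩ := hN
    exact ⟨-w, by
      rw [h, hw, pow_add]
      have : c ^ 6 = 4 := by decide
      rw [this]; ring⟩
  rcases sqrt_md hM h2 with h3 | h3
  · exact main X h h3
  · apply main (-X) (by rw [← h]; ring)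
    rw [map_neg, h3, map_neg, neg_neg]

lemma prime_c_of_dvd {p : CR} (hp : Prime p) {n : ℕ} (h : p ∣ c ^ n) : c ∣ p :=
  (hp.associated_of_dvd c_prime (hp.dvd_of_dvd_pow h)).symm.dvd

lemma od_not_c {p x : CR} (hp : Prime p) (hx : Od x) (h : p ∣ x) (n : ℕ) : ¬ p ∣ c ^ n := fun hh =>
  hx ((prime_c_of_dvd hp hh).trans h)

lemma odd_cancel {n : ℕ} {f x : CR} (hf : Od f) (h : c ^ n ∣ f * x) : c ^ n ∣ x :=
  c_prime.pow_dvd_of_dvd_mul_left n hf h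

lemma core {X k l e σ : CR} {m n : ℕ} (he : e = 1 ∨ e = qq) (hσ : σ = 1 ∨ σ = -1)
    (hX : X ^ 2 = k ^ 4 - 4 * σ * pp * (e * c ^ m * l ^ 2) ^ 2) (hk : Od k) (hl : l ≠ 0)
    (hn : c ^ (n + 1) ∣ (c ^ m * l ^ 2) ^ 2) :
    ∃ f k' l' a, k = f * k' ∧ l = f * l' ∧ Od f ∧ Od k' ∧ l' ≠ 0 ∧ Cls a ∧ Od a ∧
      a * (k' ^ 2 - a) = σ * pp * (e * c ^ m * l' ^ 2) ^ 2 ∧ c ^ (n + 1) ∣ k' ^ 2 - a := by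
  obtain ⟨f, k', l', rfl, rfl, hcop, hf⟩ := gcd_rm k l (Or.inr hl)
  have hfo := hk.left
  have hko := hk.right
  have hl' := right_ne_zero_of_mul hl
  obtain ⟨Y, hY⟩ : ∃ Y, X = f ^ 2 * Y := by
    apply sq_div (y := k' ^ 4 - 4 * σ * pp * (e * c ^ m * l' ^ 2) ^ 2)
    rw [hX]; ring
  have hY2 : Y ^ 2 = (k' ^ 2) ^ 2 - 4 * (σ * pp * (e * c ^ m * l' ^ 2) ^ 2) := by
    apply mul_left_cancel₀ (pow_ne_zero 4 hf)
    rw [hY] at hX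
    linear_combination hX
  have hn' : c ^ (n + 1) ∣ (c ^ m * l' ^ 2) ^ 2 := by
    apply odd_cancel (hfo.pow 4)
    convert hn using 1; ring
  have hnN : c ^ (n + 1) ∣ σ * pp * (e * c ^ m * l' ^ 2) ^ 2 := by
    rw [show σ * pp * (e * c ^ m * l' ^ 2) ^ 2 = (c ^ m * l' ^ 2) ^ 2 * (σ * pp * e ^ 2) by ring]
    exact dvd_mul_of_dvd_left hn' _
  obtain ⟨a, ha, hb⟩ := split (hko.pow 2) hY2 hnN
  have hao : Od a := (hko.pow 2).congr ((dvd_pow_self c (by omega)).trans hb)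
  refine ⟨f, k', l', a, rfl, rfl, hfo, hko, hl', ?_, hao, ha, hb⟩
  have he0 : e ≠ 0 := by rcases he with rfl | rfl <;> decide
  have hσ2 : σ * σ = 1 := by rcases hσ with rfl | rfl <;> decide
  apply cls_of (b := σ * (k' ^ 2 - a)) (s := e * c ^ m * l' ^ 2) (Or.inr rfl)
  · linear_combination σ * ha + pp * (e * c ^ m * l' ^ 2) ^ 2 * hσ2
  · exact mul_ne_zero (mul_ne_zero he0 (pow_ne_zero _ c_prime.ne_zero)) (pow_ne_zero _ hl')
  · intro p hp hpa hpb
    have hpb' : p ∣ k' ^ 2 - a := by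
      have := dvd_mul_of_dvd_right hpb σ
      rwa [← mul_assoc, hσ2, one_mul] at this
    have hpk : p ∣ k' := hp.dvd_of_dvd_pow (n := 2) (by simpa using dvd_add hpb' hpa)
    have hpl : ¬ p ∣ l' := fun h => hp.not_dvd_one (by
      obtain ⟨x, y, hxy⟩ := hcop
      rw [← hxy]; exact dvd_add (dvd_mul_of_dvd_right hpk _) (dvd_mul_of_dvd_right h _))
    have hpc := od_not_c hp hao hpa m
    have hpN : p ∣ σ * (σ * pp * (e * c ^ m * l' ^ 2) ^ 2) := by
      rw [← ha]; exact dvd_mul_of_dvd_right (dvd_mul_of_dvd_left hpa _) _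
    rw [show σ * (σ * pp * (e * c ^ m * l' ^ 2) ^ 2) = pp * (e * c ^ m * l' ^ 2) ^ 2 by
      linear_combination (pp * (e * c ^ m * l' ^ 2) ^ 2) * hσ2] at hpN
    rcases hp.dvd_or_dvd hpN with h | h
    · exact h
    exfalso
    have h := hp.dvd_of_dvd_pow h
    rcases hp.dvd_or_dvd h with h | h
    swap
    · exact hpl (hp.dvd_of_dvd_pow h)
    rcases hp.dvd_or_dvd h with h | h
    swap
    · exact hpc h
    rcases he with rfl | rfl
    · exact hp.not_dvd_one h
    have hq : qq ∣ p := (hp.associated_of_dvd qq_prime h).symm.dvd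
    obtain ⟨k1, hk1⟩ := hq.trans hpk
    have hpq := hp.associated_of_dvd qq_prime h
    obtain ⟨Y1, hY1⟩ : qq ∣ Y := by
      apply qq_prime.dvd_of_dvd_pow (n := 2)
      rw [hY2, hk1]
      exact ⟨qq ^ 3 * k1 ^ 4 - qq * (4 * (σ * pp * (c ^ m * l' ^ 2) ^ 2)), by ring⟩
    have h1 : Y1 ^ 2 = qq ^ 2 * k1 ^ 4 - 4 * (σ * pp * (c ^ m * l' ^ 2) ^ 2) := by
      apply mul_left_cancel₀ (pow_ne_zero 2 qq_prime.ne_zero)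
      rw [hY1, hk1] at hY2
      linear_combination hY2
    have h2 := (ns Y1 (2 * (c ^ m * l' ^ 2)) (by
      rcases hσ with rfl | rfl
      · right; exact ⟨qq * k1 ^ 4, by linear_combination h1⟩
      · left; exact ⟨qq * k1 ^ 4, by linear_combination h1⟩)).2
    have h3 := hpq.dvd.trans h2
    rw [← hc] at h3
    rcases hp.dvd_or_dvd h3 with h | h
    · exact od_not_c hp hao hpa 3 h
    rcases hp.dvd_or_dvd h with h | h
    · exact hpc h
    · exact hpl (hp.dvd_of_dvd_pow h)

/-- trivial class with root control -/
lemma cls_root {a k : CR} (h : Cls a) (ha : Od a) (hk : Od k) (hd : c ^ 10 ∣ k ^ 2 - a) :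
    ∃ t, a = t ^ 2 ∧ Od t ∧ md 7 k = md 7 t := by
  have h10 : md 10 (k ^ 2) = md 10 a := by rw [md_eq]; exact hd
  obtain ⟨t, rfl, ht⟩ := cls_one h ha hk (md_mono (by omega) h10.symm)
  rw [map_pow, map_pow] at h10
  rcases sqrt_md (n := 4) ht h10 with h | h
  · exact ⟨t, rfl, ht, h⟩
  · exact ⟨-t, by ring, ht.neg, h⟩

lemma pass {X k l e : CR} {i : ℕ} (he : e = 1 ∨ e = qq)
    (hX : X ^ 2 = k ^ 4 - pp * (e * c ^ i * (2 * l) ^ 2) ^ 2) (hk : Od k) (hl : l ≠ 0)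
    (hn : c ^ 10 ∣ (c ^ i * l ^ 2) ^ 2) :
    ∃ f k' l' X', Od f ∧ Od k' ∧ l' ≠ 0 ∧ l = f * l' ∧ md 7 k = md 7 (f * k') ∧
      X' ^ 2 = k' ^ 4 - pp * (e * c ^ i * l' ^ 2) ^ 2 := by
  have hc3 := hc
  have hX1 : X ^ 2 = k ^ 4 - 4 * 1 * pp * (e * c ^ (i + 3) * l ^ 2) ^ 2 := by
    rw [hX, pow_add, hc]; ring
  obtain ⟨f, k1, l1, a, rfl, rfl, hf, hk1, hl1, hcl, hao, ha, hb⟩ :=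
    core (n := 9) he (Or.inl rfl) hX1 hk hl (by
      rw [show (c ^ (i + 3) * l ^ 2) ^ 2 = (c ^ i * l ^ 2) ^ 2 * c ^ 6 by rw [pow_add]; ring]
      exact dvd_mul_of_dvd_left hn _)
  obtain ⟨p, rfl, hpo, hkp⟩ := cls_root hcl hao hk1 hb
  have hW : (k1 * p) ^ 2 = p ^ 4 - 4 * (-1) * pp * (e * c ^ i * l1 ^ 2) ^ 2 := by
    rw [pow_add, hc] at ha
    linear_combination ha
  obtain ⟨f2, p2, l2, a2, rfl, rfl, hf2, hp2, hl2, hcl2, hao2, ha2, hb2⟩ :=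
    core (n := 9) he (Or.inr rfl) hW hpo hl1 (by
      apply odd_cancel (hf.pow 4)
      convert hn using 1; ring)
  obtain ⟨q, rfl, hqo, hpq⟩ := cls_root hcl2 hao2 hp2 hb2
  refine ⟨f * f2, q, l2, p2 * q, hf.mul hf2, hqo, hl2, by ring, ?_, ?_⟩
  · rw [map_mul, hkp, map_mul, map_mul, map_mul, hpq, mul_assoc]
  · linear_combination ha2

/-- Case I: no solutions -/
lemma caseI_bottom {X k l : CR} (hX : X ^ 2 = k ^ 4 - pp * (2 * l) ^ 4) (hk : Od k) (hl : Od l) : False := by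
  have hX1 : X ^ 2 = k ^ 4 - 4 * 1 * pp * (1 * c ^ 3 * l ^ 2) ^ 2 := by
    rw [hX, hc]; ring
  obtain ⟨f, k1, l1, a, rfl, rfl, hf, hk1, hl1, hcl, hao, ha, hb⟩ :=
    core (n := 5) (Or.inl rfl) (Or.inl rfl) hX1 hk hl.ne_zero ⟨l ^ 4, by ring⟩
  obtain ⟨b, hb⟩ := hb
  have hab : a * b = pp * l1 ^ 4 := by
    apply mul_left_cancel₀ (pow_ne_zero 6 c_prime.ne_zero)
    rw [hb] at ha
    linear_combination ha
  have hbo : Od b := by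
    have : Od (a * b) := by rw [hab]; exact Od.mul (by decide) (hl.right.pow 4)
    exact this.right
  have hd : c ∣ -b - k1 ^ 2 := by
    have h2 := (hk1.pow 2)
    rw [od_r] at h2 hbo
    rw [c_dvd]; simp only [sub_r, neg_r]; omega
  obtain ⟨w, hw⟩ := hd
  have h7 : md 7 a = md 7 ((1 + c ^ 6) * k1 ^ 2) := by
    rw [md_eq]
    exact ⟨w, by linear_combination c ^ 6 * hw - hb⟩
  obtain ⟨g, hg, s, hs, t, h1, h2, h3, h4⟩ := cls_const hcl hao hk1 h7
  have key : ∀ g ∈ G8, ∀ s ∈ SQ4, ¬ c ^ 7 ∣ g * s - (1 + c ^ 6) := by decide +kernel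
  exact key g hg s hs h3

lemma caseI (j : ℕ) : ∀ (X k l : CR), X ^ 2 = k ^ 4 - pp * (2 ^ (j + 1) * l) ^ 4 → Od k → Od l → False := by
  induction j with
  | zero => intro X k l h hk hl; exact caseI_bottom (by simpa using h) hk hl
  | succ j ih =>
    intro X k l h hk hl
    obtain ⟨f, k', l', X', hf, hk', hl', hll, -, hX'⟩ := pass (X := X) (k := k) (l := 2 ^ (j + 1) * l) (i := 0)
      (Or.inl rfl) (by rw [h]; ring) hk (mul_ne_zero (pow_ne_zero _ (by decide)) hl.ne_zero)
      ⟨c ^ 2 * (2 ^ j * l) ^ 4, by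
        have : c ^ 12 = 16 := by decide
        linear_combination -(2 ^ j * l) ^ 4 * this⟩
    have hd : c ^ (3 * (j + 1)) ∣ l' := by
      apply odd_cancel hf
      rw [← hll, pow_mul, hc]; exact dvd_mul_right _ _
    obtain ⟨l2, rfl⟩ := hd
    rw [pow_mul, hc] at hll hX'
    have : l = f * l2 := by
      apply mul_left_cancel₀ (pow_ne_zero (j + 1) (show (2 : CR) ≠ 0 by decide))
      linear_combination hll
    exact ih X' k' l2 (by rw [hX']; ring) hk' (by rw [this] at hl; exact hl.right)

end CR

namespace CR

lemma od_fourth {x : CR} (h : Od x) : c ^ 4 ∣ x ^ 4 - 1 := by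
  have : c ∣ x - 1 := by
    rw [od_r] at h; rw [c_dvd]; simp only [sub_r, one_r]; omega
  obtain ⟨y, hy⟩ := this
  have hx : x = 1 + c * y := by linear_combination hy
  refine ⟨c ^ 3 * y + 3 * c * y ^ 2 + 4 * y ^ 3 * 0 + c ^ 2 * 2 * y ^ 3 + y ^ 4, ?_⟩
  have := hc
  rw [hx]
  linear_combination (-2 * c * y - c ^ 4 * y - 3 * c ^ 2 * y ^ 2 - 2 * c ^ 3 * y ^ 3) * this

lemma md_cancel {n : ℕ} {f x y : CR} (hf : Od f) (h : md n (f * x) = md n (f * y)) : md n x = md n y := by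
  rw [md_eq] at *; rw [← mul_sub] at h; exact odd_cancel hf h

/-- bottom of the descent, first half -/
lemma bot1 {X k l e : CR} (he : e = 1 ∨ e = qq) (hX : X ^ 2 = k ^ 4 - 4 * pp * (e * c ^ 2 * l ^ 2) ^ 2)
    (hk : Od k) (hl : Od l) :
    ∃ f k' l' t, k = f * k' ∧ l = f * l' ∧ Od f ∧ Od k' ∧ Od l' ∧ Od t ∧
      t ^ 2 * (k' ^ 2 - pp * t ^ 2) = (e * c ^ 2 * l' ^ 2) ^ 2 ∧ md 3 t = md 3 ((1 + c + c ^ 2) * k') := by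
  obtain ⟨f, k1, l1, a, rfl, rfl, hf, hk1, hl1, hcl, hao, ha, hb⟩ :=
    core (m := 2) (n := 3) he (Or.inl rfl) (by rw [hX, mul_one]) hk hl.ne_zero ⟨l ^ 4, by ring⟩
  obtain ⟨b, hb⟩ := hb
  have hlo := hl.right
  obtain ⟨w1, hw1⟩ := od_fourth hlo
  obtain ⟨w2, hw2⟩ := od_fourth hk1
  have he2 : ∃ w, e ^ 2 = 1 + c ^ 3 * w := by
    rcases he with rfl | rfl
    · exact ⟨0, by ring⟩
    · exact ⟨⟨-4, 3, 1⟩, by decide⟩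
  obtain ⟨w3, hw3⟩ := he2
  have hab : a * b = pp * e ^ 2 * l1 ^ 4 := by
    apply mul_left_cancel₀ (pow_ne_zero 4 c_prime.ne_zero)
    rw [hb] at ha
    linear_combination ha
  have h7 : md 7 a = md 7 ((⟨-3, -2, 0⟩ : CR) * k1 ^ 2) := by
    have h3 : md 3 b = md 3 (pp * k1 ^ 2) := by
      apply md_cancel (hk1.pow 2)
      rw [md_eq]
      have e1 : a = k1 ^ 2 - c ^ 4 * b := by linear_combination -hb
      rw [e1] at hab
      refine ⟨c * b ^ 2 + pp * (w3 * l1 ^ 4 + c * (w1 - w2)), ?_⟩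
      linear_combination hab + pp * l1 ^ 4 * hw3 + pp * hw1 - pp * hw2
    rw [md_eq] at h3 ⊢
    obtain ⟨w, hw⟩ := h3
    refine ⟨-w, ?_⟩
    have e2 : (⟨-3, -2, 0⟩ : CR) = 1 - pp * c ^ 4 := by decide
    rw [e2]
    linear_combination -hb - c ^ 4 * hw
  obtain ⟨g, hg, s, hs, t, h1, h2, h3, h4⟩ := cls_const hcl hao hk1 h7
  have key : ∀ g ∈ G8, ∀ s ∈ SQ4, c ^ 7 ∣ g * s - (⟨-3, -2, 0⟩ : CR) →
      g = pp ∧ c ^ 7 ∣ s - (1 + c + c ^ 2) ^ 2 := by decide +kernel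
  obtain ⟨rfl, hs2⟩ := key g hg s hs h3
  refine ⟨f, k1, l1, t, rfl, rfl, hf, hk1, hlo, h2, ?_, ?_⟩
  · apply mul_left_cancel₀ pp_prime.ne_zero
    rw [h1] at ha
    linear_combination ha
  · apply sqrt_md3 (n := 1) (Od.mul (by decide) hk1)
    rw [h4, map_mul, md_eq.2 hs2]
    simp only [map_mul, map_pow]; ring

/-- bottom of the descent, second half -/
lemma bot2 {k l t e : CR} (he : e = 1 ∨ e = qq) (hk : Od k) (hl : Od l) (ht : Od t)
    (h : t ^ 2 * (k ^ 2 - pp * t ^ 2) = (e * c ^ 2 * l ^ 2) ^ 2) :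
    ∃ f L p K, Od f ∧ Od L ∧ Od p ∧ Od K ∧ l = f * L ∧ t = f * (e * p) ∧
      K ^ 2 = pp * e ^ 2 * p ^ 4 + c ^ 4 * L ^ 4 ∧ Cls (K + c ^ 2 * L ^ 2) ∧ Cls (-K + c ^ 2 * L ^ 2) := by
  obtain ⟨f, t1, L, rfl, rfl, hcop, hf⟩ := gcd_rm t l (Or.inr hl.ne_zero)
  obtain ⟨Y, hY⟩ : ∃ Y, k * (f * t1) = f ^ 2 * Y := by
    apply sq_div (y := pp * t1 ^ 4 + (e * c ^ 2 * L ^ 2) ^ 2)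
    linear_combination h
  have hY2 : Y ^ 2 = pp * t1 ^ 4 + (e * c ^ 2 * L ^ 2) ^ 2 := by
    apply mul_left_cancel₀ (pow_ne_zero 4 hf)
    have : (f ^ 2 * Y) ^ 2 = f ^ 4 * (pp * t1 ^ 4 + (e * c ^ 2 * L ^ 2) ^ 2) := by
      rw [← hY]; linear_combination h
    linear_combination this
  have key : ∃ p K, t1 = e * p ∧ K ^ 2 = pp * e ^ 2 * p ^ 4 + c ^ 4 * L ^ 4 := by
    rcases he with rfl | rfl
    · exact ⟨t1, Y, by ring, by rw [hY2]; ring⟩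
    · obtain ⟨hq1, hq2⟩ := ns Y (t1 ^ 2) (Or.inl ⟨qq * (c ^ 2 * L ^ 2) ^ 2, by linear_combination hY2⟩)
      obtain ⟨p, rfl⟩ := qq_prime.dvd_of_dvd_pow hq2
      obtain ⟨K, rfl⟩ := hq1
      refine ⟨p, K, rfl, ?_⟩
      apply mul_left_cancel₀ (pow_ne_zero 2 qq_prime.ne_zero)
      linear_combination hY2
  obtain ⟨p, K, rfl, hK⟩ := key
  have hLo := hl.right
  have hpo := ht.right.right
  have hKo : Od K := by
    apply Od.of_pow (n := 2) (by norm_num)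
    have : Od (pp * e ^ 2 * p ^ 4) := ((Od.mul (by decide) (ht.right.left.pow 2))).mul (hpo.pow 4)
    exact this.congr ⟨-(c ^ 3 * L ^ 4), by rw [hK]; ring⟩
  have cl : ∀ K : CR, Od K → K ^ 2 = pp * e ^ 2 * p ^ 4 + c ^ 4 * L ^ 4 → Cls (K + c ^ 2 * L ^ 2) := by
    intro K hKo hK
    apply cls_of (b := K - c ^ 2 * L ^ 2) (s := e * p ^ 2) (Or.inr rfl)
    · linear_combination hK
    · exact mul_ne_zero ht.right.left.ne_zero (hpo.pow 2).ne_zero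
    intro q hq hqa hqb
    have hGo : Od (K + c ^ 2 * L ^ 2) := hKo.congr ⟨-(c * L ^ 2), by ring⟩
    have hqc := od_not_c hq hGo hqa
    have hqL : q ∣ L := by
      have h1 : q ∣ c ^ 5 * L ^ 2 := by
        have := dvd_sub hqa hqb
        convert this using 1
        have := hc
        linear_combination (c ^ 2 * L ^ 2) * this
      rcases hq.dvd_or_dvd h1 with h | h
      · exact absurd h (hqc 5)
      · exact hq.dvd_of_dvd_pow h
    have hqt : ¬ q ∣ e * p := fun h => hq.not_dvd_one (by
      obtain ⟨x, y, hxy⟩ := hcop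
      rw [← hxy]; exact dvd_add (dvd_mul_of_dvd_right h _) (dvd_mul_of_dvd_right hqL _))
    have h2 : q ∣ pp * (e * p * (e * p ^ 3)) := by
      have := dvd_mul_of_dvd_left hqa (K - c ^ 2 * L ^ 2)
      convert this using 1
      linear_combination -hK
    rcases hq.dvd_or_dvd h2 with h | h
    · exact h
    · exfalso
      rcases hq.dvd_or_dvd h with h | h
      · exact hqt h
      · rcases hq.dvd_or_dvd h with h | h
        · exact hqt (dvd_mul_of_dvd_left h _)
        · exact hqt (dvd_mul_of_dvd_right (hq.dvd_of_dvd_pow h) _)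
  exact ⟨f, L, p, K, ht.left, hLo, hpo, hKo, rfl, rfl, hK, cl K hKo hK, cl (-K) hKo.neg (by rw [← hK]; ring)⟩

lemma md_sq6 {x y : CR} (h : md 3 x = md 3 y) : c ^ 6 ∣ x ^ 2 - y ^ 2 := by
  rw [md_eq] at h
  obtain ⟨w, hw⟩ := h
  have hx : x = y + c ^ 3 * w := by linear_combination hw
  have := hc
  refine ⟨w * y + w ^ 2, ?_⟩
  rw [hx]; linear_combination (-c ^ 3 * w * y) * this

/-- the final local computation modulo `c ^ 10` -/
lemma bot3 {L p K e η : CR} (hLo : Od L) (hpo : Od p) (hKo : Od K)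
    (hK : K ^ 2 = pp * e ^ 2 * p ^ 4 + c ^ 4 * L ^ 4) (hc1 : Cls (K + c ^ 2 * L ^ 2))
    (hη : md 3 L = md 3 (η * p)) :
    ∃ g ∈ G8, ∃ P, K + c ^ 2 * L ^ 2 = g * P ^ 2 ∧ Od P ∧ ∃ y ∈ O64, md 7 P = md 7 (p * y) ∧
      c ^ 10 ∣ g * y ^ 2 * (g * y ^ 2 - c ^ 5 * η ^ 2) - pp * e ^ 2 := by
  obtain ⟨g, hg, P, hP⟩ := hc1
  have hGo : Od (K + c ^ 2 * L ^ 2) := hKo.congr ⟨-(c * L ^ 2), by ring⟩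
  have hPo : Od P := by rw [hP] at hGo; exact hGo.right.of_pow (by norm_num)
  obtain ⟨q, hq, hpq⟩ := od_inv 10 hpo
  obtain ⟨y, hy, hy10, hy7⟩ := sq_rep10 (hPo.mul hq)
  refine ⟨g, hg, P, hP, hPo, y, hy, ?_, ?_⟩
  · have : md 7 p * md 7 q = 1 := by
      rw [← map_mul, ← map_one (md 7)]
      apply md_mono (n := 10) (by omega)
      rw [map_mul, hpq, map_one]
    rw [map_mul, ← hy7, map_mul]
    linear_combination (-md 7 P) * this
  · rw [← md_eq]
    have h1 : md 10 (c ^ 5 * L ^ 2) = md 10 (c ^ 5 * (η ^ 2 * p ^ 2)) := by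
      rw [md_eq]
      obtain ⟨w, hw⟩ := md_sq6 hη
      exact ⟨c * w, by linear_combination c ^ 5 * hw⟩
    have h2 : g * P ^ 2 * (g * P ^ 2 - c ^ 5 * L ^ 2) = pp * e ^ 2 * p ^ 4 := by
      rw [← hP]
      have := hc
      linear_combination hK - (K + c ^ 2 * L ^ 2) * (c ^ 2 * L ^ 2) * this
    have h3 := congrArg (md 10) h2
    simp only [map_mul, map_sub, map_pow] at h1 h3 hy10 ⊢
    rw [← hy10]
    linear_combination (md 10 q) ^ 4 * h3 + md 10 g * md 10 P ^ 2 * md 10 q ^ 4 * h1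
      - (md 10 g * md 10 P ^ 2 * md 10 q ^ 2 * md 10 c ^ 5 * md 10 η ^ 2) * (md 10 p * md 10 q + 1) * hpq * (-1)
      + (md 10 pp * md 10 e ^ 2) * (md 10 p * md 10 q + 1) * ((md 10 p * md 10 q) ^ 2 + 1) * hpq

/-- bottom contradiction -/
lemma bottom {X k l e τ η : CR} (he : e = 1 ∨ e = qq)
    (hX : X ^ 2 = k ^ 4 - 4 * pp * (e * c ^ 2 * l ^ 2) ^ 2)
    (hk : Od k) (hl : Od l) (hτ : md 3 l = md 3 (τ * k)) (hη : c ^ 3 ∣ η - (c - 1) * τ * e)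
    (key : ∀ g ∈ G8, ∀ y ∈ O64, ¬ c ^ 10 ∣ g * y ^ 2 * (g * y ^ 2 - c ^ 5 * η ^ 2) - pp * e ^ 2) : False := by
  obtain ⟨f, k', l', t, rfl, rfl, hf, hk', hl', ht, h, ht3⟩ := bot1 he hX hk hl
  have hτ' : md 3 l' = md 3 (τ * k') := by
    apply md_cancel hf; rw [hτ]; congr 1; ring
  obtain ⟨f2, L, p, K, hf2, hL, hp, hK, rfl, rfl, hKe, hcl, -⟩ := bot2 he hk' hl' ht h
  have hLp : md 3 L = md 3 (η * p) := by
    apply md_cancel (hk'.mul hf2)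
    rw [← md_eq] at hη
    have hu : md 3 (c - 1) * md 3 (1 + c + c ^ 2) = 1 := by
      rw [← map_mul, show (c - 1) * (1 + c + c ^ 2) = 1 by decide, map_one]
    simp only [map_mul] at hτ' ht3 hη ⊢
    rw [hη]
    linear_combination md 3 k' * hτ' - (md 3 k' * md 3 (c - 1) * md 3 τ) * ht3
      - md 3 k' ^ 2 * md 3 τ * hu
  obtain ⟨g, hg, P, -, -, y, hy, -, hd⟩ := bot3 hL hp hK hKe hcl hLp
  exact key g hg y hy hd

lemma keyII1 : ∀ g ∈ G8, ∀ y ∈ O64, ¬ c ^ 10 ∣ g * y ^ 2 * (g * y ^ 2 - c ^ 5 * (1 + c) ^ 2) - pp * 1 ^ 2 := by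
  decide +kernel
lemma keyIII1 : ∀ g ∈ G8, ∀ y ∈ O64, ¬ c ^ 10 ∣ g * y ^ 2 * (g * y ^ 2 - c ^ 5 * 1 ^ 2) - pp * qq ^ 2 := by
  decide +kernel
lemma keyIII2 : ∀ g ∈ G8, ∀ y ∈ O64, ¬ c ^ 10 ∣ g * y ^ 2 * (g * y ^ 2 - c ^ 5 * (1 + c) ^ 2) - pp * qq ^ 2 := by
  decide +kernel

lemma bottomII {X k l : CR}
    (hX : X ^ 2 = k ^ 4 - 4 * pp * (1 * c ^ 2 * l ^ 2) ^ 2)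
    (hk : Od k) (hl : Od l) (hτ : md 3 l = md 3 k) : False :=
  bottom (τ := 1) (η := 1 + c) (Or.inl rfl) hX hk hl (by rw [hτ, one_mul]) (by decide) keyII1

lemma bottomIII1 {X k l : CR}
    (hX : X ^ 2 = k ^ 4 - 4 * pp * (qq * c ^ 2 * l ^ 2) ^ 2)
    (hk : Od k) (hl : Od l) (hτ : md 3 l = md 3 ((1 + c) * k)) : False :=
  bottom (τ := 1 + c) (η := 1) (Or.inr rfl) hX hk hl hτ (by decide) keyIII1

lemma bottomIII2 {X k l : CR}
    (hX : X ^ 2 = k ^ 4 - 4 * pp * (qq * c ^ 2 * l ^ 2) ^ 2)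
    (hk : Od k) (hl : Od l) (hτ : md 3 l = md 3 ((1 + c ^ 2) * k)) : False :=
  bottom (τ := 1 + c ^ 2) (η := 1 + c) (Or.inr rfl) hX hk hl hτ (by decide) keyIII2

end CR

namespace CR

lemma fin3 {X k l σ ρ : CR} (hX : X ^ 2 = k ^ 4 - pp * qq ^ 2 * c ^ 2 * l ^ 4) (hk : k ≠ 0)
    (hσ : Od σ) (hρ : md 3 ρ = md 3 ((1 + c ^ 2) * σ)) (h : σ * l = c ^ 2 * ρ * k) : False := by
  obtain ⟨g, k, l, rfl, rfl, hcop, hg⟩ := gcd_rm k l (Or.inl hk)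
  obtain ⟨Y, rfl⟩ : ∃ Y, X = g ^ 2 * Y := by
    apply sq_div (y := k ^ 4 - pp * qq ^ 2 * c ^ 2 * l ^ 4)
    rw [hX]; ring
  have hY : Y ^ 2 = k ^ 4 - pp * qq ^ 2 * c ^ 2 * l ^ 4 := by
    apply mul_left_cancel₀ (pow_ne_zero 4 hg)
    linear_combination hX
  have h' : σ * l = c ^ 2 * ρ * k := by
    apply mul_left_cancel₀ hg
    linear_combination h
  obtain ⟨l0, rfl⟩ : c ^ 2 ∣ l := by
    apply odd_cancel hσ
    rw [h']; exact ⟨ρ * k, by ring⟩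
  have hko : Od k := by
    intro hh
    apply c_prime.not_dvd_one
    obtain ⟨x, y, hxy⟩ := hcop
    rw [← hxy]
    exact dvd_add (dvd_mul_of_dvd_right hh _) (dvd_mul_of_dvd_right (dvd_mul_of_dvd_left (dvd_pow_self c (by norm_num)) _) _)
  have h2 : σ * l0 = ρ * k := by
    apply mul_left_cancel₀ (pow_ne_zero 2 c_prime.ne_zero)
    linear_combination h'
  have hρo : Od ρ := Od.congr_md (Od.mul (by decide) hσ) (by norm_num) hρ.symm
  have hlo : Od l0 := (show Od (σ * l0) by rw [h2]; exact hρo.mul hko).right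
  refine bottomIII2 (X := Y) (k := k) (l := l0) ?_ hko hlo ?_
  · have h6 : c ^ 6 = 4 := by decide
    rw [hY]; linear_combination (-pp * (qq * c ^ 2 * l0 ^ 2) ^ 2) * h6
  · apply md_cancel hσ
    rw [h2, map_mul, hρ, ← map_mul]; congr 1; ring

/-- addition on the quartic -/
lemma addIII {c u d P V p P1 V1 p1 : CR} (h : c ^ 5 * V ^ 2 = u * P ^ 4 - d * p ^ 4)
    (h1 : c ^ 5 * V1 ^ 2 = u * P1 ^ 4 - d * p1 ^ 4) :
    (c ^ 6 * V * V1 * (P ^ 2 * p1 ^ 2 + P1 ^ 2 * p ^ 2) - 2 * c * u * P ^ 3 * P1 ^ 3 * p * p1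
      + 2 * c * d * P * P1 * p ^ 3 * p1 ^ 3) ^ 2 =
      (c ^ 3 * (P * p * V1 - P1 * p1 * V)) ^ 4 - u * d * c ^ 2 * (P ^ 2 * p1 ^ 2 - P1 ^ 2 * p ^ 2) ^ 4 := by
  have hT : c ^ 5 * (P ^ 2 * p ^ 2 * V1 ^ 2 + P1 ^ 2 * p1 ^ 2 * V ^ 2) =
      P ^ 2 * p ^ 2 * (u * P1 ^ 4 - d * p1 ^ 4) + P1 ^ 2 * p1 ^ 2 * (u * P ^ 4 - d * p ^ 4) := by
    linear_combination P ^ 2 * p ^ 2 * h1 + P1 ^ 2 * p1 ^ 2 * h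
  linear_combination ((P ^ 2 * p1 ^ 2 + P1 ^ 2 * p ^ 2) ^ 2 - 4 * (P * p * P1 * p1) ^ 2) * c ^ 2 *
      (c ^ 5 * V ^ 2 * h1 + (u * P1 ^ 4 - d * p1 ^ 4) * h)
    - c ^ 2 * (c ^ 5 * (P ^ 2 * p ^ 2 * V1 ^ 2 + P1 ^ 2 * p1 ^ 2 * V ^ 2) +
      (P ^ 2 * p ^ 2 * (u * P1 ^ 4 - d * p1 ^ 4) + P1 ^ 2 * p1 ^ 2 * (u * P ^ 4 - d * p ^ 4))) * hT
    + 4 * c ^ 7 * (P * p * P1 * p1) * V * V1 * hT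

lemma subIII {L p P : CR} (hp : Od p) (hPo : Od P) (hL : md 6 L = md 6 ((⟨1, 0, 3⟩ : CR) * p))
    (hP : md 3 P = md 3 ((1 + c ^ 2) * p))
    (h : c ^ 5 * (c - 1) * (P * L) ^ 2 = (c - 1) ^ 2 * P ^ 4 - pp * qq ^ 2 * p ^ 4) : False := by
  obtain ⟨L1, hL1⟩ : ∃ x : CR, x = ⟨7, -4, -1⟩ := ⟨_, rfl⟩
  obtain ⟨p1, hp1⟩ : ∃ x : CR, x = ⟨3, -2, 0⟩ := ⟨_, rfl⟩
  have h1 : c ^ 5 * (c - 1) * (qq * L1) ^ 2 = (c - 1) ^ 2 * qq ^ 4 - pp * qq ^ 2 * p1 ^ 4 := by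
    rw [hL1, hp1]; decide
  have hui : (c - 1) * (1 + c + c ^ 2) = 1 := by decide
  have hX : (P * qq * (c ^ 6 * L * L1 * (P ^ 2 * p1 ^ 2 + qq ^ 2 * p ^ 2) - 2 * c * (c - 1) * P ^ 2 * qq ^ 2 * p * p1
      + 2 * c * (pp * qq ^ 2) * (1 + c + c ^ 2) * p ^ 3 * p1 ^ 3)) ^ 2 =
      (c ^ 3 * P * qq * (p * L1 - p1 * L)) ^ 4 - pp * qq ^ 2 * c ^ 2 * (P ^ 2 * p1 ^ 2 - qq ^ 2 * p ^ 2) ^ 4 := by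
    have e1 := addIII (p := p) (p1 := p1) (P := P) (P1 := qq) (V := P * L) (V1 := qq * L1) (c := c) (u := c - 1)
      (d := pp * qq ^ 2 * (1 + c + c ^ 2))
      (by linear_combination (1 + c + c ^ 2) * h + ((c - 1) * P ^ 4 - c ^ 5 * (P * L) ^ 2) * hui)
      (by linear_combination (1 + c + c ^ 2) * h1 + ((c - 1) * qq ^ 4 - c ^ 5 * (qq * L1) ^ 2) * hui)
    linear_combination e1 + pp * qq ^ 2 * c ^ 2 * (P ^ 2 * p1 ^ 2 - qq ^ 2 * p ^ 2) ^ 4 * (-hui)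
  have hk : c ^ 3 * P * qq * (p * L1 - p1 * L) ≠ 0 := by
    refine mul_ne_zero (mul_ne_zero (mul_ne_zero (pow_ne_zero _ c_prime.ne_zero) hPo.ne_zero) qq_prime.ne_zero) ?_
    intro h0
    have h2 := congrArg (md 6) h0
    rw [map_sub, map_mul _ p1, hL, ← map_mul, ← map_sub, map_zero, md_zero] at h2
    rw [show p * L1 - p1 * (⟨1, 0, 3⟩ * p) = p * (L1 - p1 * ⟨1, 0, 3⟩) by ring] at h2
    have h3 := odd_cancel hp h2
    rw [hL1, hp1] at h3
    revert h3; decide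
  rw [md_eq] at hL hP
  obtain ⟨w, hw⟩ := hL
  obtain ⟨v, hv⟩ := hP
  have hκ : p * L1 + p1 * L = c ^ 3 * ((⟨-1, -3, 4⟩ : CR) * p + c ^ 3 * p1 * w) := by
    have : L1 + p1 * ⟨1, 0, 3⟩ = c ^ 3 * (⟨-1, -3, 4⟩ : CR) := by rw [hL1, hp1]; decide
    linear_combination p1 * hw + p * this
  have hS : (c - 1) ^ 2 * P ^ 2 * qq ^ 2 + pp * qq ^ 2 * p ^ 2 * p1 ^ 2 =
      c ^ 3 * ((⟨135, -30, -60⟩ : CR) * p ^ 2 + (c - 1) ^ 2 * qq ^ 2 * (c ^ 3 * ((1 + c ^ 2) * p * v + v ^ 2))) := by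
    have : (c - 1) ^ 2 * qq ^ 2 * (1 + c ^ 2) ^ 2 + pp * qq ^ 2 * p1 ^ 2 = c ^ 3 * (⟨135, -30, -60⟩ : CR) := by rw [hp1]; decide
    have hPv : P = (1 + c ^ 2) * p + c ^ 3 * v := by linear_combination hv
    have hc3 := hc
    rw [hPv]
    linear_combination p ^ 2 * this - ((c - 1) ^ 2 * qq ^ 2 * c ^ 3 * (1 + c ^ 2) * p * v) * hc3
  generalize hS0 : (⟨135, -30, -60⟩ : CR) * p ^ 2 + (c - 1) ^ 2 * qq ^ 2 * (c ^ 3 * ((1 + c ^ 2) * p * v + v ^ 2)) = S0 at hS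
  generalize hκ0 : (⟨-1, -3, 4⟩ : CR) * p + c ^ 3 * p1 * w = κ at hκ
  have hSm : md 3 S0 = md 3 ((⟨135, -30, -60⟩ : CR) * p ^ 2) := by
    rw [md_eq, ← hS0]; exact ⟨(c - 1) ^ 2 * qq ^ 2 * ((1 + c ^ 2) * p * v + v ^ 2), by ring⟩
  have hκm : md 3 κ = md 3 ((⟨-1, -3, 4⟩ : CR) * p) := by
    rw [md_eq, ← hκ0]; exact ⟨p1 * w, by ring⟩
  have hPm : md 3 P = md 3 ((1 + c ^ 2) * p) := by rw [md_eq]; exact ⟨v, hv⟩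
  refine fin3 (σ := -S0) (ρ := (c - 1) * P * qq * κ) hX hk ?_ ?_ ?_
  · apply Od.neg
    exact Od.congr_md (Od.mul (by decide) (hp.pow 2)) (by norm_num) hSm.symm
  · rw [map_mul, map_mul _ _ (-S0), map_neg, map_mul _ _ qq, map_mul _ _ P, hPm, hκm, hSm, ← map_neg, ← map_mul, ← map_mul, ← map_mul, ← map_mul]
    have : c ^ 3 ∣ (c - 1) * (1 + c ^ 2) * qq * (⟨-1, -3, 4⟩ : CR) + (1 + c ^ 2) * (⟨135, -30, -60⟩ : CR) := by decide
    obtain ⟨z, hz⟩ := this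
    rw [md_eq]
    exact ⟨z * p ^ 2, by linear_combination p ^ 2 * hz⟩
  · have hc4 := pow_ne_zero 4 c_prime.ne_zero
    apply mul_left_cancel₀ hc4
    have e1 : (c - 1) * (c ^ 3 * P * qq * (p * L1 - p1 * L)) * (c ^ 3 * P * qq * (p * L1 + p1 * L)) =
      - c * (P ^ 2 * p1 ^ 2 - qq ^ 2 * p ^ 2) * ((c - 1) ^ 2 * P ^ 2 * qq ^ 2 + pp * qq ^ 2 * p ^ 2 * p1 ^ 2) := by
      linear_combination (c * P ^ 2 * p ^ 2) * h1 - c * qq ^ 2 * p1 ^ 2 * h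
    rw [hκ, hS] at e1
    linear_combination -e1

lemma keyS : ∀ g ∈ G8, ∀ y ∈ O64, c ^ 10 ∣ g * y ^ 2 * (g * y ^ 2 - c ^ 5 * (⟨1, 0, 3⟩ : CR) ^ 2) - pp * qq ^ 2 →
    (g = c - 1 ∧ c ^ 3 ∣ y - (1 + c ^ 2)) ∨ g = -(c - 1) * pp := by
  decide +kernel

lemma keyT : ∀ y ∈ O64, c ^ 10 ∣ y ^ 2 * (1 - pp * y ^ 2) - qq ^ 2 * c ^ 4 * (1 + c + c ^ 2) ^ 4 →
    y = ⟨3, 1, 1⟩ ∨ y = ⟨5, 3, 3⟩ := by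
  decide +kernel

lemma bottomIII4_aux {L p K : CR} (hL : Od L) (hp : Od p) (hK : Od K)
    (hKe : K ^ 2 = pp * qq ^ 2 * p ^ 4 + c ^ 4 * L ^ 4) (hcl : Cls (K + c ^ 2 * L ^ 2))
    (hLp : md 6 L = md 6 ((⟨1, 0, 3⟩ : CR) * p)) :
    ∃ P, K + c ^ 2 * L ^ 2 = -(c - 1) * pp * P ^ 2 := by
  obtain ⟨g, hg, P, hP, hPo, y, hy, hy7, hd⟩ := bot3 hL hp hK hKe hcl (md_mono (by norm_num) hLp)
  rcases keyS g hg y hy hd with ⟨rfl, hy3⟩ | rfl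
  · exfalso
    refine subIII (L := L) (p := p) (P := P) hp hPo hLp ?_ ?_
    · rw [md_mono (by norm_num) hy7, map_mul, md_eq.2 hy3, ← map_mul, mul_comm]
    · have hc3 := hc
      have : (K + c ^ 2 * L ^ 2) * ((K + c ^ 2 * L ^ 2) - c ^ 5 * L ^ 2) = pp * qq ^ 2 * p ^ 4 := by
        linear_combination hKe - (K + c ^ 2 * L ^ 2) * (c ^ 2 * L ^ 2) * hc3
      rw [hP] at this
      linear_combination -this
  · exact ⟨P, hP⟩

lemma bottomIII4 {X k l : CR}
    (hX : X ^ 2 = k ^ 4 - 4 * pp * (qq * c ^ 2 * l ^ 2) ^ 2)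
    (hk : Od k) (hl : Od l) (hτ : md 6 l = md 6 ((1 + c + c ^ 2) * k)) : False := by
  obtain ⟨f, k', l', t, rfl, rfl, hf, hk', hl', ht, h, ht3⟩ := bot1 (Or.inr rfl) hX hk hl
  have hτ' : md 6 l' = md 6 ((1 + c + c ^ 2) * k') := by
    apply md_cancel hf; rw [hτ]; congr 1; ring
  -- the residue of t
  have hty : md 7 t = md 7 ((⟨3, 1, 1⟩ : CR) * k') ∨ md 7 t = md 7 ((⟨5, 3, 3⟩ : CR) * k') := by
    obtain ⟨q, hq, hkq⟩ := od_inv 10 hk'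
    obtain ⟨y, hy, hy10, hy7⟩ := sq_rep10 (ht.mul hq)
    have h7 : md 7 t = md 7 (y * k') := by
      have : md 7 k' * md 7 q = 1 := by
        rw [← map_mul, ← map_one (md 7)]
        apply md_mono (n := 10) (by omega)
        rw [map_mul, hkq, map_one]
      rw [map_mul, ← hy7, map_mul]
      linear_combination (-md 7 t) * this
    have hd : c ^ 10 ∣ y ^ 2 * (1 - pp * y ^ 2) - qq ^ 2 * c ^ 4 * (1 + c + c ^ 2) ^ 4 := by
      rw [← md_eq]
      have h1 : md 10 (c ^ 4 * l' ^ 4) = md 10 (c ^ 4 * ((1 + c + c ^ 2) * k') ^ 4) := by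
        have h2 : md 6 (l' ^ 4) = md 6 (((1 + c + c ^ 2) * k') ^ 4) := by rw [map_pow, hτ', map_pow]
        rw [md_eq] at h2 ⊢
        obtain ⟨w, hw⟩ := h2
        exact ⟨w, by linear_combination c ^ 4 * hw⟩
      have h3 := congrArg (md 10) h
      simp only [map_mul, map_sub, map_pow, map_one] at h1 h3 hy10 ⊢
      rw [← hy10]
      generalize md 10 (1 + c + c ^ 2) = uu at *
      linear_combination md 10 q ^ 4 * h3 + md 10 qq ^ 2 * md 10 q ^ 4 * h1
        - md 10 t ^ 2 * md 10 q ^ 2 * (md 10 k' * md 10 q + 1) * hkq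
        + md 10 qq ^ 2 * md 10 c ^ 4 * uu ^ 4 * ((md 10 k' * md 10 q) ^ 2 + 1) * (md 10 k' * md 10 q + 1) * hkq
    rcases keyT y hy hd with rfl | rfl
    · exact Or.inl h7
    · exact Or.inr h7
  obtain ⟨f2, L, p, K, hf2, hL, hp, hK, rfl, rfl, hKe, hcl, hcl2⟩ := bot2 (Or.inr rfl) hk' hl' ht h
  have fin : ∀ L : CR, Od L → K ^ 2 = pp * qq ^ 2 * p ^ 4 + c ^ 4 * L ^ 4 → Cls (K + c ^ 2 * L ^ 2) →
      Cls (-K + c ^ 2 * L ^ 2) → md 6 L = md 6 ((⟨1, 0, 3⟩ : CR) * p) → False := by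
    intro L hL hKe hcl hcl2 hLp
    obtain ⟨P, hP⟩ := bottomIII4_aux hL hp hK hKe hcl hLp
    obtain ⟨P', hP'⟩ := bottomIII4_aux hL hp hK.neg (by rw [← hKe]; ring) hcl2 hLp
    have h1 : ((c - 1) * pp * (P * P')) ^ 2 = -pp * (qq * p ^ 2) ^ 2 := by
      linear_combination -hKe - (-K + c ^ 2 * L ^ 2) * hP - (-(c - 1) * pp * P ^ 2) * hP'
    have h2 := congrArg nm h1
    generalize (c - 1) * pp * (P * P') = x at h2
    generalize hz : qq * p ^ 2 = z at h2
    rw [pow_two, nm_mul, nm_mul, pow_two z, nm_mul z, show nm (-pp) = -5 by decide] at h2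
    have h3 : nm z ≠ 0 := by
      intro h0
      rw [← hz] at h0
      exact (mul_ne_zero qq_prime.ne_zero (hp.pow 2).ne_zero) (nm_eq_zero h0)
    nlinarith [sq_nonneg (nm x), sq_pos_of_ne_zero h3 ]
  have hsgn : md 6 L = md 6 ((⟨1, 0, 3⟩ : CR) * p) ∨ md 6 (-L) = md 6 ((⟨1, 0, 3⟩ : CR) * p) := by
    rcases hty with h7 | h7
    · right
      apply md_cancel (hf2.mul (show Od qq by decide))
      have h6 := md_mono (m := 6) (by norm_num) h7
      have e : md 6 (qq * (1 + c + c ^ 2)) = md 6 (-((⟨1, 0, 3⟩ : CR) * ⟨3, 1, 1⟩)) := by rw [md_eq]; decide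
      simp only [map_mul, map_neg] at *
      linear_combination -md 6 qq * hτ' - md 6 k' * e - md 6 (⟨1, 0, 3⟩ : CR) * h6
    · left
      apply md_cancel (hf2.mul (show Od qq by decide))
      have h6 := md_mono (m := 6) (by norm_num) h7
      have e : md 6 (qq * (1 + c + c ^ 2)) = md 6 (((⟨1, 0, 3⟩ : CR) * ⟨5, 3, 3⟩)) := by rw [md_eq]; decide
      simp only [map_mul, map_neg] at *
      linear_combination md 6 qq * hτ' + md 6 k' * e - md 6 (⟨1, 0, 3⟩ : CR) * h6
  rcases hsgn with h | h
  · exact fin L hL hKe hcl hcl2 h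
  · exact fin (-L) hL.neg (by rw [hKe]; ring) (by convert hcl using 1; ring) (by convert hcl2 using 1; ring) h

end CR

namespace CR

lemma not_both {m n p : CR} (h : IsCoprime m n) (hp : Prime p) (h1 : p ∣ m) (h2 : p ∣ n) : False :=
  hp.not_dvd_one (by
    obtain ⟨x, y, hxy⟩ := h
    rw [← hxy]; exact dvd_add (dvd_mul_of_dvd_right h1 _) (dvd_mul_of_dvd_right h2 _))

/-- start of the descent -/
lemma startA {m n f g ε s : CR} (N : ℕ) (hm : Od m) (hn : n ≠ 0) (hε0 : ε ≠ 0)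
    (hcop : IsCoprime m n) (hf : c ∣ f) (hg : c ∣ g) (hgg : ∀ p, Prime p → p ∣ g → c ∣ p ∨ ¬ p ∣ m ^ 2 + f * m * n + g * n ^ 2)
    (hs : s ^ 2 = (m ^ 2 + f * m * n + g * n ^ 2) ^ 2 - 4 * (pp * (ε * m * n) ^ 2))
    (hN : c ^ (N + 1) ∣ (ε * n) ^ 2)
    (hε : ∀ p, Prime p → p ∣ ε → p ∣ m ^ 2 + f * m * n + g * n ^ 2 → c ∣ p) :
    ∃ a, Cls a ∧ Od a ∧ a * (m ^ 2 + f * m * n + g * n ^ 2 - a) = pp * (ε * m * n) ^ 2 ∧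
      c ^ (N + 1) ∣ m ^ 2 + f * m * n + g * n ^ 2 - a := by
  have hθ : Od (m ^ 2 + f * m * n + g * n ^ 2) := (hm.pow 2).congr (by
    obtain ⟨x, rfl⟩ := hf
    obtain ⟨y, rfl⟩ := hg
    exact ⟨-(x * m * n + y * n ^ 2), by ring⟩)
  obtain ⟨a, ha, hb⟩ := split (n := N + 1) hθ hs (by
    rw [show pp * (ε * m * n) ^ 2 = (ε * n) ^ 2 * (pp * m ^ 2) by ring]; exact dvd_mul_of_dvd_left hN _)
  have hao : Od a := hθ.congr ((dvd_pow_self c (by omega)).trans hb)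
  refine ⟨a, ?_, hao, ha, hb⟩
  apply cls_of (b := m ^ 2 + f * m * n + g * n ^ 2 - a) (s := ε * m * n) (Or.inr rfl) ha
    (mul_ne_zero (mul_ne_zero hε0 hm.ne_zero) hn)
  intro p hp hpa hpb
  have hpc : ¬ c ∣ p := fun h => hao (h.trans hpa)
  have hpθ : p ∣ m ^ 2 + f * m * n + g * n ^ 2 := by simpa using dvd_add hpb hpa
  have hpN : p ∣ pp * (ε * m * n) ^ 2 := by rw [← ha]; exact dvd_mul_of_dvd_left hpa _
  rcases hp.dvd_or_dvd hpN with h | h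
  · exact h
  exfalso
  rcases hp.dvd_or_dvd (hp.dvd_of_dvd_pow h) with h | h
  · rcases hp.dvd_or_dvd h with h | h
    · exact hpc (hε p hp h hpθ)
    · have : p ∣ g * n ^ 2 := by
        have := dvd_sub hpθ (dvd_mul_of_dvd_right h (m + f * n))
        convert this using 1; ring
      rcases hp.dvd_or_dvd this with h' | h'
      · rcases hgg p hp h' with h2 | h2
        · exact hpc h2
        · exact h2 hpθ
      · exact not_both hcop hp h (hp.dvd_of_dvd_pow h')
  · have : p ∣ m ^ 2 := by
      have := dvd_sub hpθ (dvd_mul_of_dvd_right h (f * m + g * n))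
      convert this using 1; ring
    exact not_both hcop hp (hp.dvd_of_dvd_pow this) h

lemma T2 {m n K ε k : CR} (hE : 4 + K ^ 2 = pp * ε ^ 2) (hk : k ≠ 0)
    (h : k ^ 2 * (m ^ 2 + (-2 * K) * m * n + (-4) * n ^ 2 - k ^ 2) = pp * (ε * m * n) ^ 2) :
    ∃ X, X ^ 2 = k ^ 4 - 4 * pp * (ε * n ^ 2) ^ 2 := by
  have h1 : (m * (k ^ 2 - pp * ε ^ 2 * n ^ 2) - K * k ^ 2 * n) ^ 2 = k ^ 2 * (k ^ 4 - 4 * pp * (ε * n ^ 2) ^ 2) := by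
    linear_combination (k ^ 2 - pp * ε ^ 2 * n ^ 2) * h + k ^ 4 * n ^ 2 * hE
  obtain ⟨X, hX⟩ := sq_div h1
  refine ⟨X, ?_⟩
  rw [hX] at h1
  apply mul_left_cancel₀ (pow_ne_zero 2 hk)
  linear_combination h1

lemma passes {e τ : CR} (he : e = 1 ∨ e = qq) (r : ℕ) (hr : r ≤ 7) (j : ℕ) : ∀ (X k o : CR),
    X ^ 2 = k ^ 4 - pp * (e * c ^ 5 * (2 ^ j * o) ^ 2) ^ 2 → Od k → Od o → md r o = md r (τ * k) →
    ∃ X k o, X ^ 2 = k ^ 4 - 4 * pp * (e * c ^ 2 * o ^ 2) ^ 2 ∧ Od k ∧ Od o ∧ md r o = md r (τ * k) := by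
  induction j with
  | zero =>
    intro X k o h hk ho hm
    have h6 : c ^ 6 = 4 := by decide
    exact ⟨X, k, o, by rw [h]; linear_combination (-pp * (e * c ^ 2 * o ^ 2) ^ 2) * h6, hk, ho, hm⟩
  | succ j ih =>
    intro X k o h hk ho hm
    obtain ⟨f, k', l', X', hf, hk', hl', hll, hkk, hX'⟩ := pass (X := X) (k := k) (l := 2 ^ j * o) (i := 5)
      he (by rw [h]; ring) hk (mul_ne_zero (pow_ne_zero _ (by decide)) ho.ne_zero)
      ⟨(2 ^ j * o) ^ 4, by ring⟩
    have hd : c ^ (3 * j) ∣ l' := by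
      apply odd_cancel hf
      rw [← hll, pow_mul, hc]; exact dvd_mul_right _ _
    obtain ⟨o', rfl⟩ := hd
    rw [pow_mul, hc] at hll hX'
    have ho' : o = f * o' := by
      apply mul_left_cancel₀ (pow_ne_zero j (show (2 : CR) ≠ 0 by decide))
      linear_combination hll
    refine ih X' k' o' hX' hk' (by rw [ho'] at ho; exact ho.right) ?_
    apply md_cancel hf
    rw [← ho', hm, map_mul, md_mono hr hkk, ← map_mul]; congr 1; ring

lemma c_of_dvd_two {p : CR} (hp : Prime p) (h : p ∣ 2) : c ∣ p :=
  prime_c_of_dvd hp (n := 3) (by rw [hc]; exact h)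

lemma c_of_dvd_four {p : CR} (hp : Prime p) (h : p ∣ -4) : c ∣ p := by
  rw [dvd_neg] at h
  exact prime_c_of_dvd hp (n := 6) (by rw [show c ^ 6 = 4 by decide]; exact h)

lemma od_int {m : ℤ} (h : m % 2 = 1) : Od (m : CR) := by rw [od_r, intCast_r]; exact h

lemma int_ne {n : ℤ} (h : n ≠ 0) : (n : CR) ≠ 0 := by
  intro h0
  have := congrArg CR.r h0
  rw [intCast_r] at this
  exact h (by simpa using this)

lemma int_pow (n : ℤ) (hn : n ≠ 0) : ∃ (j : ℕ) (o : ℤ), o % 2 = 1 ∧ n = 2 ^ j * o := by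
  have := (Int.finiteMultiplicity_iff.2 ⟨by norm_num, hn⟩ : FiniteMultiplicity (2 : ℤ) n).exists_eq_pow_mul_and_not_dvd
  obtain ⟨o, ho, h⟩ := this
  exact ⟨_, o, by omega, ho⟩

lemma md_of_dvd {n : ℕ} {x y z : CR} (h : x - y = c ^ n * z) : md n x = md n y := by
  rw [md_eq]; exact ⟨z, h⟩

lemma od_sq3 {x : CR} (h : Od x) : ∃ y, x ^ 2 = 1 + c ^ 2 * y ∧ True := by
  have : c ∣ x - 1 := by
    rw [od_r] at h; rw [c_dvd]; simp only [sub_r, one_r]; omega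
  obtain ⟨y, hy⟩ := this
  refine ⟨c ^ 2 * y + y ^ 2, ?_, trivial⟩
  have hx : x = 1 + c * y := by linear_combination hy
  have := hc
  rw [hx]; linear_combination (-c * y) * this

lemma A3_I {m n : ℤ} {s : CR} (hm : m % 2 = 1) (hn : n ≠ 0) (hcop : IsCoprime m n)
    (hs : s ^ 2 = ((m : CR) ^ 2 + (-2 * (2 * c)) * m * n + (-4) * (n : CR) ^ 2) ^ 2 - 4 * (pp * (2 * m * n) ^ 2)) : False := by
  have hmo := od_int hm
  have hnz : (n : CR) ≠ 0 := int_ne hn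
  obtain ⟨a, hcl, hao, ha, hb⟩ := startA (f := -2 * (2 * c)) (g := -4) (ε := 2) 5 hmo hnz (by decide)
    (by simpa using hcop.map (Int.castRingHom CR)) (by decide) (by decide)
    (fun p hp h => Or.inl (c_of_dvd_four hp h)) hs
    ⟨(n : CR) ^ 2, by have : c ^ 6 = 4 := by decide
                      rw [this]; ring⟩
    (fun p hp h _ => c_of_dvd_two hp h)
  obtain ⟨b, hb⟩ := hb
  have h6 : c ^ 6 = 4 := by decide
  have hab : a * b = pp * (m * n) ^ 2 := by
    apply mul_left_cancel₀ (show (4 : CR) ≠ 0 by decide)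
    rw [hb, h6] at ha; linear_combination ha
  have hd : c ∣ n ^ 2 + b := by
    by_cases hno : Od (n : CR)
    · have hbo : Od b := (show Od (a * b) by rw [hab]; exact Od.mul (by decide) ((hmo.mul hno).pow 2)).right
      have h2 := hno.pow 2
      rw [od_r] at h2 hbo
      rw [c_dvd]; simp only [add_r]; omega
    · have hno' : c ∣ (n : CR) := by unfold Od at hno; tauto
      have : c ∣ b := by
        have h1 : c ∣ a * b := by rw [hab]; exact dvd_mul_of_dvd_right (dvd_pow (dvd_mul_of_dvd_right hno' _) (by norm_num)) _
        exact (c_prime.dvd_or_dvd h1).resolve_left hao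
      exact dvd_add (dvd_pow hno' (by norm_num)) this
  obtain ⟨w, hw⟩ := hd
  obtain ⟨k, rfl, hk⟩ := cls_one hcl hao hmo (md_of_dvd (z := -w - m * n) (by
    linear_combination -hb - c ^ 6 * hw + (c * (m:CR) * n + (n:CR)^2)* h6))
  obtain ⟨X, hX⟩ := T2 (K := 2 * c) (ε := 2) (by decide) hk.ne_zero ha
  obtain ⟨j, o, ho, rfl⟩ := int_pow n hn
  refine caseI j X k (o : CR) ?_ hk (od_int ho)
  rw [hX]; push_cast; ring

lemma A3_II {m n : ℤ} {s : CR} (hm : m % 2 = 1) (hn : n ≠ 0) (hn2 : n % 2 = 0) (hcop : IsCoprime m n)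
    (hs : s ^ 2 = ((m : CR) ^ 2 + (-2 * c ^ 2) * m * n + (-4) * (n : CR) ^ 2) ^ 2 - 4 * (pp * (c ^ 2 * m * n) ^ 2)) : False := by
  have hmo := od_int hm
  have hnz : (n : CR) ≠ 0 := int_ne hn
  obtain ⟨v, hv⟩ : ∃ v : CR, (n : CR) = 2 * v := by
    obtain ⟨v, hv⟩ : (2 : ℤ) ∣ n := by omega
    exact ⟨v, by rw [hv]; push_cast; ring⟩
  have h6 : c ^ 6 = 4 := by decide
  have hc3 := hc
  obtain ⟨a, hcl, hao, ha, hb⟩ := startA (f := -2 * c ^ 2) (g := -4) (ε := c ^ 2) 9 hmo hnz (by decide)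
    (by simpa using hcop.map (Int.castRingHom CR)) (by decide) (by decide)
    (fun p hp h => Or.inl (c_of_dvd_four hp h)) hs
    ⟨v ^ 2, by rw [hv]; linear_combination (-c ^ 4 * v ^ 2) * h6⟩
    (fun p hp h _ => prime_c_of_dvd hp h)
  obtain ⟨b, hb⟩ := hb
  have h8 : md 8 a = md 8 ((m : CR) ^ 2) := md_of_dvd (z := -c ^ 2 * b - m * v - 2 * c * v ^ 2 ) (by
    rw [hv] at hb
    have h8 : c ^ 8 = 4 * c ^ 2 := by decide
    have h9 : c ^ 9 = 8 := by decide
    linear_combination -hb + (m : CR) * v * h8 + 2 * v ^ 2 * h9)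
  obtain ⟨k, rfl, hk⟩ := cls_one hcl hao hmo (md_mono (by norm_num) h8)
  obtain ⟨X, hX⟩ := T2 (K := c ^ 2) (ε := c ^ 2) (by decide) hk.ne_zero ha
  obtain ⟨j, o, ho, rfl⟩ := int_pow n hn
  have hkm : md 3 k = md 3 (m : CR) := by
    rw [map_pow, map_pow] at h8
    exact sqrt_md3 (n := 2) hmo h8
  obtain ⟨X, k, o, h1, h2, h3, h4⟩ := passes (e := 1) (τ := 1) (Or.inl rfl) 3 (by norm_num) j X k o
    (by rw [hX]; push_cast; linear_combination (pp * (c ^ 2 * (2 ^ j * (o : CR)) ^ 2) ^ 2) * h6) hk (od_int ho)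
    (by
      rw [one_mul, hkm, md_eq, hc]
      obtain ⟨w, hw⟩ : (2 : ℤ) ∣ o - m := by omega
      exact ⟨w, by exact_mod_cast congrArg (Int.cast (R := CR)) hw⟩)
  exact bottomII h1 h2 h3 (by rw [h4, one_mul])

lemma qq_int {n : ℤ} : qq ∣ (n : CR) ↔ 5 ∣ n := by
  rw [qq_dvd, intCast_r]; simp

/-- primes dividing ε in case III -/
lemma eps_III {p θ : CR} (hp : Prime p) (h : p ∣ c ^ 2 * qq * (1 + c + c ^ 2) ^ 2) (hθ : p ∣ θ) (hq : ¬ qq ∣ θ) : c ∣ p := by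
  rcases hp.dvd_or_dvd h with h | h
  · rcases hp.dvd_or_dvd h with h | h
    · exact prime_c_of_dvd hp h
    · exact absurd ((hp.associated_of_dvd qq_prime h).symm.dvd.trans hθ) hq
  · exfalso
    have : (1 + c + c ^ 2) * (c - 1) = 1 := by decide
    exact hp.not_dvd_one (by rw [← this]; exact dvd_mul_of_dvd_left (hp.dvd_of_dvd_pow h) _)

lemma A3_III_start {m n : ℤ} {s : CR} (N : ℕ) (hm : m % 2 = 1) (hn : n ≠ 0) (hcop : IsCoprime m n) (h5 : ¬ (5 : ℤ) ∣ m + n)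
    (hs : s ^ 2 = ((m : CR) ^ 2 + (-2 * ⟨24, 20, 15⟩) * m * n + (-4) * (n : CR) ^ 2) ^ 2
      - 4 * (pp * (c ^ 2 * qq * (1 + c + c ^ 2) ^ 2 * m * n) ^ 2)) (hN : c ^ (N + 1) ∣ c ^ 4 * (n : CR) ^ 2) :
    ∃ a, Cls a ∧ Od a ∧ a * ((m : CR) ^ 2 + (-2 * ⟨24, 20, 15⟩) * m * n + (-4) * (n : CR) ^ 2 - a) = pp * (c ^ 2 * qq * (1 + c + c ^ 2) ^ 2 * m * n) ^ 2 ∧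
      c ^ (N + 1) ∣ (m : CR) ^ 2 + (-2 * ⟨24, 20, 15⟩) * m * n + (-4) * (n : CR) ^ 2 - a := by
  have hmo := od_int hm
  have hnz : (n : CR) ≠ 0 := int_ne hn
  have hq : ¬ qq ∣ (m : CR) ^ 2 + (-2 * ⟨24, 20, 15⟩) * m * n + (-4) * (n : CR) ^ 2 := by
    intro h
    have h1 : qq ∣ ((m + n : ℤ) : CR) ^ 2 := by
      have : qq ∣ ⟨25, 20, 15⟩ := by rw [qq_dvd]; decide
      obtain ⟨w, hw⟩ := this
      have e : (⟨24, 20, 15⟩ : CR) = -1 + qq * w := by rw [← hw]; decide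
      obtain ⟨z, hz⟩ := h
      rw [e] at hz
      refine ⟨z + 2 * w * m * n + pp * n ^ 2, ?_⟩
      have := pq5
      push_cast
      linear_combination hz + (-(n : CR) ^ 2) * this
    exact h5 (qq_int.1 (qq_prime.dvd_of_dvd_pow h1))
  exact startA (f := -2 * ⟨24, 20, 15⟩) (g := -4) (ε := c ^ 2 * qq * (1 + c + c ^ 2) ^ 2) N hmo hnz (by decide)
    (by simpa using hcop.map (Int.castRingHom CR)) (by decide) (by decide)
    (fun p hp h => Or.inl (c_of_dvd_four hp h)) hs
    (by
      rw [show (c ^ 2 * qq * (1 + c + c ^ 2) ^ 2 * (n : CR)) ^ 2 = c ^ 4 * (n : CR) ^ 2 * (qq * (1 + c + c ^ 2) ^ 2) ^ 2 by ring]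
      exact dvd_mul_of_dvd_left hN _)
    (fun p hp h hθ => eps_III hp h hθ hq)

/-- n divisible by 4 -/
lemma A3_III4 {m n : ℤ} {s : CR} (hm : m % 2 = 1) (hn : n ≠ 0) (hn4 : n % 4 = 0) (hcop : IsCoprime m n) (h5 : ¬ (5 : ℤ) ∣ m + n)
    (hs : s ^ 2 = ((m : CR) ^ 2 + (-2 * ⟨24, 20, 15⟩) * m * n + (-4) * (n : CR) ^ 2) ^ 2
      - 4 * (pp * (c ^ 2 * qq * (1 + c + c ^ 2) ^ 2 * m * n) ^ 2)) : False := by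
  have hmo := od_int hm
  obtain ⟨v, hv⟩ : ∃ v : CR, (n : CR) = 4 * v := by
    obtain ⟨v, hv⟩ : (4 : ℤ) ∣ n := by omega
    exact ⟨v, by rw [hv]; push_cast; ring⟩
  have h6 : c ^ 6 = 4 := by decide
  have h12 : c ^ 12 = 16 := by decide
  obtain ⟨a, hcl, hao, ha, hb⟩ := A3_III_start 10 hm hn hcop h5 hs
    ⟨c ^ 5 * v ^ 2, by rw [hv]; linear_combination (-c ^ 4 * v ^ 2) * h12⟩
  obtain ⟨b, hb⟩ := hb
  have h11 : md 11 a = md 11 ((m : CR) ^ 2) := by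
    obtain ⟨z, hz⟩ : ∃ z : CR, (⟨24, 20, 15⟩ : CR) * 8 = c ^ 11 * z := ⟨⟨15, 12, 10⟩, by decide⟩
    apply md_of_dvd (z := -b - z * m * v - 4 * c * v ^ 2)
    rw [hv] at hb
    linear_combination -hb - (m : CR) * v * hz + 4 * v ^ 2 * h12
  obtain ⟨k, rfl, hk⟩ := cls_one hcl hao hmo (md_mono (by norm_num) h11)
  obtain ⟨X, hX⟩ := T2 (K := ⟨24, 20, 15⟩) (ε := c ^ 2 * qq * (1 + c + c ^ 2) ^ 2) (by decide) hk.ne_zero ha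
  obtain ⟨j, o, ho, rfl⟩ := int_pow n hn
  rw [map_pow, map_pow] at h11
  have ho4 : md 6 (o : CR) = md 6 (m : CR) ∨ md 6 (o : CR) = md 6 (-m : CR) := by
    rw [md_eq, md_eq, h6]
    rcases (by omega : (4 : ℤ) ∣ o - m ∨ (4 : ℤ) ∣ o - -m) with ⟨w, hw⟩ | ⟨w, hw⟩
    · left; exact ⟨w, by exact_mod_cast congrArg (Int.cast (R := CR)) hw⟩
    · right; exact ⟨w, by exact_mod_cast congrArg (Int.cast (R := CR)) hw⟩
  have hk6 : md 6 k = md 6 (m : CR) ∨ md 6 k = md 6 (-m : CR) := by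
    rcases sqrt_md (n := 5) hmo h11 with h | h
    · exact Or.inl (md_mono (by norm_num) h)
    · exact Or.inr (md_mono (by norm_num) h)
  have hok : ∃ k' : CR, (k' = k ∨ k' = -k) ∧ md 6 (o : CR) = md 6 k' := by
    rw [map_neg] at hk6 ho4
    rcases ho4 with h1 | h1 <;> rcases hk6 with h2 | h2
    · exact ⟨k, Or.inl rfl, by rw [h1, h2]⟩
    · exact ⟨-k, Or.inr rfl, by rw [h1, map_neg, h2, neg_neg]⟩
    · exact ⟨-k, Or.inr rfl, by rw [h1, map_neg, h2]⟩
    · exact ⟨k, Or.inl rfl, by rw [h1, h2]⟩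
  obtain ⟨k', hk', hok⟩ := hok
  have hk2 : k' ^ 4 = k ^ 4 := by rcases hk' with rfl | rfl <;> ring
  have hk'o : Od k' := by
    rcases hk' with rfl | rfl
    · exact hk
    · exact hk.neg
  obtain ⟨X, k, o, h1, h2, h3, h4⟩ := passes (e := qq) (τ := 1 + c + c ^ 2) (Or.inr rfl) 6 (by norm_num) j X k' ((1 + c + c ^ 2) * o)
    (by rw [hX, hk2]; push_cast
        linear_combination (pp * (qq * c ^ 2 * (2 ^ j * ((1 + c + c ^ 2) * (o : CR))) ^ 2) ^ 2) * h6) hk'o (Od.mul (by decide) (od_int ho))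
    (by rw [map_mul, hok, ← map_mul])
  exact bottomIII4 h1 h2 h3 h4

/-- n odd -/
lemma A3_III1 {m n : ℤ} {s : CR} (hm : m % 2 = 1) (hn : n % 2 = 1) (hcop : IsCoprime m n) (h5 : ¬ (5 : ℤ) ∣ m + n)
    (hs : s ^ 2 = ((m : CR) ^ 2 + (-2 * ⟨24, 20, 15⟩) * m * n + (-4) * (n : CR) ^ 2) ^ 2
      - 4 * (pp * (c ^ 2 * qq * (1 + c + c ^ 2) ^ 2 * m * n) ^ 2)) : False := by
  have hmo := od_int hm
  have hno := od_int hn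
  have h6 : c ^ 6 = 4 := by decide
  have hc3 := hc
  obtain ⟨a, hcl, hao, ha, hb⟩ := A3_III_start 3 hm (by omega) hcop h5 hs ⟨(n : CR) ^ 2, rfl⟩
  obtain ⟨b, hb⟩ := hb
  have hab : a * b = pp * (qq * (1 + c + c ^ 2) ^ 2 * m * n) ^ 2 := by
    apply mul_left_cancel₀ (pow_ne_zero 4 c_prime.ne_zero)
    rw [hb] at ha; linear_combination ha
  obtain ⟨w, hw⟩ : ∃ w : ℤ, m = 1 + 2 * w := ⟨m / 2, by omega⟩
  obtain ⟨z, hz⟩ : ∃ z : ℤ, n = m + 2 * z := ⟨(n - m) / 2, by omega⟩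
  have hz' : (n : CR) = m + 2 * z := by rw [hz]; push_cast; ring
  have hw' : (m : CR) = 1 + 2 * w := by rw [hw]; push_cast; ring
  obtain ⟨x, hx⟩ : ∃ x : CR, x = qq ^ 2 * (1 + c + c ^ 2) ^ 4 := ⟨_, rfl⟩
  obtain ⟨y, hy⟩ : ∃ y : CR, y = ⟨24, 20, 15⟩ := ⟨_, rfl⟩
  obtain ⟨y2, hy2⟩ : ∃ y2 : CR, y = c ^ 2 * y2 := ⟨⟨15, 12, 10⟩, by rw [hy]; decide⟩
  rw [← hy] at hb
  have hb3 : md 3 b = md 3 (pp * x * m ^ 2) := by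
    apply md_cancel (hmo.pow 2)
    have hab : a * b = pp * x * m ^ 2 * n ^ 2 := by rw [hab, hx]; ring
    have ha3 : md 3 a = md 3 ((m : CR) ^ 2) :=
      md_of_dvd (z := -c * b - y * m * n - c ^ 3 * n ^ 2) (by linear_combination -hb + (c ^ 3 * n ^ 2 + 2 * n ^ 2 + y * m * n)  * hc3)
    have hn3 : md 3 (n : CR) = md 3 (m : CR) := md_of_dvd (z := z) (by rw [hz', hc]; ring)
    have := congrArg (md 3) hab
    simp only [map_mul, map_pow] at this ha3 hn3 ⊢
    rw [ha3, hn3] at this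
    linear_combination this
  have h7 : md 7 a = md 7 ((1 - 4 - 2 * y - c ^ 4 * pp * x) * (m : CR) ^ 2) := by
    rw [md_eq] at hb3
    obtain ⟨v, hv⟩ := hb3
    apply md_of_dvd (z := -v - c * y2 * m * z - 2 * c ^ 2 * (m * z + z ^ 2))
    rw [hz', hy2] at hb
    rw [hy2]
    have h9 : c ^ 9 = 8 := by decide
    linear_combination -hb - c ^ 4 * hv + (c ^ 2 * y2 * m * z) * h6 + 2 * (m * z + z ^ 2) * h9
  obtain ⟨g, hg, t, ht, k, h1, h2, h3, h4⟩ := cls_const hcl hao hmo h7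
  have key : ∀ g ∈ G8, ∀ s ∈ SQ4, c ^ 7 ∣ g * s - (1 - 4 - 2 * ⟨24, 20, 15⟩ - c ^ 4 * pp * (qq ^ 2 * (1 + c + c ^ 2) ^ 4)) →
      g = 1 ∧ c ^ 7 ∣ s - (1 + c ^ 2) ^ 2 := by decide +kernel
  rw [hy, hx] at h3
  obtain ⟨rfl, hs2⟩ := key g hg t ht h3
  rw [one_mul] at h1
  subst h1
  obtain ⟨X, hX⟩ := T2 (K := ⟨24, 20, 15⟩) (ε := c ^ 2 * qq * (1 + c + c ^ 2) ^ 2) (by decide) h2.ne_zero ha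
  have hkm : md 3 k = md 3 ((1 + c ^ 2) * (m : CR)) := by
    apply sqrt_md3 (n := 1) (Od.mul (by decide) hmo)
    rw [h4, map_mul, md_eq.2 hs2]
    simp only [map_mul, map_pow]; ring
  refine bottomIII1 (X := X) (k := k) (l := (1 + c + c ^ 2) * n) (by rw [hX]; ring) h2 (Od.mul (by decide) hno) ?_
  have hn3 : md 3 (n : CR) = md 3 (m : CR) := md_of_dvd (z := z) (by rw [hz', hc]; ring)
  rw [map_mul, hn3, map_mul, hkm, ← map_mul, ← map_mul, md_eq]
  have : c ^ 3 ∣ (1 + c + c ^ 2) - (1 + c) * (1 + c ^ 2) := by decide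
  obtain ⟨q, hq⟩ := this
  exact ⟨q * m, by linear_combination (m : CR) * hq⟩
end CR

namespace CR

lemma T2g {p q F g E k : CR} (hk : k ≠ 0)
    (h : k ^ 2 * (p ^ 2 + 2 * F * p * q + g * q ^ 2 - k ^ 2) = E * p ^ 2 * q ^ 2) :
    ∃ Y, Y ^ 2 = k ^ 4 + (F ^ 2 - g - E) * k ^ 2 * q ^ 2 + g * E * q ^ 4 := by
  have h1 : (p * (k ^ 2 - E * q ^ 2) + F * k ^ 2 * q) ^ 2 =
      k ^ 2 * (k ^ 4 + (F ^ 2 - g - E) * k ^ 2 * q ^ 2 + g * E * q ^ 4) := by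
    linear_combination (k ^ 2 - E * q ^ 2) * h
  obtain ⟨X, hX⟩ := sq_div h1
  refine ⟨X, ?_⟩
  rw [hX] at h1
  apply mul_left_cancel₀ (pow_ne_zero 2 hk)
  linear_combination h1

lemma c_dvd_sq_add (x : CR) : c ∣ x ^ 2 + x := by
  rw [c_dvd]; simp only [add_r, pow_two, mul_r]
  rcases Int.even_or_odd x.r with ⟨y, hy⟩ | ⟨y, hy⟩ <;> rw [hy]
  · exact ⟨2 * y ^ 2 + y + (x.s * x.t + x.t * x.s), by ring⟩
  · exact ⟨2 * y ^ 2 + 3 * y + 1 + (x.s * x.t + x.t * x.s), by ring⟩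

lemma md_sq7 {x y : CR} (hy : Od y) (h : md 3 x = md 3 y) : md 7 (x ^ 2) = md 7 (y ^ 2) := by
  rw [md_eq] at h
  obtain ⟨w, hw⟩ := h
  have hx : x = y + c ^ 3 * w := by linear_combination hw
  have := hc
  obtain ⟨v, hv⟩ : c ∣ y - 1 := by
    rw [od_r] at hy; rw [c_dvd]; simp only [sub_r, one_r]; omega
  obtain ⟨z, hz⟩ := c_dvd_sq_add w
  apply md_of_dvd (z := w * v + z)
  rw [hx]; linear_combination (-c ^ 3 * w * y) * this + c ^ 6 * hz + c ^ 6 * w * hv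

/-- last stage in case II -/
lemma A2_II_end {W p q : CR} (hW : W ^ 2 = (p ^ 2 + c ^ 2 * (1 + c) * q ^ 2) ^ 2 - 2 * c ^ 4 * pp * q ^ 4)
    (hp : Od p) (hq : Od q) (h3 : md 3 q = md 3 p) : False := by
  obtain ⟨f, p, q, rfl, rfl, hcop, hf⟩ := gcd_rm p q (Or.inl hp.ne_zero)
  have hfo := hp.left
  have hpo := hp.right
  have hqo := hq.right
  replace h3 := md_cancel hfo h3
  obtain ⟨Y, rfl⟩ : ∃ Y, W = f ^ 2 * Y := by
    apply sq_div (y := (p ^ 2 + c ^ 2 * (1 + c) * q ^ 2) ^ 2 - 2 * c ^ 4 * pp * q ^ 4)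
    rw [hW]; ring
  have hY : Y ^ 2 = (p ^ 2 + c ^ 2 * (1 + c) * q ^ 2) ^ 2 - 4 * (c * pp * q ^ 4) := by
    apply mul_left_cancel₀ (pow_ne_zero 4 hf)
    have := hc
    linear_combination hW - (2 * c * pp * f ^ 4 * q ^ 4) * this
  have hθ : Od (p ^ 2 + c ^ 2 * (1 + c) * q ^ 2) := (hpo.pow 2).congr ⟨-(c * (1 + c) * q ^ 2), by ring⟩
  obtain ⟨a, ha, hb⟩ := split (n := 1) hθ hY ⟨pp * q ^ 4, by ring⟩
  have hao : Od a := hθ.congr (by rwa [pow_one] at hb)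
  obtain ⟨b, hb⟩ := hb
  have hab : a * b = pp * (q ^ 2) ^ 2 := by
    apply mul_left_cancel₀ c_prime.ne_zero
    rw [hb] at ha; linear_combination ha
  have hcl : Cls a := by
    apply cls_of (Or.inr rfl) hab (hqo.pow 2).ne_zero
    intro r hr hra hrb
    have h1 : r ∣ pp * (q ^ 2) ^ 2 := by rw [← hab]; exact dvd_mul_of_dvd_left hra _
    rcases hr.dvd_or_dvd h1 with h | h
    · exact h
    exfalso
    have hrq := hr.dvd_of_dvd_pow (hr.dvd_of_dvd_pow h)
    have hrp : r ∣ p ^ 2 := by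
      have : r ∣ a + c ^ 1 * b - c ^ 2 * (1 + c) * q * q :=
        dvd_sub (dvd_add hra (dvd_mul_of_dvd_right hrb _)) (dvd_mul_of_dvd_right hrq _)
      convert this using 1
      linear_combination hb
    exact not_both hcop hr (hr.dvd_of_dvd_pow hrp) hrq
  obtain ⟨g, hg, t, rfl⟩ := hcl
  have ht : Od t := hao.right.of_pow (by norm_num)
  obtain ⟨y, hy, hpy⟩ := od_inv 7 hpo
  obtain ⟨s, hs, hts⟩ := sq_rep7 (ht.mul hy)
  have key : ∀ g ∈ G8, ∀ s ∈ SQ4, ¬ c ^ 7 ∣ g * s * (1 + c ^ 2 * (1 + c) - g * s) - c * pp := by decide +kernel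
  apply key g hg s hs
  rw [← md_eq]
  have h7 := md_sq7 hpo h3
  have h1 := congrArg (md 7) ha
  simp only [map_mul, map_pow, map_sub, map_add, map_one] at h1 h7 hts ⊢
  rw [← hts]
  have h8 : md 7 q ^ 4 = md 7 p ^ 4 := by linear_combination (md 7 q ^ 2 + md 7 p ^ 2) * h7
  rw [h8, h7] at h1
  linear_combination md 7 y ^ 4 * h1 + (md 7 c * md 7 pp * ((md 7 p * md 7 y) ^ 2 + 1) -
    md 7 g * md 7 t ^ 2 * md 7 y ^ 2 * (1 + md 7 c ^ 2 * (1 + md 7 c))) * (md 7 p * md 7 y + 1) * hpy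

lemma unit_u : IsUnit (c - 1) := by rw [nm_unit_iff]; decide

/-- middle stage in case II -/
lemma A2_II_mid {Y k q : CR} (hY : Y ^ 2 = (k ^ 2 - c ^ 5 * (1 + c) * q ^ 2) ^ 2 + c ^ 10 * (c - 1) ^ 2 * q ^ 4)
    (hk : Od k) (hq : Od q) (h3 : md 3 q = md 3 ((1 + c ^ 2) * k)) : False := by
  obtain ⟨f, k, q, rfl, rfl, hcop, hf⟩ := gcd_rm k q (Or.inl hk.ne_zero)
  have hfo := hk.left
  have hko := hk.right
  have hqo := hq.right
  replace h3 : md 3 q = md 3 ((1 + c ^ 2) * k) := by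
    apply md_cancel hfo; rw [h3]; congr 1; ring
  obtain ⟨Y, rfl⟩ : ∃ Z, Y = f ^ 2 * Z := by
    apply sq_div (y := (k ^ 2 - c ^ 5 * (1 + c) * q ^ 2) ^ 2 + c ^ 10 * (c - 1) ^ 2 * q ^ 4)
    rw [hY]; ring
  have hY : Y ^ 2 = (k ^ 2 - c ^ 5 * (1 + c) * q ^ 2) ^ 2 - 4 * (-(c ^ 4 * (c - 1) ^ 2 * q ^ 4)) := by
    apply mul_left_cancel₀ (pow_ne_zero 4 hf)
    have h6 : c ^ 6 = 4 := by decide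
    linear_combination hY + (c ^ 4 * (c - 1) ^ 2 * f ^ 4 * q ^ 4) * h6
  have hθ : Od (k ^ 2 - c ^ 5 * (1 + c) * q ^ 2) := (hko.pow 2).congr ⟨(c ^ 4 * (1 + c) * q ^ 2), by ring⟩
  obtain ⟨a, ha, hb⟩ := split (n := 4) hθ hY ⟨-((c - 1) ^ 2 * q ^ 4), by ring⟩
  have hao : Od a := hθ.congr ((dvd_pow_self c (by omega)).trans hb)
  obtain ⟨b, hb⟩ := hb
  have hab : a * (-b) = 1 * ((c - 1) * q ^ 2) ^ 2 := by
    apply mul_left_cancel₀ (pow_ne_zero 4 c_prime.ne_zero)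
    rw [hb] at ha; linear_combination -ha
  have hcl : Cls a := by
    apply cls_of (Or.inl rfl) hab (mul_ne_zero (by decide) (hqo.pow 2).ne_zero)
    intro r hr hra hrb
    exfalso
    have h1 : r ∣ 1 * ((c - 1) * q ^ 2) ^ 2 := by rw [← hab]; exact dvd_mul_of_dvd_left hra _
    rw [one_mul] at h1
    rcases hr.dvd_or_dvd (hr.dvd_of_dvd_pow h1) with h | h
    · exact hr.not_isUnit (isUnit_of_dvd_unit h unit_u)
    have hrq := (hr.dvd_of_dvd_pow h)
    have hrk : r ∣ k ^ 2 := by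
      have : r ∣ a - c ^ 4 * -b + c ^ 5 * (1 + c) * q * q :=
        dvd_add (dvd_sub hra (dvd_mul_of_dvd_right hrb _)) (dvd_mul_of_dvd_right hrq _)
      convert this using 1
      linear_combination hb
    exact not_both hcop hr (hr.dvd_of_dvd_pow hrk) hrq
  have h7 : md 7 a = md 7 ((1 - c ^ 5 * (1 + c) * (1 + c ^ 2) ^ 2 + c ^ 4 * (c - 1) ^ 2 * (1 + c ^ 2) ^ 4) * k ^ 2) := by
    have ha3 : md 3 a = md 3 (k ^ 2) := md_of_dvd (z := -c * b - c ^ 2 * (1 + c) * q ^ 2) (by linear_combination -hb)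
    have hb3 : md 3 b = md 3 (-((c - 1) ^ 2 * (1 + c ^ 2) ^ 4 * k ^ 2)) := by
      apply md_cancel (hko.pow 2)
      have := congrArg (md 3) hab
      simp only [map_mul, map_pow, map_neg, map_one] at this ha3 h3 ⊢
      rw [ha3, h3] at this
      linear_combination -this
    have hq2 := md_sq6 h3
    obtain ⟨v, hv⟩ := hq2
    rw [md_eq] at hb3
    obtain ⟨w, hw⟩ := hb3
    apply md_of_dvd (z := -w - (1 + c) * c ^ 4 * v)
    linear_combination -hb - c ^ 4 * hw - c ^ 5 * (1 + c) * hv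
  obtain ⟨g, hg, t, ht, p, h1, h2, h4, h5⟩ := cls_const hcl hao hko h7
  have key : ∀ g ∈ G8, ∀ s ∈ SQ4, c ^ 7 ∣ g * s - (1 - c ^ 5 * (1 + c) * (1 + c ^ 2) ^ 2 + c ^ 4 * (c - 1) ^ 2 * (1 + c ^ 2) ^ 4) →
      g = 1 ∧ c ^ 7 ∣ s - (1 + c ^ 2) ^ 2 := by decide +kernel
  obtain ⟨rfl, hs2⟩ := key g hg t ht h4
  rw [one_mul] at h1
  subst h1
  have hkp : md 3 p = md 3 ((1 + c ^ 2) * k) := by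
    apply sqrt_md3 (n := 1) (Od.mul (by decide) hko)
    rw [h5, map_mul, md_eq.2 hs2]
    simp only [map_mul, map_pow]; ring
  refine A2_II_end (W := k * p) (p := p) (q := q) ?_ h2 hqo (by rw [h3, hkp])
  have hc3 := hc
  have hp := hpp
  rw [hp]
  linear_combination ha + (c ^ 2 * (1 + c) * q ^ 2 * p ^ 2) * hc3

lemma A2_II {p q : ℤ} {s : CR} (hp : p % 2 = 1) (hq : q % 2 = 1) (hcop : IsCoprime p q)
    (hs : s ^ 2 = ((p : CR) ^ 2 + (2 * (2 - c ^ 2)) * p * q + 8 * (q : CR) ^ 2) ^ 2 - 4 * (pp * (c ^ 2 * p * q) ^ 2)) : False := by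
  have hpo := od_int hp
  have hqo := od_int hq
  have h9 : c ^ 9 = 8 := by decide
  have h6 : c ^ 6 = 4 := by decide
  have hc3 := hc
  obtain ⟨a, hcl, hao, ha, hb⟩ := startA (f := 2 * (2 - c ^ 2)) (g := 8) (ε := c ^ 2) 3 hpo hqo.ne_zero (by decide)
    (by simpa using hcop.map (Int.castRingHom CR)) (by decide) (by decide)
    (fun p hp h => Or.inl (prime_c_of_dvd hp (n := 9) (by rw [h9]; exact h))) hs
    ⟨(q : CR) ^ 2, by ring⟩
    (fun p hp h _ => prime_c_of_dvd hp h)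
  obtain ⟨b, hb⟩ := hb
  have hab : a * b = pp * p ^ 2 * q ^ 2 := by
    apply mul_left_cancel₀ (pow_ne_zero 4 c_prime.ne_zero)
    rw [hb] at ha; linear_combination ha
  obtain ⟨z, hz⟩ : ∃ z : ℤ, q = p + 2 * z := ⟨(q - p) / 2, by omega⟩
  have hz' : (q : CR) = p + 2 * z := by rw [hz]; push_cast; ring
  have hq3 : md 3 (q : CR) = md 3 (p : CR) := md_of_dvd (z := z) (by rw [hz', hc]; ring)
  have hb3 : md 3 b = md 3 (pp * p ^ 2) := by
    apply md_cancel (hpo.pow 2)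
    have ha3 : md 3 a = md 3 ((p : CR) ^ 2) :=
      md_of_dvd (z := -c * b + (2 - c ^ 2) * p * q + 4 * q ^ 2) (by
        linear_combination -hb - ((2 - c ^ 2) * p * q + 4 * (q : CR) ^ 2) * hc3)
    have := congrArg (md 3) hab
    simp only [map_mul, map_pow] at this ha3 hq3 ⊢
    rw [ha3, hq3] at this
    linear_combination this
  have h7 : md 7 a = md 7 ((1 + 4 - 2 * c ^ 2 - c ^ 4 * pp) * (p : CR) ^ 2) := by
    rw [md_eq] at hb3
    obtain ⟨v, hv⟩ := hb3
    apply md_of_dvd (z := -v + c ^ 2 * p * z - c * p * z + c ^ 2 * q ^ 2)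
    rw [hz'] at hb ⊢
    have h8 : c ^ 8 = 4 * c ^ 2 := by decide
    linear_combination -hb - c ^ 4 * hv + (- p * z - ((p : CR) + 2 * z) ^ 2) * h9 + p * z * h8
  obtain ⟨g, hg, t, ht, k, h1, h2, h3, h4⟩ := cls_const hcl hao hpo h7
  have key : ∀ g ∈ G8, ∀ s ∈ SQ4, c ^ 7 ∣ g * s - (1 + 4 - 2 * c ^ 2 - c ^ 4 * pp) →
      g = 1 ∧ c ^ 7 ∣ s - (1 + c ^ 2) ^ 2 := by decide +kernel
  obtain ⟨rfl, hs2⟩ := key g hg t ht h3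
  rw [one_mul] at h1
  subst h1
  have hkm : md 3 k = md 3 ((1 + c ^ 2) * (p : CR)) := by
    apply sqrt_md3 (n := 1) (Od.mul (by decide) hpo)
    rw [h4, map_mul, md_eq.2 hs2]
    simp only [map_mul, map_pow]; ring
  obtain ⟨Y, hY⟩ := T2g (p := p) (q := q) (F := 2 - c ^ 2) (g := 8) (E := pp * c ^ 4) h2.ne_zero
    (by linear_combination ha)
  refine A2_II_mid (Y := Y) (k := k) (q := q) ?_ h2 hqo ?_
  · have e1 : (2 - c ^ 2) ^ 2 - 8 - pp * c ^ 4 = - 2 * (c ^ 5 * (1 + c)) := by decide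
    have e2 : 8 * (pp * c ^ 4) = (c ^ 5 * (1 + c)) ^ 2 + c ^ 10 * (c - 1) ^ 2 := by decide
    rw [hY, e1, e2]; ring
  · rw [hq3, map_mul, hkm, ← map_mul, md_eq]
    have : c ^ 3 ∣ 1 - (1 + c ^ 2) * (1 + c ^ 2) := by decide
    obtain ⟨q, hq⟩ := this
    exact ⟨q * p, by linear_combination (p : CR) * hq⟩
end CR

namespace CR

/-- first splitting for the second family in case III -/
lemma H1 {Y k l : CR} (hY : Y ^ 2 = k ^ 4 - c ^ 4 * pp * (1 + c) * k ^ 2 * (c ^ 2 * l) ^ 2 + c ^ 5 * pp ^ 3 * (c ^ 2 * l) ^ 4)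
    (hk : Od k) (hl : l ≠ 0) :
    ∃ f k' l' g t, Od f ∧ k = f * k' ∧ l = f * l' ∧ Od k' ∧ l' ≠ 0 ∧ g ∈ G8 ∧ Od t ∧ IsCoprime k' l' ∧
      g * t ^ 2 * (k' ^ 2 + c ^ 2 * (-(c ^ 3 * pp * (1 + c))) * l' ^ 2 - g * t ^ 2) =
        c * (-(c ^ 3 * pp ^ 2 * (c - 1) ^ 2)) * l' ^ 4 := by
  obtain ⟨f, k, l, rfl, rfl, hcop, hf⟩ := gcd_rm k l (Or.inl hk.ne_zero)
  have hfo := hk.left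
  have hko := hk.right
  have hl0 : l ≠ 0 := right_ne_zero_of_mul hl
  obtain ⟨Y, rfl⟩ : ∃ Z, Y = f ^ 2 * Z := by
    apply sq_div (y := k ^ 4 - c ^ 4 * pp * (1 + c) * k ^ 2 * (c ^ 2 * l) ^ 2 + c ^ 5 * pp ^ 3 * (c ^ 2 * l) ^ 4)
    rw [hY]; ring
  have hY : Y ^ 2 = (k ^ 2 - c ^ 5 * pp * (1 + c) * l ^ 2) ^ 2 - 4 * (-(c ^ 4 * (pp * (c - 1) * l ^ 2) ^ 2)) := by
    apply mul_left_cancel₀ (pow_ne_zero 4 hf)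
    have e1 : c ^ 8 = 2 * c ^ 5 := by decide
    have e2 : c ^ 13 * pp ^ 3 = c ^ 10 * pp ^ 2 * (1 + c) ^ 2 + 4 * c ^ 4 * pp ^ 2 * (c - 1) ^ 2 := by decide
    linear_combination hY - (f ^ 4 * k ^ 2 * l ^ 2 * pp * (1 + c)) * e1 + f ^ 4 * l ^ 4 * e2
  have hθ : Od (k ^ 2 - c ^ 5 * pp * (1 + c) * l ^ 2) := (hko.pow 2).congr ⟨(c ^ 4 * pp * (1 + c) * l ^ 2), by ring⟩
  obtain ⟨a, ha, hb⟩ := split (n := 4) hθ hY ⟨-((pp * (c - 1) * l ^ 2) ^ 2), by ring⟩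
  have hao : Od a := hθ.congr ((dvd_pow_self c (by omega)).trans hb)
  obtain ⟨b, hb⟩ := hb
  have hab : a * (-b) = 1 * (pp * (c - 1) * l ^ 2) ^ 2 := by
    apply mul_left_cancel₀ (pow_ne_zero 4 c_prime.ne_zero)
    rw [hb] at ha; linear_combination -ha
  have hcl : Cls a := by
    apply cls_of (Or.inl rfl) hab (mul_ne_zero (by decide) (pow_ne_zero 2 hl0))
    intro r hr hra hrb
    have h1 : r ∣ 1 * (pp * (c - 1) * l ^ 2) ^ 2 := by rw [← hab]; exact dvd_mul_of_dvd_left hra _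
    rw [one_mul] at h1
    rcases hr.dvd_or_dvd (hr.dvd_of_dvd_pow h1) with h | h
    · rcases hr.dvd_or_dvd h with h | h
      · exact h
      · exact absurd (isUnit_of_dvd_unit h unit_u) hr.not_isUnit
    exfalso
    have hrq := (hr.dvd_of_dvd_pow h)
    have hrk : r ∣ k ^ 2 := by
      have : r ∣ a - c ^ 4 * -b + c ^ 5 * pp * (1 + c) * l * l :=
        dvd_add (dvd_sub hra (dvd_mul_of_dvd_right hrb _)) (dvd_mul_of_dvd_right hrq _)
      convert this using 1
      linear_combination hb
    exact not_both hcop hr (hr.dvd_of_dvd_pow hrk) hrq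
  obtain ⟨g, hg, t, rfl⟩ := hcl
  exact ⟨f, k, l, g, t, hfo, rfl, rfl, hko, hl0, hg, hao.right.of_pow (by norm_num), hcop, by linear_combination ha⟩

/-- second splitting -/
lemma H2 {W p l : CR} (hW : W ^ 2 = (p ^ 2 + c ^ 2 * (pp * (1 + c)) * l ^ 2) ^ 2 - 4 * (c * pp ^ 3 * l ^ 4))
    (hp : Od p) (hl : l ≠ 0) :
    ∃ f p' l' g t, Od f ∧ p = f * p' ∧ l = f * l' ∧ Od p' ∧ l' ≠ 0 ∧ g ∈ G8 ∧ Od t ∧ IsCoprime p' l' ∧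
      g * t ^ 2 * (p' ^ 2 + c ^ 2 * (pp * (1 + c)) * l' ^ 2 - g * t ^ 2) = c * (pp ^ 3) * l' ^ 4 := by
  obtain ⟨f, p, q, rfl, rfl, hcop, hf⟩ := gcd_rm p l (Or.inl hp.ne_zero)
  have hfo := hp.left
  have hpo := hp.right
  have hq0 : q ≠ 0 := right_ne_zero_of_mul hl
  obtain ⟨Y, rfl⟩ : ∃ Y, W = f ^ 2 * Y := by
    apply sq_div (y := (p ^ 2 + c ^ 2 * (pp * (1 + c)) * q ^ 2) ^ 2 - 4 * (c * pp ^ 3 * q ^ 4))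
    rw [hW]; ring
  have hY : Y ^ 2 = (p ^ 2 + c ^ 2 * (pp * (1 + c)) * q ^ 2) ^ 2 - 4 * (c * pp ^ 3 * q ^ 4) := by
    apply mul_left_cancel₀ (pow_ne_zero 4 hf)
    linear_combination hW
  have hθ : Od (p ^ 2 + c ^ 2 * (pp * (1 + c)) * q ^ 2) := (hpo.pow 2).congr ⟨-(c * (pp * (1 + c)) * q ^ 2), by ring⟩
  obtain ⟨a, ha, hb⟩ := split (n := 1) hθ hY ⟨pp ^ 3 * q ^ 4, by ring⟩
  have hao : Od a := hθ.congr (by rwa [pow_one] at hb)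
  obtain ⟨b, hb⟩ := hb
  have hab : a * b = pp * (pp * q ^ 2) ^ 2 := by
    apply mul_left_cancel₀ c_prime.ne_zero
    rw [hb] at ha; linear_combination ha
  have hcl : Cls a := by
    apply cls_of (Or.inr rfl) hab (mul_ne_zero pp_prime.ne_zero (pow_ne_zero 2 hq0))
    intro r hr hra hrb
    have h1 : r ∣ pp * (pp * q ^ 2) ^ 2 := by rw [← hab]; exact dvd_mul_of_dvd_left hra _
    rcases hr.dvd_or_dvd h1 with h | h
    · exact h
    rcases hr.dvd_or_dvd (hr.dvd_of_dvd_pow h) with h | h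
    · exact h
    exfalso
    have hrq := hr.dvd_of_dvd_pow h
    have hrp : r ∣ p ^ 2 := by
      have : r ∣ a + c ^ 1 * b - c ^ 2 * (pp * (1 + c)) * q * q :=
        dvd_sub (dvd_add hra (dvd_mul_of_dvd_right hrb _)) (dvd_mul_of_dvd_right hrq _)
      convert this using 1
      linear_combination hb
    exact not_both hcop hr (hr.dvd_of_dvd_pow hrp) hrq
  obtain ⟨g, hg, t, rfl⟩ := hcl
  exact ⟨f, p, q, g, t, hfo, rfl, rfl, hpo, hq0, hg, hao.right.of_pow (by norm_num), hcop, by linear_combination ha⟩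

/-- normalisation at precision `n` -/
lemma norm_n {n : ℕ} (hn7 : 7 ≤ n) (hn : n ≤ 10) {g t k l τ A N : CR} (hk : Od k) (ht : Od t)
    (h : g * t ^ 2 * (k ^ 2 + c ^ 2 * A * l ^ 2 - g * t ^ 2) = c * N * l ^ 4)
    (hl : md n (l ^ 2) = md n ((τ * k) ^ 2)) :
    ∃ y ∈ O64, md 7 t = md 7 (y * k) ∧ c ^ n ∣ g * y ^ 2 * (1 + c ^ 2 * A * τ ^ 2 - g * y ^ 2) - c * N * τ ^ 4 := by
  obtain ⟨q, hq, hkq⟩ := od_inv n hk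
  obtain ⟨y, hy, hy10, hy7⟩ := sq_rep10 (ht.mul hq)
  refine ⟨y, hy, ?_, ?_⟩
  · have : md 7 k * md 7 q = 1 := by
      rw [← map_mul, ← map_one (md 7)]
      apply md_mono (n := n) hn7
      rw [map_mul, hkq, map_one]
    rw [map_mul, ← hy7, map_mul]
    linear_combination (-md 7 t) * this
  · rw [← md_eq]
    have h3 := congrArg (md n) h
    have hy2 : md n ((t * q) ^ 2) = md n (y ^ 2) := by
      apply md_mono (n := 10) hn
      rw [map_pow, hy10, map_pow]
    have hl4 : md n (l ^ 4) = md n ((τ * k) ^ 4) := by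
      rw [show l ^ 4 = l ^ 2 * l ^ 2 by ring, map_mul, hl, ← map_mul]; congr 1; ring
    simp only [map_mul, map_sub, map_add, map_pow, map_one] at hl hl4 h3 hy2 ⊢
    rw [← hy2]
    linear_combination md n q ^ 4 * h3 + md n c * md n N * md n q ^ 4 * hl4
        - md n g * md n t ^ 2 * md n q ^ 4 * (md n c ^ 2 * md n A) * hl
        - md n g * md n t ^ 2 * md n q ^ 2 * (1 + md n c ^ 2 * md n A * md n τ ^ 2) * (md n k * md n q + 1) * hkq
        + md n c * md n N * md n τ ^ 4 * ((md n k * md n q) ^ 2 + 1) * (md n k * md n q + 1) * hkq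

lemma step12 {k l t : CR} (h : 1 * t ^ 2 * (k ^ 2 + c ^ 2 * (-(c ^ 3 * pp * (1 + c))) * l ^ 2 - 1 * t ^ 2) =
        c * (-(c ^ 3 * pp ^ 2 * (c - 1) ^ 2)) * l ^ 4) :
    (k * t) ^ 2 = (t ^ 2 + c ^ 2 * (pp * (1 + c)) * l ^ 2) ^ 2 - 4 * (c * pp ^ 3 * l ^ 4) := by
  have e1 : c ^ 5 = 2 * c ^ 2 := by decide
  have e2 : c ^ 4 * pp ^ 2 * (1 + c) ^ 2 - 4 * c * pp ^ 3 = - c ^ 4 * pp ^ 2 * (c - 1) ^ 2 := by decide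
  linear_combination h + t ^ 2 * pp * (1 + c) * l ^ 2 * e1 - l ^ 4 * e2

/-- excluded residue class -/
lemma notA2 {Y k l : CR} (hY : Y ^ 2 = k ^ 4 - c ^ 4 * pp * (1 + c) * k ^ 2 * (c ^ 2 * l) ^ 2 + c ^ 5 * pp ^ 3 * (c ^ 2 * l) ^ 4)
    (hk : Od k) (hl : Od l) (h3 : md 3 l = md 3 ((1 + c ^ 2) * k)) : False := by
  obtain ⟨f, k, l, g, t, hf, rfl, rfl, hk, -, hg, ht, -, h⟩ := H1 hY hk hl.ne_zero
  have hlo := hl.right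
  replace h3 : md 3 l = md 3 ((1 + c ^ 2) * k) := by
    apply md_cancel hf; rw [h3]; congr 1; ring
  obtain ⟨y, hy, hty, hd⟩ := norm_n (n := 7) le_rfl (by norm_num) hk ht h (md_sq7 (Od.mul (by decide) hk) h3)
  have key : ∀ g ∈ G8, ∀ y ∈ O64, c ^ 7 ∣ g * y ^ 2 * (1 + c ^ 2 * (-(c ^ 3 * pp * (1 + c))) * (1 + c ^ 2) ^ 2 - g * y ^ 2)
      - c * (-(c ^ 3 * pp ^ 2 * (c - 1) ^ 2)) * (1 + c ^ 2) ^ 4 → g = 1 ∧ c ^ 3 ∣ y - (1 + c ^ 2) := by decide +kernel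
  obtain ⟨rfl, hy3⟩ := key g hg y hy hd
  have htk : md 3 t = md 3 l := by
    rw [md_mono (by norm_num) hty, h3, map_mul, md_eq.2 hy3, ← map_mul]
  obtain ⟨f, t, l, g, r, hf, rfl, rfl, ht, -, hg, hr, -, h⟩ := H2 (step12 h) ht hlo.ne_zero
  replace htk : md 3 l = md 3 (1 * t) := by
    rw [one_mul]; exact (md_cancel hf htk).symm
  obtain ⟨y, hy, hty, hd⟩ := norm_n (n := 7) le_rfl (by norm_num) ht hr h (md_sq7 (Od.mul (by decide) ht) htk)
  have key : ∀ g ∈ G8, ∀ y ∈ O64, ¬ c ^ 7 ∣ g * y ^ 2 * (1 + c ^ 2 * (pp * (1 + c)) * 1 ^ 2 - g * y ^ 2)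
      - c * (pp ^ 3) * 1 ^ 4 := by decide +kernel
  exact key g hg y hy hd

lemma finA2 {Y k l σ ρ : CR} (hX : Y ^ 2 = k ^ 4 - c ^ 4 * pp * (1 + c) * k ^ 2 * l ^ 2 + c ^ 5 * pp ^ 3 * l ^ 4) (hk : k ≠ 0)
    (hσ : Od σ) (hρ : md 3 ρ = md 3 ((1 + c ^ 2) * σ)) (h : σ * l = c ^ 2 * ρ * k) : False := by
  obtain ⟨g, k, l, rfl, rfl, hcop, hg⟩ := gcd_rm k l (Or.inl hk)
  obtain ⟨Y, rfl⟩ : ∃ Z, Y = g ^ 2 * Z := by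
    apply sq_div (y := k ^ 4 - c ^ 4 * pp * (1 + c) * k ^ 2 * l ^ 2 + c ^ 5 * pp ^ 3 * l ^ 4)
    rw [hX]; ring
  have hY : Y ^ 2 = k ^ 4 - c ^ 4 * pp * (1 + c) * k ^ 2 * l ^ 2 + c ^ 5 * pp ^ 3 * l ^ 4 := by
    apply mul_left_cancel₀ (pow_ne_zero 4 hg)
    linear_combination hX
  have h' : σ * l = c ^ 2 * ρ * k := by
    apply mul_left_cancel₀ hg
    linear_combination h
  obtain ⟨l0, rfl⟩ : c ^ 2 ∣ l := by
    apply odd_cancel hσ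
    rw [h']; exact ⟨ρ * k, by ring⟩
  have hko : Od k := by
    intro hh
    exact not_both hcop c_prime hh (dvd_mul_of_dvd_left (dvd_pow_self c (by norm_num)) _)
  have h2 : σ * l0 = ρ * k := by
    apply mul_left_cancel₀ (pow_ne_zero 2 c_prime.ne_zero)
    linear_combination h'
  have hρo : Od ρ := Od.congr_md (Od.mul (by decide) hσ) (by norm_num) hρ.symm
  have hlo : Od l0 := (show Od (σ * l0) by rw [h2]; exact hρo.mul hko).right
  refine notA2 hY hko hlo ?_
  apply md_cancel hσ
  rw [h2, map_mul, hρ, ← map_mul]; congr 1; ring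

/-- addition formula -/
lemma addA2 {d a e r l V r1 l1 V1 : CR} (h : V ^ 2 = d * r ^ 4 + a * r ^ 2 * l ^ 2 + e * l ^ 4)
    (h1 : V1 ^ 2 = d * r1 ^ 4 + a * r1 ^ 2 * l1 ^ 2 + e * l1 ^ 4) :
    (r * r1 * l * l1 * (a * (r ^ 2 * l1 ^ 2 + r1 ^ 2 * l ^ 2) + 2 * e * l ^ 2 * l1 ^ 2 + 2 * d * r ^ 2 * r1 ^ 2)
      - V * V1 * (r ^ 2 * l1 ^ 2 + r1 ^ 2 * l ^ 2)) ^ 2 =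
    (V * r1 * l1 - V1 * r * l) ^ 4 + a * (V * r1 * l1 - V1 * r * l) ^ 2 * (r ^ 2 * l1 ^ 2 - r1 ^ 2 * l ^ 2) ^ 2
      + d * e * (r ^ 2 * l1 ^ 2 - r1 ^ 2 * l ^ 2) ^ 4 := by
  have hk : (V * r1 * l1 - V1 * r * l) ^ 2 = (d * r ^ 4 + a * r ^ 2 * l ^ 2 + e * l ^ 4) * (r1 * l1) ^ 2 +
      (d * r1 ^ 4 + a * r1 ^ 2 * l1 ^ 2 + e * l1 ^ 4) * (r * l) ^ 2 - 2 * (r * l * r1 * l1) * (V * V1) := by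
    linear_combination (r1 * l1) ^ 2 * h + (r * l) ^ 2 * h1
  have hz : (V * V1) ^ 2 = (d * r ^ 4 + a * r ^ 2 * l ^ 2 + e * l ^ 4) * (d * r1 ^ 4 + a * r1 ^ 2 * l1 ^ 2 + e * l1 ^ 4) := by
    rw [mul_pow, h, h1]
  rw [show (V * r1 * l1 - V1 * r * l) ^ 4 = ((V * r1 * l1 - V1 * r * l) ^ 2) ^ 2 by ring, hk]
  generalize V * V1 = z at *
  linear_combination ((r ^ 2 * l1 ^ 2 + r1 ^ 2 * l ^ 2) ^ 2 - 4 * (r * l * r1 * l1) ^ 2) * hz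

end CR

namespace CR

lemma subA2 {p r l V : CR} (hp : Od p) (hl : md 6 l = md 6 ((⟨1, 3, 3⟩ : CR) * p))
    (hr : md 6 r = md 6 ((⟨1, 1, 2⟩ : CR) * p)) (hV : pp * V = p * r)
    (hq : (c - 1) * pp * V ^ 2 = (c - 1) ^ 2 * r ^ 4 - (c - 1) * c ^ 2 * (1 + c) * r ^ 2 * l ^ 2 + pp * c * l ^ 4) :
    False := by
  obtain ⟨r1, hr1⟩ : ∃ x : CR, x = ⟨1, -2, 0⟩ := ⟨_, rfl⟩
  obtain ⟨l1, hl1⟩ : ∃ x : CR, x = ⟨1, 0, -1⟩ := ⟨_, rfl⟩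
  obtain ⟨V1, hV1⟩ : ∃ x : CR, x = ⟨5, 1, -4⟩ := ⟨_, rfl⟩
  have hq1 : (c - 1) * pp * V1 ^ 2 = (c - 1) ^ 2 * r1 ^ 4 - (c - 1) * c ^ 2 * (1 + c) * r1 ^ 2 * l1 ^ 2 + pp * c * l1 ^ 4 := by
    rw [hr1, hl1, hV1]; decide
  have hui : (c - 1) * (1 + c + c ^ 2) = 1 := by decide
  have E0 : ∀ V r l : CR, (c - 1) * pp * V ^ 2 = (c - 1) ^ 2 * r ^ 4 - (c - 1) * c ^ 2 * (1 + c) * r ^ 2 * l ^ 2 + pp * c * l ^ 4 →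
      (c * pp * V) ^ 2 = (c ^ 2 * (c - 1) * pp) * r ^ 4 + (-(c ^ 4 * pp * (1 + c))) * r ^ 2 * l ^ 2 +
        (c ^ 3 * pp ^ 2 * (1 + c + c ^ 2)) * l ^ 4 := by
    intro V r l h
    have h0 : (c - 1) ≠ 0 := by decide
    apply mul_left_cancel₀ h0
    linear_combination c ^ 2 * pp * h - c ^ 3 * pp ^ 2 * l ^ 4 * hui
  have hV6 : md 6 V = md 6 ((⟨3, 3, 3⟩ : CR) * p ^ 2) := by
    apply md_cancel (show Od pp by decide)
    rw [hV, map_mul, hr, ← map_mul]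
    have : c ^ 6 ∣ (⟨1, 1, 2⟩ : CR) - pp * ⟨3, 3, 3⟩ := by decide
    obtain ⟨z, hz⟩ := this
    rw [md_eq]
    exact ⟨z * p ^ 2, by linear_combination p ^ 2 * hz⟩
  have hrl : md 6 (r * l) = md 6 ((⟨1, 1, 2⟩ : CR) * ⟨1, 3, 3⟩ * p ^ 2) := by
    rw [map_mul, hr, hl, ← map_mul]; congr 1; ring
  rw [md_eq] at hV6 hrl
  obtain ⟨w, hw⟩ := hV6
  obtain ⟨w2, hw2⟩ := hrl
  have hκ : V * r1 * l1 - V1 * (r * l) = c ^ 3 * ((⟨7, -16, 13⟩ : CR) * p ^ 2 + c ^ 3 * (r1 * l1 * w - V1 * w2)) := by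
    have : (⟨3, 3, 3⟩ : CR) * r1 * l1 - V1 * (⟨1, 1, 2⟩ * ⟨1, 3, 3⟩) = c ^ 3 * (⟨7, -16, 13⟩ : CR) := by
      rw [hr1, hl1, hV1]; decide
    linear_combination r1 * l1 * hw - V1 * hw2 + p ^ 2 * this
  generalize hκ0 : (⟨7, -16, 13⟩ : CR) * p ^ 2 + c ^ 3 * (r1 * l1 * w - V1 * w2) = κ at hκ
  have hκm : md 3 κ = md 3 ((⟨7, -16, 13⟩ : CR) * p ^ 2) := by
    rw [md_eq, ← hκ0]; exact ⟨r1 * l1 * w - V1 * w2, by ring⟩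
  obtain ⟨S, hS⟩ : ∃ S, S = (c - 1) ^ 2 * r ^ 2 * r1 ^ 2 - c * pp * l ^ 2 * l1 ^ 2 := ⟨_, rfl⟩
  have hSm : md 3 S = md 3 ((1 + c) * p ^ 2) := by
    have hl3 := md_mono (m := 3) (by norm_num) hl
    have hr3 := md_mono (m := 3) (by norm_num) hr
    have : c ^ 3 ∣ (c - 1) ^ 2 * (⟨1, 1, 2⟩ : CR) ^ 2 * r1 ^ 2 - c * pp * (⟨1, 3, 3⟩ : CR) ^ 2 * l1 ^ 2 - (1 + c) := by
      rw [hr1, hl1]; decide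
    rw [← md_eq] at this
    rw [hS]
    simp only [map_mul, map_sub, map_pow] at this hl3 hr3 ⊢
    rw [hl3, hr3]
    linear_combination md 3 p ^ 2 * this
  have hadd := addA2 (E0 V r l hq) (E0 (-V1) r1 l1 (by rw [neg_sq]; exact hq1))
  have hde : c ^ 2 * (c - 1) * pp * (c ^ 3 * pp ^ 2 * (1 + c + c ^ 2)) = c ^ 5 * pp ^ 3 := by
    linear_combination c ^ 5 * pp ^ 3 * hui
  rw [hde] at hadd
  refine finA2 (σ := S) (ρ := (c - 1) * κ) (k := c * pp * V * r1 * l1 - c * pp * (-V1) * r * l)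
    (l := r ^ 2 * l1 ^ 2 - r1 ^ 2 * l ^ 2) (by rw [hadd]; ring) ?_ ?_ ?_ ?_
  · intro h0
    have h1 : c * pp * (V * r1 * l1 + V1 * (r * l)) = 0 := by rw [← h0]; ring
    rcases mul_eq_zero.1 h1 with h2 | h2
    · exact absurd h2 (by decide)
    have h3 : c ^ 6 ∣ (p ^ 2) * ((⟨3, 3, 3⟩ : CR) * r1 * l1 + V1 * (⟨1, 1, 2⟩ * ⟨1, 3, 3⟩)) :=
      ⟨-(r1 * l1 * w + V1 * w2), by linear_combination h2 - r1 * l1 * hw - V1 * hw2⟩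
    have h4 := odd_cancel (hp.pow 2) h3
    rw [hr1, hl1, hV1] at h4
    revert h4; decide
  · exact Od.congr_md (Od.mul (by decide) (hp.pow 2)) (by norm_num) hSm.symm
  · rw [map_mul, hκm, map_mul _ _ S, hSm, ← map_mul, ← map_mul]
    have : c ^ 3 ∣ (c - 1) * (⟨7, -16, 13⟩ : CR) - (1 + c ^ 2) * (1 + c) := by decide
    obtain ⟨z, hz⟩ := this
    rw [md_eq]
    exact ⟨z * p ^ 2, by linear_combination p ^ 2 * hz⟩
  · have h0 : c ^ 2 * pp ≠ 0 := by decide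
    apply mul_left_cancel₀ h0
    have e1 : (c - 1) * (V * r1 * l1 + V1 * (r * l)) * (V * r1 * l1 - V1 * (r * l)) * pp =
      (r ^ 2 * l1 ^ 2 - r1 ^ 2 * l ^ 2) * S := by
      rw [hS]
      linear_combination (r1 * l1) ^ 2 * hq - (r * l) ^ 2 * hq1
    rw [hκ] at e1
    linear_combination -c ^ 2 * pp * e1

lemma md_sq9 {x y : CR} (h : md 6 x = md 6 y) : md 9 (x ^ 2) = md 9 (y ^ 2) := by
  rw [md_eq] at h
  obtain ⟨w, hw⟩ := h
  have hx : x = y + c ^ 6 * w := by linear_combination hw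
  have := hc
  apply md_of_dvd (z := w * y + c ^ 3 * w ^ 2)
  rw [hx]; linear_combination (-c ^ 6 * w * y) * this

/-- bottom stage -/
lemma botA2 {Y k l : CR} (hY : Y ^ 2 = k ^ 4 - c ^ 4 * pp * (1 + c) * k ^ 2 * (c ^ 2 * l) ^ 2 + c ^ 5 * pp ^ 3 * (c ^ 2 * l) ^ 4)
    (hk : Od k) (hl : Od l) (h6 : md 6 l = md 6 (qq * (1 + c + c ^ 2) * k)) : False := by
  obtain ⟨f, k, l, g, t, hf, rfl, rfl, hk, -, hg, ht, -, h⟩ := H1 hY hk hl.ne_zero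
  have hlo := hl.right
  replace h6 : md 6 l = md 6 (qq * (1 + c + c ^ 2) * k) := by
    apply md_cancel hf; rw [h6]; congr 1; ring
  obtain ⟨y, hy, hty, hd⟩ := norm_n (n := 9) (by norm_num) (by norm_num) hk ht h (md_sq9 h6)
  have key : ∀ g ∈ G8, ∀ y ∈ O64, c ^ 9 ∣ g * y ^ 2 * (1 + c ^ 2 * (-(c ^ 3 * pp * (1 + c))) * (qq * (1 + c + c ^ 2)) ^ 2 - g * y ^ 2)
      - c * (-(c ^ 3 * pp ^ 2 * (c - 1) ^ 2)) * (qq * (1 + c + c ^ 2)) ^ 4 → g = 1 ∧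
        (c ^ 6 ∣ qq * (1 + c + c ^ 2) - ⟨1, 3, 3⟩ * y ∨ c ^ 6 ∣ qq * (1 + c + c ^ 2) - ⟨1, 3, 3⟩ * -y) := by decide +kernel
  obtain ⟨rfl, hy3⟩ := key g hg y hy hd
  have h12 := step12 h
  have hty6 := md_mono (m := 6) (by norm_num) hty
  have main : ∀ t, Od t → (k * t) ^ 2 = (t ^ 2 + c ^ 2 * (pp * (1 + c)) * l ^ 2) ^ 2 - 4 * (c * pp ^ 3 * l ^ 4) →
      md 6 l = md 6 ((⟨1, 3, 3⟩ : CR) * t) → False := by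
    intro t ht h12 hlt
    obtain ⟨f, p, l, g, r, hf, rfl, rfl, hp, -, hg, hr, -, h⟩ := H2 h12 ht hlo.ne_zero
    replace hlt : md 6 l = md 6 ((⟨1, 3, 3⟩ : CR) * p) := by
      apply md_cancel hf; rw [hlt]; congr 1; ring
    obtain ⟨y, hy, hry, hd⟩ := norm_n (n := 9) (by norm_num) (by norm_num) hp hr h (md_sq9 hlt)
    have key : ∀ g ∈ G8, ∀ y ∈ O64, c ^ 9 ∣ g * y ^ 2 * (1 + c ^ 2 * (pp * (1 + c)) * (⟨1, 3, 3⟩ : CR) ^ 2 - g * y ^ 2)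
      - c * (pp ^ 3) * (⟨1, 3, 3⟩ : CR) ^ 4 → g = (c - 1) * pp ∧
        (c ^ 6 ∣ y - ⟨1, 1, 2⟩ ∨ c ^ 6 ∣ -y - ⟨1, 1, 2⟩) := by decide +kernel
    obtain ⟨rfl, hy6⟩ := key g hg y hy hd
    have hry6 := md_mono (m := 6) (by norm_num) hry
    have main2 : ∀ r, (c - 1) * pp * r ^ 2 * (p ^ 2 + c ^ 2 * (pp * (1 + c)) * l ^ 2 - (c - 1) * pp * r ^ 2) = c * pp ^ 3 * l ^ 4 →
        md 6 r = md 6 ((⟨1, 1, 2⟩ : CR) * p) → False := by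
      intro r h hr6
      have h2 : (c - 1) * r ^ 2 * (p ^ 2 + c ^ 2 * (pp * (1 + c)) * l ^ 2 - (c - 1) * pp * r ^ 2) = c * pp ^ 2 * l ^ 4 := by
        apply mul_left_cancel₀ pp_prime.ne_zero
        linear_combination h
      obtain ⟨V, hV⟩ : pp ∣ p * r := by
        have : pp ∣ (p * r) ^ 2 := by
          have hui : (c - 1) * (1 + c + c ^ 2) = 1 := by decide
          exact ⟨(1 + c + c ^ 2) * (c * pp * l ^ 4 - (c - 1) * r ^ 2 * c ^ 2 * (1 + c) * l ^ 2 + (c - 1) ^ 2 * r ^ 4), by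
            linear_combination (1 + c + c ^ 2) * h2 - (p * r) ^ 2 * hui⟩
        exact pp_prime.dvd_of_dvd_pow this
      refine subA2 hp hlt hr6 hV.symm ?_
      apply mul_left_cancel₀ pp_prime.ne_zero
      linear_combination h2 - (c - 1) * (p * r + pp * V) * hV
    rcases hy6 with h6 | h6
    · refine main2 r h ?_
      rw [hry6, map_mul, md_eq.2 h6, map_mul]
    · refine main2 (-r) (by linear_combination h) ?_
      rw [map_neg, hry6, ← map_neg, ← neg_mul, map_mul, md_eq.2 h6, map_mul]
  rcases hy3 with h3 | h3
  · refine main t ht h12 ?_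
    rw [h6, map_mul, md_eq.2 h3, map_mul _ _ t, hty6]; simp only [map_mul]; ring
  · refine main (-t) ht.neg (by linear_combination h12) ?_
    rw [h6, map_mul, md_eq.2 h3, map_mul _ _ (-t), map_neg, hty6]; simp only [map_mul, map_neg]; ring

/-- the deep stage -/
lemma deepA2 {Y k l : CR} (hY : Y ^ 2 = k ^ 4 - c ^ 4 * pp * (1 + c) * k ^ 2 * (c ^ 2 * (c ^ 3 * l)) ^ 2 + c ^ 5 * pp ^ 3 * (c ^ 2 * (c ^ 3 * l)) ^ 4)
    (hk : Od k) (hl : Od l) (h6 : md 6 ((c - 1) * l) = md 6 (qq * k * (1 + c ^ 5))) : False := by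
  obtain ⟨f, k, l', g, t, hf, rfl, h0, hk, -, hg, ht, -, h⟩ := H1 hY hk (mul_ne_zero (pow_ne_zero 3 c_prime.ne_zero) hl.ne_zero)
  obtain ⟨l, rfl⟩ : c ^ 3 ∣ l' := odd_cancel hf ⟨_, h0.symm⟩
  obtain rfl : _ = f * l := mul_left_cancel₀ (pow_ne_zero 3 c_prime.ne_zero) (h0.trans (mul_left_comm _ _ _))
  have hlo := hl.right
  replace h6 : md 6 ((c - 1) * l) = md 6 (qq * k * (1 + c ^ 5)) := by
    apply md_cancel hf; convert h6 using 2 <;> ring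
  have hao : Od (g * t ^ 2) := by
    apply Od.mul _ (ht.pow 2)
    have : ∀ g ∈ G8, Od g := by decide
    exact this g hg
  obtain ⟨t', hta, ht', hkt⟩ := cls_root (a := g * t ^ 2) (k := k) ⟨g, hg, t, rfl⟩ hao hk (by
    apply odd_cancel hao
    exact ⟨c * (pp * (1 + c)) * l ^ 2 * (g * t ^ 2) - c ^ 6 * pp ^ 2 * (c - 1) ^ 2 * l ^ 4, by linear_combination h⟩)
  rw [hta] at h
  obtain ⟨f2, p, l', g', r, hf2, rfl, h0, hp, -, hg', hr, -, h2⟩ := H2 (step12 (t := t') (k := k) (l := c ^ 3 * l) (by linear_combination h)) ht'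
    (mul_ne_zero (pow_ne_zero 3 c_prime.ne_zero) hlo.ne_zero)
  obtain ⟨l2, rfl⟩ : c ^ 3 ∣ l' := odd_cancel hf2 ⟨_, h0.symm⟩
  obtain rfl : l = f2 * l2 := mul_left_cancel₀ (pow_ne_zero 3 c_prime.ne_zero) (h0.trans (mul_left_comm _ _ _))
  have hl2 := hlo.right
  have hao' : Od (g' * r ^ 2) := by
    apply Od.mul _ (hr.pow 2)
    have : ∀ g ∈ G8, Od g := by decide
    exact this g' hg'
  obtain ⟨b, hb⟩ : c ^ 9 ∣ p ^ 2 + c ^ 2 * (pp * (1 + c)) * (c ^ 3 * l2) ^ 2 - g' * r ^ 2 := by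
    apply odd_cancel hao'
    rw [h2]; exact ⟨c ^ 4 * pp ^ 3 * l2 ^ 4, by ring⟩
  obtain ⟨r', hra, hr'⟩ := cls_one (a := g' * r ^ 2) (k := p) ⟨g', hg', r, rfl⟩ hao' hp (by
    apply md_of_dvd (z := c * (pp * (1 + c)) * l2 ^ 2 - c ^ 2 * b)
    linear_combination -hb)
  rw [hra] at h2 hb
  have h9 : md (3 + 6) r' ^ 2 = md (3 + 6) (p * (1 + c ^ 5)) ^ 2 := by
    obtain ⟨x, hx⟩ : c ∣ l2 - 1 := by
      rw [od_r] at hl2; rw [c_dvd]; simp only [sub_r, one_r]; omega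
    obtain ⟨z, hz⟩ : c ∣ p - 1 := by
      rw [od_r] at hp; rw [c_dvd]; simp only [sub_r, one_r]; omega
    have e8 : c ^ 8 = 2 * c ^ 5 := by decide
    have e : pp * (1 + c) = 1 + c * ⟨1, 1, 1⟩ := by decide
    rw [← map_pow, ← map_pow]
    apply md_of_dvd (z := -b - c * p ^ 2 + ⟨1, 1, 1⟩ * l2 ^ 2 + (l2 + 1) * x - (p + 1) * z)
    linear_combination -hb + c ^ 8 * l2 ^ 2 * e + (-p ^ 2) * (-e8) + c ^ 8 * ((l2 + 1) * hx - (p + 1) * hz)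
  have hfin : ∀ r, Od r → r ^ 2 = r' ^ 2 → md 6 r = md 6 (p * (1 + c ^ 5)) → False := by
    intro r hr hrr hrp
    refine botA2 (Y := r * p) (k := r) (l := l2) ?_ hr hl2 ?_
    · rw [← hrr] at h2
      linear_combination h2
    · have e1 : md 6 (((1 : CR) + c ^ 5) * (1 + c ^ 5)) = 1 := by
        rw [← map_one (md 6), md_eq]; decide
      have e2 : md 6 ((c - 1) * (1 + c + c ^ 2)) = 1 := by
        rw [← map_one (md 6)]; congr 1
      apply md_cancel hf2
      have hkt6 := md_mono (m := 6) (by norm_num) hkt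
      generalize hU : (1 + c + c ^ 2 : CR) = U at *
      generalize hZ : (1 + c ^ 5 : CR) = Z at *
      generalize hQ : (c - 1 : CR) = Q at *
      simp only [map_mul] at *
      rw [hrp]
      rw [hkt6] at h6
      linear_combination md 6 U * h6 - md 6 f2 * md 6 l2 * e2
  rcases sqrt_md (Od.mul hp (by decide)) h9 with h1 | h1
  · exact hfin r' hr' rfl h1
  · refine hfin (-r') hr'.neg (by ring) ?_
    rw [map_neg, h1, ← map_neg, neg_neg]
end CR

namespace CR

lemma A2_III {p o : ℤ} {s : CR} (hp : p % 2 = 1) (ho : o % 2 = 1) (hcop : IsCoprime p (2 * o)) (h5 : ¬ (5 : ℤ) ∣ p)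
    (hs : s ^ 2 = ((p : CR) ^ 2 + (2 * -⟨10, 20, 15⟩) * p * (2 * o) + 200 * (2 * o : CR) ^ 2) ^ 2
      - 4 * (pp * (c ^ 2 * qq * (1 + c + c ^ 2) ^ 2 * p * (2 * o)) ^ 2)) : False := by
  have hpo := od_int hp
  have hoo := od_int ho
  have hc3 := hc
  have h6 : c ^ 6 = 4 := by decide
  have hno5 : ∀ r : CR, Prime r → r ∣ 5 → ¬ r ∣ (p : CR) ^ 2 + (2 * -⟨10, 20, 15⟩) * p * (2 * o) + 200 * (2 * o : CR) ^ 2 := by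
    intro r hr h5r h
    have h1 : r ∣ (p : CR) ^ 2 := by
      have e : (⟨10, 20, 15⟩ : CR) = 5 * ⟨2, 4, 3⟩ := by decide
      rw [e] at h
      have h2 := dvd_sub h (dvd_mul_of_dvd_left h5r (2 * -⟨2, 4, 3⟩ * p * (2 * o) + 40 * (2 * o : CR) ^ 2))
      convert h2 using 1; ring
    have h2 := hr.dvd_of_dvd_pow h1
    rw [← pq5] at h5r
    rcases hr.dvd_or_dvd h5r with h3 | h3
    · have h4 : pp ∣ (p : CR) := (hr.associated_of_dvd pp_prime h3).symm.dvd.trans h2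
      rw [pp_dvd] at h4
      apply h5
      simpa using h4
    · exact h5 (qq_int.1 ((hr.associated_of_dvd qq_prime h3).symm.dvd.trans h2))
  obtain ⟨a, hcl, hao, ha, hb⟩ := startA (m := (p : CR)) (n := 2 * (o : CR)) (f := 2 * -⟨10, 20, 15⟩) (g := 200)
    (ε := c ^ 2 * qq * (1 + c + c ^ 2) ^ 2) 9 hpo (mul_ne_zero (by decide) hoo.ne_zero) (by decide)
    (by simpa using hcop.map (Int.castRingHom CR)) (by decide) (by decide)
    (fun r hr h => by
      have e : (200 : CR) = c ^ 9 * (5 * 5) := by decide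
      rw [e] at h
      rcases hr.dvd_or_dvd h with h | h
      · exact Or.inl (prime_c_of_dvd hr h)
      · right
        apply hno5 r hr
        rcases hr.dvd_or_dvd h with h | h <;> exact h) hs
    ⟨(qq * (1 + c + c ^ 2) ^ 2 * o) ^ 2, by
      rw [show c ^ (9 + 1) = c ^ 4 * c ^ 6 by ring, h6]; ring⟩
    (fun r hr h hθ => eps_III hr h hθ (hno5 qq qq_prime ⟨pp, by rw [← pq5, mul_comm]⟩))
  obtain ⟨b, hb⟩ := hb
  have h9 : c ^ 9 = 8 := by decide
  have h8 : c ^ 8 = 4 * c ^ 2 := by decide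
  have h8' : c ^ 8 = 2 * c ^ 5 := by decide
  have e : (⟨10, 20, 15⟩ : CR) = c ^ 2 * (⟨15, 5, 10⟩) := by decide
  obtain ⟨x, hx⟩ : ∃ x : CR, (⟨15, 5, 10⟩ : CR) = 1 + c * x := ⟨⟨5, 10, 7⟩, by decide⟩
  rw [e, hx] at hb
  obtain ⟨w, hw⟩ : ∃ w : ℤ, o = p + 2 * w := ⟨(o - p) / 2, by omega⟩
  have hw' : (o : CR) = p + 2 * w := by rw [hw]; push_cast; ring
  have h9a : md (3 + 6) a = md (3 + 6) ((p * (1 + c ^ 5)) ^ 2) := by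
    apply md_of_dvd (z := -c * b - x * p * o + 100 * o ^ 2 - c * p ^ 2 - c ^ 2 * (p ^ 2 + p * w))
    linear_combination -hb + (1 + c * x) * p * o * h8 - 100 * o ^ 2 * h9 + p ^ 2 * h8' - c ^ 8 * p * hw' + (c ^ 8 * p * (p + w)) * hc3
  obtain ⟨k, rfl, hk⟩ := cls_one hcl hao (hpo.mul (show Od (1 + c ^ 5) by decide)) (md_mono (by norm_num) h9a)
  obtain ⟨Y, hY⟩ := T2g (p := p) (q := 2 * o) (F := -⟨10, 20, 15⟩) (g := 200) (E := pp * (c ^ 2 * qq * (1 + c + c ^ 2) ^ 2) ^ 2) hk.ne_zero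
    (by linear_combination ha)
  have ho4 : md 6 (o : CR) = md 6 (p : CR) ∨ md 6 (o : CR) = md 6 (-p : CR) := by
    rw [md_eq, md_eq, h6]
    rcases (by omega : (4 : ℤ) ∣ o - p ∨ (4 : ℤ) ∣ o - -p) with ⟨w, hw⟩ | ⟨w, hw⟩
    · left; exact ⟨w, by exact_mod_cast congrArg (Int.cast (R := CR)) hw⟩
    · right; exact ⟨w, by exact_mod_cast congrArg (Int.cast (R := CR)) hw⟩
  rw [map_pow, map_pow] at h9a
  have hk6 := sqrt_md (hpo.mul (show Od (1 + c ^ 5) by decide)) h9a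
  have hok : ∃ k' : CR, (k' = k ∨ k' = -k) ∧ md 6 k' = md 6 (o * (1 + c ^ 5) : CR) := by
    rw [map_neg] at hk6 ho4
    rcases ho4 with h1 | h1 <;> rcases hk6 with h2 | h2
    · exact ⟨k, Or.inl rfl, by rw [map_mul, h1, h2, map_mul]⟩
    · exact ⟨-k, Or.inr rfl, by rw [map_neg, map_mul, h1, h2, map_mul, neg_neg]⟩
    · exact ⟨-k, Or.inr rfl, by rw [map_neg, map_mul, h1, h2, map_mul, neg_mul]⟩
    · exact ⟨k, Or.inl rfl, by rw [map_mul, h1, h2, map_mul, neg_mul]⟩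
  obtain ⟨k', hk', hok⟩ := hok
  have hk'o : Od k' := by
    rcases hk' with rfl | rfl
    · exact hk
    · exact hk.neg
  have hk2 : k ^ 2 = k' ^ 2 := by rcases hk' with rfl | rfl <;> ring
  refine deepA2 (Y := Y) (k := k') (l := qq * (1 + c + c ^ 2) * o) ?_ hk'o (Od.mul (by decide) hoo) ?_
  · rw [hY, show k ^ 4 = (k ^ 2) ^ 2 by ring, hk2]
    have e1 : ((-⟨10, 20, 15⟩) ^ 2 - 200 - pp * (c ^ 2 * qq * (1 + c + c ^ 2) ^ 2) ^ 2) * 4 =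
      -(c ^ 4 * pp * (1 + c)) * (c ^ 5 * (qq * (1 + c + c ^ 2))) ^ 2 := by decide
    have e2 : 200 * (pp * (c ^ 2 * qq * (1 + c + c ^ 2) ^ 2) ^ 2) * 16 = c ^ 5 * pp ^ 3 * (c ^ 5 * (qq * (1 + c + c ^ 2))) ^ 4 := by decide
    linear_combination (k' ^ 2 * o ^ 2) * e1 + (o : CR) ^ 4 * e2
  · have e1 : md 6 (((1 : CR) + c ^ 5) * (1 + c ^ 5)) = 1 := by
      rw [← map_one (md 6), md_eq]; decide
    have e2 : (c - 1) * (1 + c + c ^ 2) = 1 := by decide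
    rw [show (c - 1) * (qq * (1 + c + c ^ 2) * (o : CR)) = qq * o by linear_combination qq * (o : CR) * e2]
    generalize (1 + c ^ 5 : CR) = Z at *
    simp only [map_mul] at *
    rw [hok]
    linear_combination -md 6 qq * md 6 (o : CR) * e1
end CR

namespace CR

lemma param {A B z : ℤ} (hA : A % 4 = 1) (hcop : IsCoprime A B) (h : A ^ 2 + B ^ 2 = z ^ 2) :
    ∃ m n : ℤ, A = m ^ 2 - 4 * n ^ 2 ∧ B = 4 * m * n ∧ m % 2 = 1 ∧ IsCoprime m n := by
  have hp : PythagoreanTriple A B z := by unfold PythagoreanTriple; linear_combination h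
  obtain ⟨m, n, h1, -, hg, h3⟩ := PythagoreanTriple.coprime_classification.1 ⟨hp, Int.isCoprime_iff_gcd_eq_one.1 hcop⟩
  rcases h1 with ⟨h1, h2⟩ | ⟨h1, h2⟩
  · have hm : m % 2 = 1 ∧ n % 2 = 0 := by
      rcases h3 with ⟨h3, h4⟩ | h3
      · exfalso
        obtain ⟨x, rfl⟩ : ∃ x, m = 2 * x := ⟨m / 2, by omega⟩
        obtain ⟨y, rfl⟩ : ∃ y, n = 2 * y + 1 := ⟨n / 2, by omega⟩
        rw [h1] at hA
        ring_nf at hA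
        omega
      · exact h3
    obtain ⟨n, rfl⟩ : ∃ x, n = 2 * x := ⟨n / 2, by omega⟩
    refine ⟨m, n, by rw [h1]; ring, by rw [h2]; ring, hm.1, ?_⟩
    exact IsCoprime.of_mul_right_right (Int.isCoprime_iff_gcd_eq_one.2 hg)
  · exfalso
    rw [h1, mul_assoc] at hA; omega

lemma endI {A B z : ℤ} {s : CR} (hA : A % 4 = 1) (hcop : IsCoprime A B) (h : A ^ 2 + B ^ 2 = z ^ 2)
    (hs : (A : CR) ^ 2 - B ^ 2 - 2 * c * A * B = s ^ 2) : B = 0 := by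
  obtain ⟨m, n, rfl, rfl, hm, hmn⟩ := param hA hcop h
  by_contra hB
  have hn : n ≠ 0 := right_ne_zero_of_mul hB
  refine A3_I (s := s) hm hn hmn ?_
  rw [← hs, hpp]
  push_cast
  ring

/-- integer splitting -/
lemma int_split {X Y M : ℤ} (hX : X % 2 = 1) (hcop : IsCoprime X Y) (h : X * Y = M ^ 2) (hM : M ≠ 0) :
    ∃ p q : ℤ, p * q = M ∧ p % 2 = 1 ∧ IsCoprime p q ∧ ((X = p ^ 2 ∧ Y = q ^ 2) ∨ (X = - p ^ 2 ∧ Y = - q ^ 2)) := by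
  obtain ⟨p, hp⟩ := Int.sq_of_isCoprime hcop h
  obtain ⟨q, hq⟩ := Int.sq_of_isCoprime hcop.symm (by rw [mul_comm]; exact h)
  have hM2 : 0 < M ^ 2 := by positivity
  have key : ((X = p ^ 2 ∧ Y = q ^ 2) ∨ (X = - p ^ 2 ∧ Y = - q ^ 2)) := by
    rcases hp with h1 | h1 <;> rcases hq with h2 | h2
    · exact Or.inl ⟨h1, h2⟩
    · exfalso; rw [h1, h2] at h; nlinarith [sq_nonneg (p * q)]
    · exfalso; rw [h1, h2] at h; nlinarith [sq_nonneg (p * q)]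
    · exact Or.inr ⟨h1, h2⟩
  have hpq : (p * q) ^ 2 = M ^ 2 := by
    rcases key with ⟨h1, h2⟩ | ⟨h1, h2⟩ <;> rw [h1, h2] at h <;> linear_combination h
  have hpo : p % 2 = 1 := by
    by_contra hc
    obtain ⟨x, rfl⟩ : ∃ x, p = 2 * x := ⟨p / 2, by omega⟩
    rcases key with ⟨h1, h2⟩ | ⟨h1, h2⟩ <;> rw [h1] at hX <;> ring_nf at hX <;> omega
  have hcpq : IsCoprime p q := by
    rcases key with ⟨h1, h2⟩ | ⟨h1, h2⟩ <;> rw [h1, h2] at hcop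
    · rwa [IsCoprime.pow_iff (by norm_num) (by norm_num)] at hcop
    · rw [IsCoprime.neg_neg_iff] at hcop
      rwa [IsCoprime.pow_iff (by norm_num) (by norm_num)] at hcop
  rcases sq_eq_sq_iff_eq_or_eq_neg.1 hpq with h1 | h1
  · exact ⟨p, q, h1, hpo, hcpq, key⟩
  · exact ⟨p, -q, by linear_combination -h1, hpo, hcpq.neg_right, by rwa [neg_sq]⟩

lemma cop_of {X Y : ℤ} (h : ∀ p : ℤ, Prime p → p ∣ X → p ∣ Y → False) (h0 : X ≠ 0) : IsCoprime X Y :=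
  isCoprime_of_prime_dvd (fun h1 => h0 h1.1) (fun p hp h1 h2 => h p hp h1 h2)

lemma endII {A B z w : ℤ} {s : CR} (hA : A % 4 = 1) (hcop : IsCoprime A B) (h : A ^ 2 + B ^ 2 = z ^ 2)
    (hs : (A : CR) ^ 2 - B ^ 2 - c ^ 2 * A * B = s ^ 2) (hw : A ^ 2 - B ^ 2 - 2 * A * B = w ^ 2) : B = 0 := by
  obtain ⟨m, n, rfl, rfl, hm, hmn⟩ := param hA hcop h
  by_contra hB
  have hn : n ≠ 0 := right_ne_zero_of_mul hB
  have hm0 : m ≠ 0 := by omega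
  have h4 : c ^ 4 = 2 * c := by decide
  rcases Int.emod_two_eq_zero_or_one n with hn2 | hn2
  · refine A3_II (s := s) hm hn hn2 hmn ?_
    rw [← hs, hpp]
    push_cast
    linear_combination (4 * (m : CR) ^ 2 * n ^ 2 * c ^ 2) * h4 + 8 * (m : CR) ^ 2 * n ^ 2 * hc
  -- n odd
  obtain ⟨D, hD⟩ : ∃ D, D = m ^ 2 - 4 * n ^ 2 - 4 * m * n := ⟨_, rfl⟩
  have hDw : D ^ 2 - w ^ 2 = 32 * (m * n) ^ 2 := by rw [← hw, hD]; ring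
  obtain ⟨m', hm'⟩ : ∃ x, m = 2 * x + 1 := ⟨m / 2, by omega⟩
  obtain ⟨n', hn'⟩ : ∃ x, n = 2 * x + 1 := ⟨n / 2, by omega⟩
  have hD4 : D % 4 = 1 := by
    rw [hD, hm', hn']; ring_nf; omega
  have hwo : w % 2 = 1 := by
    rcases Int.emod_two_eq_zero_or_one w with h | h
    · obtain ⟨x, rfl⟩ : ∃ x, w = 2 * x := ⟨w / 2, by omega⟩
      obtain ⟨y, rfl⟩ : ∃ x, D = 2 * x + 1 := ⟨D / 2, by omega⟩
      ring_nf at hDw; omega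
    · exact h
  -- choose X odd
  have main : ∀ X Y : ℤ, X + Y = D → X * Y = 8 * (m * n) ^ 2 → X % 2 = 1 → False := by
    intro X Y hXY hP hXo
    have hc8 : IsCoprime (8 : ℤ) X := by
      have : IsCoprime (2 : ℤ) X := ⟨-(X / 2), 1, by omega⟩
      have := IsCoprime.pow_left (m := 3) this
      norm_num at this; exact this
    obtain ⟨Y, rfl⟩ : (8 : ℤ) ∣ Y := hc8.dvd_of_dvd_mul_left (Dvd.intro _ hP.symm)
    have hP' : X * Y = (m * n) ^ 2 := by linarith
    have hco : IsCoprime X Y := by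
      apply cop_of _ (by omega)
      intro p hp h1 h2
      have h3 : p ∣ D := by rw [← hXY]; exact dvd_add h1 (dvd_mul_of_dvd_right h2 _)
      have h4 : p ∣ m * n := hp.dvd_of_dvd_pow (by rw [← hP']; exact dvd_mul_of_dvd_left h1 _)
      have hb : p ∣ m ∧ p ∣ n ∨ p ∣ 2 := by
        rcases hp.dvd_or_dvd h4 with h | h
        · have : p ∣ 2 * 2 * (n * n) := by
            have := dvd_sub (dvd_mul_of_dvd_left h (m - 4 * n)) h3
            have e : 2 * 2 * (n * n) = m * (m - 4 * n) - D := by rw [hD]; ring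
            rw [e]; exact this
          rcases hp.dvd_or_dvd this with h5 | h5
          · right; rcases hp.dvd_or_dvd h5 with h6 | h6 <;> exact h6
          · left; exact ⟨h, by rcases hp.dvd_or_dvd h5 with h6 | h6 <;> exact h6⟩
        · left
          refine ⟨?_, h⟩
          have : p ∣ m ^ 2 := by
            have := dvd_add h3 (dvd_mul_of_dvd_left h (4 * n + 4 * m))
            have e : m ^ 2 = D + n * (4 * n + 4 * m) := by rw [hD]; ring
            rw [e]; exact this
          exact hp.dvd_of_dvd_pow this
      rcases hb with ⟨h5, h6⟩ | h5
      · exact hp.not_isUnit (hmn.isUnit_of_dvd' h5 h6)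
      · exact hp.not_isUnit (IsCoprime.isUnit_of_dvd' (⟨-(X / 2), 1, by omega⟩ : IsCoprime (2 : ℤ) X) h5 h1)
    obtain ⟨p, q, hpq, hpo, hc2, h5⟩ := int_split hXo hco hP' (mul_ne_zero hm0 hn)
    have hqo : q % 2 = 1 := by
      have : (p * q) % 2 = 1 := by rw [hpq, Int.mul_emod, hm, hn2]; rfl
      rcases Int.emod_two_eq_zero_or_one q with h | h
      · rw [Int.mul_emod, h] at this; simp at this
      · exact h
    have hDp : D = p ^ 2 + 8 * q ^ 2 := by
      rcases h5 with ⟨h6, h7⟩ | ⟨h6, h7⟩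
      · rw [← hXY, h6, h7]
      · exfalso
        obtain ⟨x, rfl⟩ : ∃ x, p = 2 * x + 1 := ⟨p / 2, by omega⟩
        have : D = -(2 * x + 1) ^ 2 - 8 * q ^ 2 := by rw [← hXY, h6, h7]; ring
        rw [this] at hD4; ring_nf at hD4; omega
    refine A2_II (s := s) hpo hqo hc2 ?_
    have e1 : (p : CR) ^ 2 + 8 * (q : CR) ^ 2 = m ^ 2 - 4 * n ^ 2 - 4 * m * n := by
      rw [hDp] at hD; exact_mod_cast congrArg (Int.cast (R := CR)) hD
    have e2 : (p : CR) * q = m * n := by exact_mod_cast congrArg (Int.cast (R := CR)) hpq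
    rw [show (p : CR) ^ 2 + (2 * (2 - c ^ 2)) * p * q + 8 * (q : CR) ^ 2 = (p ^ 2 + 8 * q ^ 2) + (2 * (2 - c ^ 2)) * (p * q) by ring,
      show c ^ 2 * (p : CR) * q = c ^ 2 * (p * q) by ring, e1, e2, ← hs, hpp]
    push_cast
    linear_combination (4 * (m : CR) ^ 2 * n ^ 2 * c ^ 2) * h4 + 8 * (m : CR) ^ 2 * n ^ 2 * hc
  obtain ⟨x, hx⟩ : ∃ x, D - w = 2 * x := ⟨(D - w) / 2, by omega⟩
  obtain ⟨y, hy⟩ : ∃ x, D + w = 2 * x := ⟨(D + w) / 2, by omega⟩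
  have hxy : x * y = 8 * (m * n) ^ 2 := by
    have : (2 * x) * (2 * y) = 32 * (m * n) ^ 2 := by rw [← hx, ← hy, ← hDw]; ring
    linarith
  rcases (by omega : x % 2 = 1 ∨ y % 2 = 1) with h1 | h1
  · exact main x y (by omega) hxy h1
  · exact main y x (by omega) (by rw [mul_comm]; exact hxy) h1
end CR

namespace CR

lemma hKe : (4 : CR) + ⟨24,20,15⟩ ^ 2 = pp * (c ^ 2 * qq * (1 + c + c ^ 2) ^ 2) ^ 2 := by decide

lemma five_sq {m n q D : ℤ} (h5 : ¬ (5 : ℤ) ∣ m + n) (hD : D = m ^ 2 - 4 * n ^ 2 - 28 * m * n) : ¬ (5 : ℤ) ∣ D - 3 * q ^ 2 := by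
  intro h
  have key : ∀ m n q : ZMod 5, m ^ 2 - 4 * n ^ 2 - 28 * m * n - 3 * q ^ 2 = 0 → m + n = 0 := by decide
  apply h5
  have h1 := (ZMod.intCast_zmod_eq_zero_iff_dvd (D - 3 * q ^ 2) 5).2 h
  rw [hD] at h1
  push_cast at h1
  apply (ZMod.intCast_zmod_eq_zero_iff_dvd (m + n) 5).1
  push_cast
  exact key _ _ _ h1

lemma endIII {A B z w : ℤ} {s : CR} (hA : A % 4 = 1) (hcop : IsCoprime A B) (h : A ^ 2 + B ^ 2 = z ^ 2)
    (h5 : ¬ (5 : ℤ) ∣ A - 2 * B)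
    (hs : (A : CR) ^ 2 - B ^ 2 - ⟨24,20,15⟩ * A * B = s ^ 2) (hw : A ^ 2 - B ^ 2 - 14 * A * B = w ^ 2) : B = 0 := by
  obtain ⟨m, n, rfl, rfl, hm, hmn⟩ := param hA hcop h
  by_contra hB
  have hn : n ≠ 0 := right_ne_zero_of_mul hB
  have hm0 : m ≠ 0 := by omega
  have h5' : ¬ (5 : ℤ) ∣ m + n := by
    rintro ⟨k, hk⟩
    apply h5
    obtain rfl : m = 5 * k - n := by omega
    exact ⟨5 * k ^ 2 - 10 * k * n + n ^ 2, by ring⟩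
  have hgen : s ^ 2 = ((m : CR) ^ 2 + (-2 * ⟨24,20,15⟩) * m * n + (-4) * (n : CR) ^ 2) ^ 2
      - 4 * (pp * (c ^ 2 * qq * (1 + c + c ^ 2) ^ 2 * m * n) ^ 2) := by
    have e : (c ^ 2 * qq * (1 + c + c ^ 2) ^ 2 * m * n) = (c ^ 2 * qq * (1 + c + c ^ 2) ^ 2) * (m * n : CR) := by ring
    rw [e, mul_pow, ← mul_assoc pp, ← hKe, ← hs]
    push_cast
    ring
  rcases Int.emod_two_eq_zero_or_one n with hn2 | hn2
  swap
  · exact A3_III1 hm hn2 hmn h5' hgen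
  by_cases hn4 : n % 4 = 0
  · exact A3_III4 hm hn hn4 hmn h5' hgen
  obtain ⟨D, hD⟩ : ∃ D, D = m ^ 2 - 4 * n ^ 2 - 28 * m * n := ⟨_, rfl⟩
  have hDw : D ^ 2 - w ^ 2 = 800 * (m * n) ^ 2 := by rw [← hw, hD]; ring
  obtain ⟨m', hm'⟩ : ∃ x, m = 2 * x + 1 := ⟨m / 2, by omega⟩
  obtain ⟨n', hn'⟩ : ∃ x, n = 4 * x + 2 := ⟨n / 4, by omega⟩
  have hD4 : D % 4 = 1 := by
    rw [hD, hm', hn']; ring_nf; omega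
  have hwo : w % 2 = 1 := by
    rcases Int.emod_two_eq_zero_or_one w with h | h
    · obtain ⟨x, rfl⟩ : ∃ x, w = 2 * x := ⟨w / 2, by omega⟩
      obtain ⟨y, rfl⟩ : ∃ x, D = 2 * x + 1 := ⟨D / 2, by omega⟩
      ring_nf at hDw; omega
    · exact h
  have h5D : ¬ (5 : ℤ) ∣ D := by
    have := five_sq (q := 0) h5' hD; simpa using this
  have h5p : Prime (5 : ℤ) := by norm_num
  have cop : ∀ X Y a b : ℤ, a * X + b * Y = D → X * Y = (m * n) ^ 2 → X % 2 = 1 → IsCoprime X Y := by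
    intro X Y a b hXY hP' hXo
    apply cop_of _ (by omega)
    intro p hp h1 h2
    have h3 : p ∣ D := by rw [← hXY]; exact dvd_add (dvd_mul_of_dvd_right h1 _) (dvd_mul_of_dvd_right h2 _)
    have h4 : p ∣ m * n := hp.dvd_of_dvd_pow (by rw [← hP']; exact dvd_mul_of_dvd_left h1 _)
    have hb : p ∣ m ∧ p ∣ n ∨ p ∣ 2 := by
      rcases hp.dvd_or_dvd h4 with h | h
      · have : p ∣ 2 * 2 * (n * n) := by
          have := dvd_sub (dvd_mul_of_dvd_left h (m - 28 * n)) h3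
          have e : 2 * 2 * (n * n) = m * (m - 28 * n) - D := by rw [hD]; ring
          rw [e]; exact this
        rcases hp.dvd_or_dvd this with h5 | h5
        · right; rcases hp.dvd_or_dvd h5 with h6 | h6 <;> exact h6
        · left; exact ⟨h, by rcases hp.dvd_or_dvd h5 with h6 | h6 <;> exact h6⟩
      · left
        refine ⟨?_, h⟩
        have : p ∣ m ^ 2 := by
          have := dvd_add h3 (dvd_mul_of_dvd_left h (4 * n + 28 * m))
          have e : m ^ 2 = D + n * (4 * n + 28 * m) := by rw [hD]; ring
          rw [e]; exact this
        exact hp.dvd_of_dvd_pow this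
    rcases hb with ⟨h5, h6⟩ | h5
    · exact hp.not_isUnit (hmn.isUnit_of_dvd' h5 h6)
    · exact hp.not_isUnit (IsCoprime.isUnit_of_dvd' (⟨-(X / 2), 1, by omega⟩ : IsCoprime (2 : ℤ) X) h5 h1)
  have main : ∀ X Y : ℤ, X + Y = D → X * Y = 200 * (m * n) ^ 2 → X % 2 = 1 → False := by
    intro X Y hXY hP hXo
    have hc8 : IsCoprime (8 : ℤ) X := by
      have : IsCoprime (2 : ℤ) X := ⟨-(X / 2), 1, by omega⟩
      have := IsCoprime.pow_left (m := 3) this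
      norm_num at this; exact this
    obtain ⟨Y, rfl⟩ : (8 : ℤ) ∣ Y := hc8.dvd_of_dvd_mul_left ⟨25 * (m * n) ^ 2, by rw [hP]; ring⟩
    have hP' : X * Y = 25 * (m * n) ^ 2 := by linarith
    rcases h5p.dvd_or_dvd (⟨5 * (m * n) ^ 2, by rw [hP']; ring⟩ : (5 : ℤ) ∣ X * Y) with h6 | h6
    · have h7 : ¬ (5 : ℤ) ∣ Y := fun h8 => h5D (by rw [← hXY]; exact dvd_add h6 (dvd_mul_of_dvd_right h8 _))
      have h8 : IsCoprime (25 : ℤ) Y := by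
        have := IsCoprime.pow_left (m := 2) (((Prime.coprime_iff_not_dvd h5p).2 h7))
        norm_num at this; exact this
      obtain ⟨X, rfl⟩ : (25 : ℤ) ∣ X := h8.dvd_of_dvd_mul_right ⟨(m * n) ^ 2, hP'⟩
      have hP2 : X * Y = (m * n) ^ 2 := by linarith
      have hXo' : X % 2 = 1 := by omega
      obtain ⟨p, q, hpq, hpo, hc2, h9⟩ := int_split hXo' (cop X Y 25 8 hXY hP2 hXo') hP2 (mul_ne_zero hm0 hn)
      rcases h9 with ⟨h9, h10⟩ | ⟨h9, h10⟩
      · refine five_sq (q := q) h5' hD ?_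
        rw [← hXY, h9, h10]; exact ⟨5 * p ^ 2 + q ^ 2, by ring⟩
      · obtain ⟨x, rfl⟩ : ∃ x, p = 2 * x + 1 := ⟨p / 2, by omega⟩
        have : D = -25 * (2 * x + 1) ^ 2 - 8 * q ^ 2 := by rw [← hXY, h9, h10]; ring
        rw [this] at hD4; ring_nf at hD4; omega
    · have h7 : ¬ (5 : ℤ) ∣ X := fun h8 => h5D (by rw [← hXY]; exact dvd_add h8 (dvd_mul_of_dvd_right h6 _))
      have h8 : IsCoprime (25 : ℤ) X := by
        have := IsCoprime.pow_left (m := 2) (((Prime.coprime_iff_not_dvd h5p).2 h7))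
        norm_num at this; exact this
      obtain ⟨Y, rfl⟩ : (25 : ℤ) ∣ Y := h8.dvd_of_dvd_mul_left ⟨(m * n) ^ 2, hP'⟩
      have hP2 : X * Y = (m * n) ^ 2 := by linarith
      obtain ⟨p, q, hpq, hpo, hc2, h9⟩ := int_split hXo (cop X Y 1 200 (by linarith) hP2 hXo) hP2 (mul_ne_zero hm0 hn)
      have hDp : D = p ^ 2 + 200 * q ^ 2 := by
        rcases h9 with ⟨h6, h7⟩ | ⟨h6, h7⟩
        · rw [← hXY, h6, h7]; ring
        · exfalso
          obtain ⟨x, rfl⟩ : ∃ x, p = 2 * x + 1 := ⟨p / 2, by omega⟩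
          have : D = -(2 * x + 1) ^ 2 - 200 * q ^ 2 := by rw [← hXY, h6, h7]; ring
          rw [this] at hD4; ring_nf at hD4; omega
      have h5p' : ¬ (5 : ℤ) ∣ p := by
        rintro ⟨k, rfl⟩
        exact h5D ⟨5 * k ^ 2 + 40 * q ^ 2, by rw [hDp]; ring⟩
      obtain ⟨o, rfl, ho⟩ : ∃ o, q = 2 * o ∧ o % 2 = 1 := by
        obtain ⟨x, rfl⟩ : ∃ x, p = 2 * x + 1 := ⟨p / 2, by omega⟩
        have e : (2 * x + 1) * q = (2 * m' + 1) * (4 * n' + 2) := by rw [hpq, ← hm', ← hn']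
        have e2 : q = 2 * (4 * m' * n' + 2 * m' + 2 * n' + 1 - x * q) := by linear_combination e
        obtain ⟨o, rfl⟩ : ∃ o, q = 2 * o := ⟨_, e2⟩
        refine ⟨o, rfl, ?_⟩
        have e3 : o = 2 * (2 * m' * n' + m' + n' - x * o) + 1 := by linarith
        omega
      refine A2_III (s := s) hpo ho hc2 h5p' ?_
      have e1 : (p : CR) ^ 2 + 200 * (2 * o : CR) ^ 2 = m ^ 2 - 4 * n ^ 2 - 28 * m * n := by
        rw [hDp] at hD; exact_mod_cast congrArg (Int.cast (R := CR)) hD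
      have e2 : (p : CR) * (2 * o) = m * n := by exact_mod_cast congrArg (Int.cast (R := CR)) hpq
      have e3 : (2 : CR) * -⟨10,20,15⟩ = 28 - 2 * ⟨24,20,15⟩ := by decide
      rw [show (p : CR) ^ 2 + (2 * -⟨10,20,15⟩) * p * (2 * o) + 200 * (2 * o : CR) ^ 2 = (p ^ 2 + 200 * (2 * o) ^ 2) + (2 * -⟨10,20,15⟩) * (p * (2 * o)) by ring,
        show c ^ 2 * qq * (1 + c + c ^ 2) ^ 2 * (p : CR) * (2 * o) = c ^ 2 * qq * (1 + c + c ^ 2) ^ 2 * (p * (2 * o)) by ring, e1, e2, e3, hgen]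
      ring
  obtain ⟨x, hx⟩ : ∃ x, D - w = 2 * x := ⟨(D - w) / 2, by omega⟩
  obtain ⟨y, hy⟩ : ∃ x, D + w = 2 * x := ⟨(D + w) / 2, by omega⟩
  have hxy : x * y = 200 * (m * n) ^ 2 := by
    have : (2 * x) * (2 * y) = 800 * (m * n) ^ 2 := by rw [← hx, ← hy, ← hDw]; ring
    linarith
  rcases (by omega : x % 2 = 1 ∨ y % 2 = 1) with h1 | h1
  · exact main x y (by omega) hxy h1
  · exact main y x (by omega) (by rw [mul_comm]; exact hxy) h1
end CR

namespace CR

lemma pos_split1 {M N Y : ℤ} (hcop : IsCoprime M N) (hM : 0 < M) (hN : N ≠ 0) (h : M * N = Y ^ 2) :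
    ∃ w v : ℤ, M = w ^ 2 ∧ N = v ^ 2 := by
  obtain ⟨w, hw⟩ := Int.sq_of_isCoprime hcop h
  obtain ⟨v, hv⟩ := Int.sq_of_isCoprime hcop.symm (by rw [mul_comm]; exact h)
  have hN' : 0 < N := by
    rcases lt_or_gt_of_ne hN with h1 | h1
    · nlinarith [sq_nonneg Y, mul_pos hM (neg_pos.2 h1)]
    · exact h1
  refine ⟨w, v, ?_, ?_⟩
  · rcases hw with h1 | h1
    · exact h1
    · nlinarith [sq_nonneg w]
  · rcases hv with h1 | h1
    · exact h1
    · nlinarith [sq_nonneg v]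

lemma pos_split {M N Y e : ℤ} (hcop : IsCoprime M N) (hM : 0 < M) (hN : N ≠ 0) (h : M * N = e * Y ^ 2)
    (he : e = 1 ∨ e = 5 ∧ ¬ (5 : ℤ) ∣ M) :
    ∃ w v : ℤ, M = w ^ 2 ∧ N = e * v ^ 2 := by
  rcases he with rfl | ⟨rfl, h5⟩
  · rw [one_mul] at h
    obtain ⟨w, v, h1, h2⟩ := pos_split1 hcop hM hN h
    exact ⟨w, v, h1, by rw [one_mul]; exact h2⟩
  · have h5p : Prime (5 : ℤ) := by norm_num
    obtain ⟨N, rfl⟩ := (h5p.dvd_or_dvd (Dvd.intro _ h.symm)).resolve_left h5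
    have h' : M * N = Y ^ 2 := by linarith
    obtain ⟨w, v, h1, h2⟩ := pos_split1 hcop.of_mul_right_right hM (right_ne_zero_of_mul hN) h'
    exact ⟨w, v, h1, by rw [h2]⟩

lemma three_not {S T v k e : ℤ} (hk : k = -16 ∨ k = 32) (hcop : IsCoprime S T) (h : S ^ 3 + k * T ^ 3 = e * v ^ 2) :
    ¬ (3 : ℤ) ∣ v := by
  rintro ⟨v, rfl⟩
  have key : ∀ x y : ZMod 9, (x ^ 3 + (-16) * y ^ 3 = 0 ∨ x ^ 3 + 32 * y ^ 3 = 0) → 3 * x = 0 ∧ 3 * y = 0 := by decide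
  have h1 : ((S : ZMod 9) ^ 3 + k * (T : ZMod 9) ^ 3) = 0 := by
    have := congrArg (Int.cast (R := ZMod 9)) h
    push_cast at this
    rw [this, mul_pow]
    have h9 : (3 : ZMod 9) ^ 2 = 0 := by decide
    rw [h9]; ring
  have h2 : 3 * (S : ZMod 9) = 0 ∧ 3 * (T : ZMod 9) = 0 := by
    apply key
    rcases hk with rfl | rfl
    · left; push_cast at h1; exact h1
    · right; push_cast at h1; exact h1
  have h3 : (9 : ℤ) ∣ 3 * S := (ZMod.intCast_zmod_eq_zero_iff_dvd (3 * S) 9).1 (by push_cast; exact h2.1)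
  have h4 : (9 : ℤ) ∣ 3 * T := (ZMod.intCast_zmod_eq_zero_iff_dvd (3 * T) 9).1 (by push_cast; exact h2.2)
  have h5 : IsUnit (3 : ℤ) := hcop.isUnit_of_dvd' (by omega) (by omega)
  rw [Int.isUnit_iff] at h5
  omega

lemma form_a (S T : ℤ) : (S : CR) + 2 * -c * T = ⟨S, -2 * T, 0⟩ := by
  rw [show (2 : CR) * -c = ⟨0, -2, 0⟩ by decide]; ext <;> simp

lemma form_b (S T : ℤ) : (S : CR) + 2 * c ^ 2 * T = ⟨S, 0, 2 * T⟩ := by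
  rw [show (2 : CR) * c ^ 2 = ⟨0, 0, 2⟩ by decide]; ext <;> simp

lemma md7_of {x y z r s t : ℤ} (h1 : (8 : ℤ) ∣ x - r) (h2 : (4 : ℤ) ∣ y - s) (h3 : (4 : ℤ) ∣ z - t) :
    md 7 (⟨x, y, z⟩ : CR) = md 7 ⟨r, s, t⟩ := by
  obtain ⟨u, hu⟩ := h1
  obtain ⟨v, hv⟩ := h2
  obtain ⟨w, hw⟩ := h3
  apply md_of_dvd (z := ⟨v, w, u⟩)
  rw [show c ^ 7 = ⟨0, 4, 0⟩ by decide]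
  ext <;> simp <;> omega

lemma alpha_cls {S T v k e : ℤ} {γ : CR} (hγ : γ = -c ∧ k = -16 ∨ γ = c ^ 2 ∧ k = 32) (hS : S % 2 = 1)
    (hcop : IsCoprime S T) (he : e = 1 ∨ e = 5) (h : S ^ 3 + k * T ^ 3 = e * v ^ 2) (hv : v ≠ 0) :
    Cls (S + 2 * γ * T) ∧ Od (S + 2 * γ * T) := by
  have h3v := three_not (by rcases hγ with h | h; exacts [Or.inl h.2, Or.inr h.2]) hcop h
  have hcopC : IsCoprime (S : CR) (T : CR) := by simpa using hcop.map (Int.castRingHom CR)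
  have hk : (8 : CR) * γ ^ 3 = k := by
    rcases hγ with ⟨rfl, rfl⟩ | ⟨rfl, rfl⟩ <;> decide
  have hodd : Od ((S : CR) + 2 * γ * T) := by
    intro hh
    apply od_int hS
    have h2 : c ∣ (2 : CR) * γ * T := by rw [mul_assoc, ← hc]; exact ⟨c ^ 2 * (γ * T), by ring⟩
    exact (dvd_add_left h2).1 hh
  have hE : ((S : CR) + 2 * γ * T) * (S ^ 2 - 2 * γ * S * T + 4 * γ ^ 2 * T ^ 2) = e * v ^ 2 := by
    have := congrArg (Int.cast (R := CR)) h
    push_cast at this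
    rw [← this, ← hk]; ring
  have hcommon : ∀ p : CR, Prime p → p ∣ (S : CR) + 2 * γ * T → p ∣ (S : CR) ^ 2 - 2 * γ * S * T + 4 * γ ^ 2 * T ^ 2 → False := by
    intro p hp h1 h2
    have hnc : ∀ n, ¬ p ∣ c ^ n := fun n => od_not_c hp hodd h1 n
    have hn2 : ¬ p ∣ 2 := fun hh => hnc 3 (by rw [hc]; exact hh)
    have hT : p ∣ (T : CR) → False := by
      intro hT
      exact not_both hcopC hp ((dvd_add_left (dvd_mul_of_dvd_right hT _)).1 h1) hT
    have h12 : p ∣ (2 * 2 * 3) * γ ^ 2 * T ^ 2 := by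
      have := dvd_sub h2 (dvd_mul_of_dvd_left h1 (S - 4 * γ * T))
      have e : (2 * 2 * 3 : CR) * γ ^ 2 * T ^ 2 = ((S : CR) ^ 2 - 2 * γ * S * T + 4 * γ ^ 2 * T ^ 2) - ((S : CR) + 2 * γ * T) * (S - 4 * γ * T) := by ring
      rw [e]; exact this
    rcases hp.dvd_or_dvd h12 with h4 | h4
    swap
    · exact hT (hp.dvd_of_dvd_pow h4)
    rcases hp.dvd_or_dvd h4 with h5 | h5
    swap
    · have h6 := hp.dvd_of_dvd_pow h5
      rcases hγ with ⟨rfl, rfl⟩ | ⟨rfl, rfl⟩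
      · rw [dvd_neg] at h6; exact hnc 1 (by rw [pow_one]; exact h6)
      · exact hnc 2 h6
    rcases hp.dvd_or_dvd h5 with h6 | h6
    · rcases hp.dvd_or_dvd h6 with h7 | h7 <;> exact hn2 h7
    have h7 : p ∣ (e : CR) * v ^ 2 := by rw [← hE]; exact dvd_mul_of_dvd_left h1 _
    have h8 : IsCoprime (3 : ℤ) (e * v ^ 2) := by
      refine IsCoprime.mul_right ?_ (IsCoprime.pow_right ((Prime.coprime_iff_not_dvd (by norm_num)).2 h3v))
      rcases he with rfl | rfl
      · exact isCoprime_one_right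
      · exact ⟨2, -1, by norm_num⟩
    have h9 : IsCoprime (3 : CR) ((e : CR) * v ^ 2) := by simpa using h8.map (Int.castRingHom CR)
    exact not_both h9 hp h6 h7
  refine ⟨?_, hodd⟩
  rcases he with rfl | rfl
  · refine cls_of (E := 1) (s := v) (Or.inl rfl) (by rw [hE]; push_cast; ring) (int_ne hv) (fun p hp h1 h2 => (hcommon p hp h1 h2).elim)
  · have hq : ¬ qq ∣ (S : CR) + 2 * γ * T := by
      intro hh
      have h5 : (5 : ℤ) ∣ S ∧ (5 : ℤ) ∣ T := by
        rcases hγ with ⟨rfl, rfl⟩ | ⟨rfl, rfl⟩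
        · rw [form_a, qq_dvd] at hh; dsimp only at hh; omega
        · rw [form_b, qq_dvd] at hh; dsimp only at hh; omega
      have := hcop.isUnit_of_dvd' h5.1 h5.2
      rw [Int.isUnit_iff] at this
      omega
    have hq2 : qq ∣ ((S : CR) + 2 * γ * T) * (S ^ 2 - 2 * γ * S * T + 4 * γ ^ 2 * T ^ 2) := by
      rw [hE]; push_cast; rw [← pq5]; exact ⟨pp * v ^ 2, by ring⟩
    obtain ⟨β, hβ⟩ := (qq_prime.dvd_or_dvd hq2).resolve_left hq
    have hE2 : ((S : CR) + 2 * γ * T) * β = pp * v ^ 2 := by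
      apply mul_left_cancel₀ qq_prime.ne_zero
      rw [hβ] at hE
      push_cast at hE; rw [← pq5] at hE
      linear_combination hE
    exact cls_of (Or.inr rfl) hE2 (int_ne hv) (fun p hp h1 h2 => (hcommon p hp h1 (by rw [hβ]; exact dvd_mul_of_dvd_right h2 _)).elim)

end CR

namespace CR

lemma endI' {A B z : ℤ} {s : CR} (hA : A % 2 = 1) (hcop : IsCoprime A B) (h : A ^ 2 + B ^ 2 = z ^ 2)
    (hs : (A : CR) ^ 2 - B ^ 2 - 2 * c * A * B = s ^ 2) : B = 0 := by
  rcases (by omega : A % 4 = 1 ∨ (-A) % 4 = 1) with h1 | h1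
  · exact endI h1 hcop h hs
  · have := endI (s := s) (z := z) h1 hcop.neg_neg (by rw [← h]; ring) (by rw [← hs]; push_cast; ring)
    omega

lemma endII' {A B z w : ℤ} {s : CR} (hA : A % 2 = 1) (hcop : IsCoprime A B) (h : A ^ 2 + B ^ 2 = z ^ 2)
    (hs : (A : CR) ^ 2 - B ^ 2 - c ^ 2 * A * B = s ^ 2) (hw : A ^ 2 - B ^ 2 - 2 * A * B = w ^ 2) : B = 0 := by
  rcases (by omega : A % 4 = 1 ∨ (-A) % 4 = 1) with h1 | h1
  · exact endII h1 hcop h hs hw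
  · have := endII (s := s) (z := z) (w := w) h1 hcop.neg_neg (by rw [← h]; ring) (by rw [← hs]; push_cast; ring) (by rw [← hw]; ring)
    omega

lemma endIII' {A B z w : ℤ} {s : CR} (hA : A % 2 = 1) (hcop : IsCoprime A B) (h : A ^ 2 + B ^ 2 = z ^ 2)
    (h5 : ¬ (5 : ℤ) ∣ A - 2 * B)
    (hs : (A : CR) ^ 2 - B ^ 2 - ⟨24,20,15⟩ * A * B = s ^ 2) (hw : A ^ 2 - B ^ 2 - 14 * A * B = w ^ 2) : B = 0 := by
  rcases (by omega : A % 4 = 1 ∨ (-A) % 4 = 1) with h1 | h1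
  · exact endIII h1 hcop h h5 hs hw
  · have := endIII (s := s) (z := z) (w := w) h1 hcop.neg_neg (by rw [← h]; ring) (by omega) (by rw [← hs]; push_cast; ring) (by rw [← hw]; ring)
    omega

lemma sq8 {w : ℤ} (h : w % 2 = 1) : ∃ k, w ^ 2 = 8 * k + 1 := by
  obtain ⟨x, rfl⟩ : ∃ x, w = 2 * x + 1 := ⟨w / 2, by omega⟩
  obtain ⟨y, hy⟩ := Int.even_mul_succ_self x
  exact ⟨y, by linear_combination 4 * hy⟩

lemma odd_of_sq {w n : ℤ} (h : n = w ^ 2) (hn : n % 2 = 1) : w % 2 = 1 := by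
  rcases Int.emod_two_eq_zero_or_one w with h1 | h1
  · obtain ⟨x, rfl⟩ : ∃ x, w = 2 * x := ⟨w / 2, by omega⟩
    ring_nf at h; omega
  · exact h1

lemma cop_PQ {a b : ℤ} (h : IsCoprime a b) : IsCoprime (a ^ 2 - b ^ 2) (a * b) := by
  have h2 : ∀ p : ℤ, Prime p → p ∣ a ^ 2 - b ^ 2 → p ∣ a * b → False := by
    intro p hp h1 h2
    rcases hp.dvd_or_dvd h2 with h3 | h3
    · have h4 : p ∣ b ^ 2 := (dvd_sub_right (dvd_pow h3 (by norm_num))).1 h1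
      exact hp.not_isUnit (h.isUnit_of_dvd' h3 (hp.dvd_of_dvd_pow h4))
    · have h4 : p ∣ a ^ 2 := (dvd_sub_left (dvd_pow h3 (by norm_num))).1 h1
      exact hp.not_isUnit (h.isUnit_of_dvd' (hp.dvd_of_dvd_pow h4) h3)
  refine isCoprime_of_prime_dvd ?_ (fun p hp h1 h3 => h2 p hp h1 h3)
  rintro ⟨h0, h1⟩
  exact h2 2 Int.prime_two (by rw [h0]; exact dvd_zero _) (by rw [h1]; exact dvd_zero _)

lemma not5 {a b M : ℤ} (hcop : IsCoprime a b) (h : (5 : ℤ) ∣ a ^ 2 + b ^ 2) : ¬ (5 : ℤ) ∣ a ^ 2 - b ^ 2 - 2 * (a * b) := by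
  intro h1
  have key : ∀ x y : ZMod 5, x ^ 2 + y ^ 2 = 0 → x ^ 2 - y ^ 2 - 2 * (x * y) = 0 → x = 0 ∧ y = 0 := by decide
  have := key a b
    (by have := (ZMod.intCast_zmod_eq_zero_iff_dvd _ 5).2 h; push_cast at this; exact this)
    (by have := (ZMod.intCast_zmod_eq_zero_iff_dvd _ 5).2 h1; push_cast at this; exact this)
  have h5 := hcop.isUnit_of_dvd' ((ZMod.intCast_zmod_eq_zero_iff_dvd a 5).1 this.1) ((ZMod.intCast_zmod_eq_zero_iff_dvd b 5).1 this.2)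
  rw [Int.isUnit_iff] at h5
  omega

lemma case_odd {a b z Y e : ℤ} (hcop : IsCoprime a b) (hab : (a + b) % 2 = 1) (he : e = 1 ∨ e = 5)
    (h1 : a ^ 2 + b ^ 2 = e * z ^ 2) (hpos : 0 < a ^ 2 - b ^ 2 - 2 * (a * b))
    (h : (a ^ 2 - b ^ 2 - 2 * (a * b)) * ((a ^ 2 - b ^ 2) ^ 3 - 16 * (a * b) ^ 3) = e * Y ^ 2) : b = 0 := by
  have hPQ := cop_PQ hcop
  obtain ⟨P, hP⟩ : ∃ P, P = a ^ 2 - b ^ 2 := ⟨_, rfl⟩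
  obtain ⟨Q, hQ⟩ : ∃ Q, Q = a * b := ⟨_, rfl⟩
  rw [← hP, ← hQ] at hPQ hpos h
  have hPo : P % 2 = 1 := by
    obtain ⟨x, hx⟩ : ∃ x, a + b = 2 * x + 1 := ⟨(a + b) / 2, by omega⟩
    have : P = 2 * (2 * x ^ 2 + 2 * x - 2 * x * b - b) + 1 := by
      rw [hP, show a = 2 * x + 1 - b by omega]; ring
    omega
  have hN3o : (P ^ 3 - 16 * Q ^ 3) % 2 = 1 := by
    obtain ⟨x, rfl⟩ : ∃ x, P = 2 * x + 1 := ⟨P / 2, by omega⟩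
    ring_nf; omega
  have hco : IsCoprime (P - 2 * Q) (P ^ 3 - 16 * Q ^ 3) := by
    apply cop_of _ (by omega)
    intro p hp h2 h3
    have h4 : p ∣ (2 ^ 3) * Q ^ 3 := by
      have := dvd_sub (dvd_mul_of_dvd_left h2 (P ^ 2 + 2 * P * Q + 4 * Q ^ 2)) h3
      have e : (2 ^ 3) * Q ^ 3 = (P - 2 * Q) * (P ^ 2 + 2 * P * Q + 4 * Q ^ 2) - (P ^ 3 - 16 * Q ^ 3) := by ring
      rw [e]; exact this
    rcases hp.dvd_or_dvd h4 with h5 | h5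
    · have h6 := hp.dvd_of_dvd_pow h5
      exact hp.not_isUnit (IsCoprime.isUnit_of_dvd' (⟨-(P / 2), 1, by omega⟩ : IsCoprime (2 : ℤ) P) h6
        ((dvd_sub_left (dvd_mul_of_dvd_left h6 _)).1 h2))
    · have h6 := hp.dvd_of_dvd_pow h5
      exact hp.not_isUnit (hPQ.isUnit_of_dvd' ((dvd_sub_left (dvd_mul_of_dvd_right h6 _)).1 h2) h6)
  obtain ⟨w, v, hw, hv⟩ := pos_split hco hpos (by intro h0; rw [h0] at hN3o; omega) h (by
    rcases he with rfl | rfl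
    · exact Or.inl rfl
    · refine Or.inr ⟨rfl, ?_⟩
      rw [hP, hQ]; exact not5 (M := 0) hcop (Dvd.intro _ h1.symm))
  have hv0 : v ≠ 0 := by rintro rfl; rw [hv] at hN3o; ring_nf at hN3o; omega
  obtain ⟨hcls, hod⟩ := alpha_cls (γ := -c) (k := -16) (Or.inl ⟨rfl, rfl⟩) hPo hPQ he (by rw [← hv]; ring) hv0
  have hwo : w % 2 = 1 := odd_of_sq hw (by omega)
  obtain ⟨kw, hkw⟩ := sq8 hwo
  have hao : a % 2 = 1 := by
    by_contra ha
    obtain ⟨x, rfl⟩ : ∃ x, a = 2 * x := ⟨a / 2, by omega⟩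
    obtain ⟨y, hy⟩ := sq8 (w := b) (by omega)
    rw [hkw, hP, hQ, hy] at hw
    have : 8 * kw + 1 = 4 * x ^ 2 - 8 * y - 1 - 4 * (x * b) := by rw [← hw]; ring
    omega
  obtain ⟨b', rfl⟩ : ∃ x, b = 2 * x := ⟨b / 2, by omega⟩
  obtain ⟨ka, hka⟩ := sq8 hao
  rw [form_a] at hcls hod
  have hz : z % 2 = 1 := by
    have : (a ^ 2 + (2 * b') ^ 2) % 2 = 1 := by rw [hka]; ring_nf; omega
    rcases Int.emod_two_eq_zero_or_one z with h2 | h2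
    · obtain ⟨x, rfl⟩ : ∃ x, z = 2 * x := ⟨z / 2, by omega⟩
      rw [h1] at this
      have e3 : e * (2 * x) ^ 2 = 2 * (2 * e * x ^ 2) := by ring
      rw [e3] at this; omega
    · exact h2
  obtain ⟨kz, hkz⟩ := sq8 hz
  rw [hka, hkz] at h1
  have hQ4 : (4 : ℤ) ∣ -2 * Q := ⟨-(a * b'), by rw [hQ]; ring⟩
  rcases he with rfl | rfl
  · have hs := cls_one (k := 1) hcls hod (by rw [od_r]; rfl) (by
      rw [show (1 : CR) ^ 2 = ⟨1, 0, 0⟩ by decide]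
      apply md7_of
      · rw [hP, hka]
        have : (2 * b') ^ 2 = 8 * (kz - ka) := by linarith
        rw [this]; omega
      · simpa using hQ4
      · simp)
    obtain ⟨s, hs, -⟩ := hs
    refine endI' (s := s) (z := z) hao hcop (by rw [hka, hkz, h1]; ring) ?_
    rw [← hs, ← form_a, hP, hQ]
    push_cast; ring
  · exfalso
    obtain ⟨g, hg, s, hs, -, -, -, h7, -⟩ := cls_const (k := 1) (e := 5) hcls hod (by rw [od_r]; rfl) (by
      rw [show (5 : CR) * (1 : CR) ^ 2 = ⟨5, 0, 0⟩ by decide]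
      apply md7_of
      · rw [hP, hka]
        have : (2 * b') ^ 2 = 8 * (5 * kz - ka) + 4 := by linarith
        rw [this]; omega
      · simpa using hQ4
      · simp)
    have key : ∀ g ∈ G8, ∀ s ∈ SQ4, ¬ c ^ 7 ∣ g * s - 5 := by decide +kernel
    exact key g hg s hs h7

end CR

namespace CR

lemma three_five {a b : ℤ} (hcop : IsCoprime a b) (h : (5 : ℤ) ∣ a ^ 2 + b ^ 2)
    (h3 : (5 : ℤ) ∣ (a ^ 2 - b ^ 2) ^ 3 - 16 * (a * b) ^ 3) : (5 : ℤ) ∣ a - 3 * b := by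
  have key : ∀ x y : ZMod 5, x ^ 2 + y ^ 2 = 0 → (x ^ 2 - y ^ 2) ^ 3 - 16 * (x * y) ^ 3 = 0 → x - 3 * y = 0 := by decide
  have := key a b
    (by have := (ZMod.intCast_zmod_eq_zero_iff_dvd _ 5).2 h; push_cast at this; exact this)
    (by have := (ZMod.intCast_zmod_eq_zero_iff_dvd _ 5).2 h3; push_cast at this; exact this)
  exact (ZMod.intCast_zmod_eq_zero_iff_dvd (a - 3 * b) 5).1 (by push_cast; exact this)

lemma A_odd {A B w k : ℤ} (hw : A ^ 2 - B ^ 2 - 2 * (k * (A * B)) = w ^ 2) (hwo : w % 2 = 1) : A % 2 = 1 := by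
  by_contra hA
  obtain ⟨x, rfl⟩ : ∃ x, A = 2 * x := ⟨A / 2, by omega⟩
  obtain ⟨y, hy⟩ := sq8 hwo
  rcases Int.emod_two_eq_zero_or_one B with h2 | h2
  · obtain ⟨t, rfl⟩ : ∃ x, B = 2 * x := ⟨B / 2, by omega⟩
    have : 2 * (2 * x ^ 2 - 2 * t ^ 2 - 4 * (k * (x * t))) = 8 * y + 1 := by rw [← hy, ← hw]; ring
    omega
  · obtain ⟨t, ht⟩ := sq8 h2
    have : 4 * (x ^ 2 - 2 * t - (k * (x * B))) - 1 = 8 * y + 1 := by rw [← hy, ← hw, ht]; ring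
    omega

lemma case_even {a b z Y e : ℤ} (hcop : IsCoprime a b) (ha : a % 2 = 1) (hb : b % 2 = 1) (he : e = 1 ∨ e = 5)
    (h1 : a ^ 2 + b ^ 2 = 2 * (e * z ^ 2)) (hpos : 0 < a ^ 2 - b ^ 2 - 2 * (a * b))
    (h : (a ^ 2 - b ^ 2 - 2 * (a * b)) * ((a ^ 2 - b ^ 2) ^ 3 - 16 * (a * b) ^ 3) = 2 * e * Y ^ 2) :
    a = -b ∨ a = 3 * b := by
  have hPQ := cop_PQ hcop
  obtain ⟨ka, hka⟩ := sq8 ha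
  obtain ⟨kb, hkb⟩ := sq8 hb
  obtain ⟨P, hP⟩ : ∃ P, a ^ 2 - b ^ 2 = 8 * P := ⟨ka - kb, by rw [hka, hkb]; ring⟩
  obtain ⟨S, hS⟩ : ∃ S, S = - (a * b) := ⟨_, rfl⟩
  have hQ : a * b = - S := by rw [hS]; ring
  have hN5 := not5 (M := 0) hcop
  have h35 := three_five hcop
  rw [hP, hQ] at hPQ hpos h hN5 h35
  have hSP : IsCoprime S P := by
    have := (hPQ.of_mul_left_right).symm.neg_left
    rwa [neg_neg] at this
  have hSo : S % 2 = 1 := by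
    have : (a * b) % 2 = 1 := by rw [Int.mul_emod, ha, hb]; rfl
    omega
  have h16 : 16 * ((S + 4 * P) * (S ^ 3 + 32 * P ^ 3)) = e * Y ^ 2 := by linarith
  obtain ⟨Y, rfl⟩ : (4 : ℤ) ∣ Y := by
    have hce : IsCoprime (16 : ℤ) e := by
      rcases he with rfl | rfl
      · exact isCoprime_one_right
      · exact ⟨1, -3, by norm_num⟩
    have h2 : (16 : ℤ) ∣ Y ^ 2 := hce.dvd_of_dvd_mul_left (Dvd.intro _ h16)
    rw [show (16 : ℤ) = 4 ^ 2 by norm_num] at h2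
    exact (Int.pow_dvd_pow_iff (by norm_num)).1 h2
  have hY : (S + 4 * P) * (S ^ 3 + 32 * P ^ 3) = e * Y ^ 2 := by linarith
  have hpos' : 0 < S + 4 * P := by linarith
  obtain ⟨S3, hS3⟩ : ∃ x, S ^ 3 = 8 * x + S := by
    obtain ⟨k, hk⟩ := sq8 hSo
    exact ⟨k * S, by rw [pow_succ, hk]; ring⟩
  have hN3o : (S ^ 3 + 32 * P ^ 3) % 2 = 1 := by omega
  have hco : IsCoprime (S + 4 * P) (S ^ 3 + 32 * P ^ 3) := by
    apply cop_of _ (by omega)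
    intro p hp h2 h3
    have h4 : p ∣ (2 ^ 5) * P ^ 3 := by
      have := dvd_sub (dvd_mul_of_dvd_left h2 (S ^ 2 - 4 * S * P + 16 * P ^ 2)) h3
      have e : (2 ^ 5) * P ^ 3 = (S + 4 * P) * (S ^ 2 - 4 * S * P + 16 * P ^ 2) - (S ^ 3 + 32 * P ^ 3) := by ring
      rw [e]; exact this
    rcases hp.dvd_or_dvd h4 with h5 | h5
    · have h6 := hp.dvd_of_dvd_pow h5
      have h7 : p ∣ 4 * P := dvd_mul_of_dvd_left (h6.trans ⟨2, by norm_num⟩) _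
      exact hp.not_isUnit (IsCoprime.isUnit_of_dvd' (⟨-(S / 2), 1, by omega⟩ : IsCoprime (2 : ℤ) S) h6
        ((dvd_add_left h7).1 h2))
    · have h6 := hp.dvd_of_dvd_pow h5
      exact hp.not_isUnit (hSP.isUnit_of_dvd' ((dvd_add_left (dvd_mul_of_dvd_right h6 _)).1 h2) h6)
  obtain ⟨w, v, hw, hv⟩ := pos_split hco hpos' (by intro h0; rw [h0] at hN3o; omega) hY (by
    rcases he with rfl | rfl
    · exact Or.inl rfl
    · refine Or.inr ⟨rfl, fun h5 => hN5 ⟨2 * z ^ 2, by rw [h1]; ring⟩ ?_⟩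
      rw [show 8 * P - 2 * -S = 2 * (S + 4 * P) by ring]
      exact dvd_mul_of_dvd_right h5 _)
  have hvo : v % 2 = 1 := by
    rcases Int.emod_two_eq_zero_or_one v with h2 | h2
    · obtain ⟨x, rfl⟩ : ∃ x, v = 2 * x := ⟨v / 2, by omega⟩
      have e3 : e * (2 * x) ^ 2 = 2 * (2 * e * x ^ 2) := by ring
      rw [hv, e3] at hN3o; omega
    · exact h2
  have hv0 : v ≠ 0 := by omega
  obtain ⟨hcls, hod⟩ := alpha_cls (γ := c ^ 2) (k := 32) (Or.inr ⟨rfl, rfl⟩) hSo hSP he hv hv0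
  have hwo : w % 2 = 1 := odd_of_sq hw (by omega)
  obtain ⟨kw, hkw⟩ := sq8 hwo
  obtain ⟨kv, hkv⟩ := sq8 hvo
  rw [form_b] at hcls hod
  rw [hkw] at hw
  rw [hkv, hS3] at hv
  rcases he with rfl | rfl
  · left
    obtain ⟨s, hs, -⟩ := cls_one (k := 1) hcls hod (by rw [od_r]; rfl) (by
      rw [show (1 : CR) ^ 2 = ⟨1, 0, 0⟩ by decide]
      apply md7_of <;> omega)
    obtain ⟨A, hA⟩ : ∃ A, b - a = 2 * A := ⟨(b - a) / 2, by omega⟩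
    obtain ⟨B, hB⟩ : ∃ A, a + b = 2 * A := ⟨(a + b) / 2, by omega⟩
    obtain rfl : a = B - A := by omega
    obtain rfl : b = A + B := by omega
    have e1 : S = A ^ 2 - B ^ 2 := by rw [hS]; ring
    have e2 : 2 * P = - (A * B) := by linarith
    have hw' : A ^ 2 - B ^ 2 - 2 * (1 * (A * B)) = w ^ 2 := by rw [hkw, ← hw, ← e1]; linarith
    have hcAB : IsCoprime A B := by
      obtain ⟨x, y, hxy⟩ := hcop
      exact ⟨y - x, x + y, by rw [← hxy]; ring⟩
    have := endII' (s := s) (z := z) (w := w) (A_odd hw' hwo) hcAB (by linarith) (by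
      rw [← hs, ← form_b]
      have e2' : (2 : CR) * P = - (A * B) := by exact_mod_cast congrArg (Int.cast (R := CR)) e2
      rw [e1]; push_cast
      linear_combination (-c ^ 2) * e2') (by rw [← hw']; ring)
    omega
  · right
    obtain ⟨g, hg, s, hs, t, ht, -, h7, -⟩ := cls_const (k := 1) (e := ⟨5, 0, 2⟩) hcls hod (by rw [od_r]; rfl) (by
      rw [one_pow, mul_one]
      apply md7_of <;> omega)
    have key : ∀ g ∈ G8, ∀ s ∈ SQ4, c ^ 7 ∣ g * s - ⟨5, 0, 2⟩ → g = pp := by decide +kernel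
    rw [key g hg s hs h7] at ht
    have h5 : (5 : ℤ) ∣ a - 3 * b := by
      refine h35 ⟨2 * z ^ 2, by rw [h1]; ring⟩ ⟨16 * (8 * kv + 1), ?_⟩
      linarith
    obtain ⟨A, hA⟩ : ∃ A, 3 * a + b = 10 * A := ⟨(3 * a + b) / 10, by omega⟩
    obtain ⟨B, hB⟩ : ∃ A, 3 * b - a = 10 * A := ⟨(3 * b - a) / 10, by omega⟩
    obtain rfl : a = 3 * A - B := by omega
    obtain rfl : b = A + 3 * B := by omega
    have e1 : S = -3 * (A ^ 2 - B ^ 2) - 8 * (A * B) := by rw [hS]; ring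
    have e2 : 2 * P = 2 * (A ^ 2 - B ^ 2) - 3 * (A * B) := by linarith
    have hw' : A ^ 2 - B ^ 2 - 2 * (7 * (A * B)) = w ^ 2 := by rw [hkw, ← hw]; linarith
    have hcAB : IsCoprime A B := by
      obtain ⟨x, y, hxy⟩ := hcop
      exact ⟨3 * x + y, 3 * y - x, by rw [← hxy]; ring⟩
    have h5' : ¬ (5 : ℤ) ∣ A - 2 * B := by
      intro h5
      have := hcop.isUnit_of_dvd' (x := 5) (by omega) (by omega)
      rw [Int.isUnit_iff] at this
      omega
    have := endIII' (s := t * (1 + c + c ^ 2)) (z := z) (w := w) (A_odd hw' hwo) hcAB (by linarith) h5' (by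
      have e2' : (2 : CR) * P = 2 * (A ^ 2 - B ^ 2) - 3 * (A * B) := by exact_mod_cast congrArg (Int.cast (R := CR)) e2
      rw [← form_b, e1] at ht
      push_cast at ht
      apply mul_left_cancel₀ pp_prime.ne_zero
      have k1 : pp * (c - 1) ^ 2 = -3 + 2 * c ^ 2 := by decide
      have k2 : pp * (c - 1) ^ 2 * ⟨24,20,15⟩ = 8 + 3 * c ^ 2 := by decide
      have k3 : (c - 1) * (1 + c + c ^ 2) = 1 := by decide
      have k4 : (c - 1) ^ 2 * (1 + c + c ^ 2) ^ 2 = 1 := by decide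
      have e3 : pp * (c - 1) ^ 2 * ((A : CR) ^ 2 - B ^ 2 - ⟨24,20,15⟩ * A * B) = pp * t ^ 2 := by
        rw [← ht]
        linear_combination ((A : CR) ^ 2 - B ^ 2) * k1 - (A * B : CR) * k2 - c ^ 2 * e2'
      linear_combination (1 + c + c ^ 2) ^ 2 * e3 - pp * ((A : CR) ^ 2 - B ^ 2 - ⟨24,20,15⟩ * A * B) * k4) (by rw [← hw']; ring)
    omega

end CR

namespace CR

lemma front {a b Z : ℤ} (hcop : IsCoprime a b) (hpos : 0 < a ^ 2 - b ^ 2 - 2 * (a * b))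
    (h : (a ^ 2 + b ^ 2) * (a ^ 2 - b ^ 2 - 2 * (a * b)) * ((a ^ 2 - b ^ 2) ^ 3 - 16 * (a * b) ^ 3) = Z ^ 2) :
    b = 0 ∨ a = -b ∨ a = 3 * b := by
  have hN1 : 0 < a ^ 2 + b ^ 2 := by
    rcases eq_or_ne a 0 with rfl | ha
    · rcases eq_or_ne b 0 with rfl | hb
      · norm_num at hpos
      · positivity
    · positivity
  obtain ⟨dn, zn, hdz, hsq⟩ := Nat.sq_mul_squarefree (a ^ 2 + b ^ 2).natAbs
  obtain ⟨d, hd⟩ : ∃ d : ℤ, d = dn := ⟨_, rfl⟩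
  obtain ⟨z, hz⟩ : ∃ z : ℤ, z = zn := ⟨_, rfl⟩
  have h1 : a ^ 2 + b ^ 2 = d * z ^ 2 := by
    rw [hd, hz, ← Int.natAbs_of_nonneg hN1.le, ← hdz]; push_cast; ring
  have hdsq : Squarefree d := by rw [hd]; exact Int.squarefree_natCast.2 hsq
  have hd0 : 0 < d := by
    rcases lt_trichotomy d 0 with h2 | h2 | h2
    · omega
    · rw [h2] at h1; omega
    · exact h2
  have hz0 : z ≠ 0 := by rintro rfl; rw [h1] at hN1; simp at hN1
  obtain ⟨M, hM⟩ : ∃ M, M = (a ^ 2 - b ^ 2 - 2 * (a * b)) * ((a ^ 2 - b ^ 2) ^ 3 - 16 * (a * b) ^ 3) := ⟨_, rfl⟩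
  have h2 : z ^ 2 * (d * M) = Z ^ 2 := by rw [hM, ← h, h1]; ring
  obtain ⟨Z, rfl⟩ : z ∣ Z := (Int.pow_dvd_pow_iff (by norm_num)).1 (Dvd.intro _ h2)
  have h3 : d * M = Z ^ 2 := by
    apply mul_left_cancel₀ (pow_ne_zero 2 hz0)
    rw [h2]; ring
  obtain ⟨Y, rfl⟩ : d ∣ Z := (hdsq.dvd_pow_iff_dvd two_ne_zero).1 (Dvd.intro _ h3)
  have h4 : M = d * Y ^ 2 := by
    apply mul_left_cancel₀ hd0.ne'
    rw [h3]; ring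
  have hda : IsCoprime d a := by
    apply cop_of _ hd0.ne'
    intro p hp h5 h6
    have h7 : p ∣ a ^ 2 + b ^ 2 := by rw [h1]; exact dvd_mul_of_dvd_left h5 _
    have h8 : p ∣ b ^ 2 := (dvd_add_right (dvd_pow h6 (by norm_num))).1 h7
    exact hp.not_isUnit (hcop.isUnit_of_dvd' h6 (hp.dvd_of_dvd_pow h8))
  have h160 : d ∣ 160 := by
    have h5 : d ∣ 160 * a ^ 9 := by
      refine ⟨(3 * a - b) * Y ^ 2 - z ^ 2 * ((-1)*b^7 + (1)*a^1*b^6 + (11)*a^2*b^5 + (-23)*a^3*b^4 + (-19)*a^4*b^3 + (147)*a^5*b^2 + (-7)*a^6*b^1 + (-157)*a^7), ?_⟩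
      have e : 160 * a ^ 9 = (3 * a - b) * M - (a ^ 2 + b ^ 2) * ((-1)*b^7 + (1)*a^1*b^6 + (11)*a^2*b^5 + (-23)*a^3*b^4 + (-19)*a^4*b^3 + (147)*a^5*b^2 + (-7)*a^6*b^1 + (-157)*a^7) := by
        rw [hM]; ring
      rw [e, h4, h1]; ring
    exact (hda.pow_right).dvd_of_dvd_mul_right h5
  have h10 : d ∣ 10 := by
    refine (hdsq.dvd_pow_iff_dvd (n := 5) (by norm_num)).1 ?_
    exact h160.trans ⟨625, by norm_num⟩
  have hd4 : d = 1 ∨ d = 2 ∨ d = 5 ∨ d = 10 := by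
    have := Int.le_of_dvd (by norm_num) h10
    interval_cases d <;> omega
  rw [hM] at h4
  have hpar : ¬ (a % 2 = 0 ∧ b % 2 = 0) := by
    rintro ⟨h5, h6⟩
    have := hcop.isUnit_of_dvd' (x := 2) (by omega) (by omega)
    rw [Int.isUnit_iff] at this
    omega
  rcases (by omega : (a + b) % 2 = 1 ∨ a % 2 = 1 ∧ b % 2 = 1) with h5 | ⟨h5, h6⟩
  · have hodd : (a ^ 2 + b ^ 2) % 2 = 1 := by
      obtain ⟨x, hx⟩ : ∃ x, a + b = 2 * x + 1 := ⟨(a + b) / 2, by omega⟩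
      have : a ^ 2 + b ^ 2 = 2 * (2 * x ^ 2 + 2 * x - a * b) + 1 := by
        linear_combination (a + b + 2 * x + 1) * hx
      omega
    left
    refine case_odd (e := d) hcop h5 ?_ h1 hpos h4
    rcases hd4 with rfl | rfl | rfl | rfl
    · exact Or.inl rfl
    · omega
    · exact Or.inr rfl
    · omega
  · right
    obtain ⟨x, hx⟩ := sq8 h5
    obtain ⟨y, hy⟩ := sq8 h6
    have hodd : ∀ d : ℤ, d % 2 = 1 → a ^ 2 + b ^ 2 = d * z ^ 2 → False := by
      intro d hdo h7
      rw [hx, hy] at h7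
      rcases Int.emod_two_eq_zero_or_one z with h8 | h8
      · obtain ⟨t, rfl⟩ : ∃ x, z = 2 * x := ⟨z / 2, by omega⟩
        have : d * (2 * t) ^ 2 = 4 * (d * t ^ 2) := by ring
        omega
      · obtain ⟨t, ht⟩ := sq8 h8
        have : d * z ^ 2 = 2 * (4 * (d * t)) + d := by rw [ht]; ring
        omega
    rcases hd4 with rfl | rfl | rfl | rfl
    · exact (hodd 1 rfl h1).elim
    · exact case_even (e := 1) (z := z) (Y := Y) hcop h5 h6 (Or.inl rfl) (by linarith) hpos (by linarith)
    · exact (hodd 5 rfl h1).elim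
    · exact case_even (e := 5) (z := z) (Y := Y) hcop h5 h6 (Or.inr rfl) (by linarith) hpos (by linarith)

lemma N2_ne {a b : ℤ} (hb : b ≠ 0) : a ^ 2 - b ^ 2 - 2 * (a * b) ≠ 0 := by
  intro h
  have h1 : (a - b) * (a - b) = 2 * b * b := by linear_combination h
  have hirr : Irrational (√2) := irrational_sqrt_two
  have hb' : (b : ℝ) ≠ 0 := by exact_mod_cast hb
  have h2 : (((a - b : ℤ) : ℝ) / b) ^ 2 = 2 := by
    rw [div_pow, div_eq_iff (pow_ne_zero 2 hb')]
    have := congrArg (Int.cast (R := ℝ)) h1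
    push_cast at this ⊢
    linear_combination this
  have h3 : √2 = |((a - b : ℤ) : ℝ) / b| := by rw [← h2, Real.sqrt_sq_eq_abs]
  apply hirr
  exact ⟨|((a - b : ℤ) : ℚ) / b|, by rw [h3]; push_cast; rfl⟩

lemma xs {x y : ℚ} (h : y ^ 2 = (x ^ 2 + 1) * (x ^ 2 - 2 * x - 1) *
      (x ^ 6 - 3 * x ^ 4 - 16 * x ^ 3 + 3 * x ^ 2 - 1)) : x = 0 ∨ x = 1 ∨ x = -1 ∨ x = 3 ∨ x = -1 / 3 := by
  obtain ⟨a, ha⟩ : ∃ a, a = x.num := ⟨_, rfl⟩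
  obtain ⟨b, hbd⟩ : ∃ b : ℤ, b = x.den := ⟨_, rfl⟩
  have hb0 : b ≠ 0 := by rw [hbd]; exact_mod_cast x.den_ne_zero
  have hbq : (b : ℚ) ≠ 0 := by exact_mod_cast hb0
  have hx : x = a / b := by
    rw [ha, hbd]; push_cast; exact (Rat.num_div_den x).symm
  have hcop : IsCoprime a b := by
    rw [ha, hbd, Int.isCoprime_iff_gcd_eq_one]
    exact x.reduced
  have hZq : (y * b ^ 5) ^ 2 = (((a ^ 2 + b ^ 2) * (a ^ 2 - b ^ 2 - 2 * (a * b)) * ((a ^ 2 - b ^ 2) ^ 3 - 16 * (a * b) ^ 3) : ℤ) : ℚ) := by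
    rw [mul_pow, h, hx]
    push_cast
    field_simp
    ring
  obtain ⟨Z, hZ⟩ : ∃ Z : ℤ, (Z : ℚ) = y * b ^ 5 := by
    have : IsSquare (((a ^ 2 + b ^ 2) * (a ^ 2 - b ^ 2 - 2 * (a * b)) * ((a ^ 2 - b ^ 2) ^ 3 - 16 * (a * b) ^ 3) : ℤ) : ℚ) :=
      ⟨y * b ^ 5, by rw [← hZq]; ring⟩
    rw [Rat.isSquare_intCast_iff] at this
    obtain ⟨r, hr⟩ := this
    rw [hr] at hZq
    push_cast at hZq
    rw [← pow_two] at hZq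
    rcases sq_eq_sq_iff_eq_or_eq_neg.1 hZq with h1 | h1
    · exact ⟨r, h1.symm⟩
    · exact ⟨-r, by rw [h1]; push_cast; rfl⟩
  have hE : (a ^ 2 + b ^ 2) * (a ^ 2 - b ^ 2 - 2 * (a * b)) * ((a ^ 2 - b ^ 2) ^ 3 - 16 * (a * b) ^ 3) = Z ^ 2 := by
    rw [← hZ] at hZq; exact_mod_cast hZq.symm
  rcases lt_or_gt_of_ne (N2_ne (a := a) hb0) with hneg | hpos
  · rcases front (a := -b) (b := a) (Z := Z) (hcop.symm.neg_left) (by linarith) (by rw [← hE]; ring) with h1 | h1 | h1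
    · left; rw [hx, h1]; simp
    · right; left
      rw [hx, div_eq_one_iff_eq hbq]
      exact_mod_cast (by omega : a = b)
    · right; right; right; right
      rw [hx, show b = -3 * a by omega]
      have ha0 : (a : ℚ) ≠ 0 := by exact_mod_cast (by omega : a ≠ 0)
      push_cast; field_simp
  · rcases front hcop hpos hE with h1 | h1 | h1
    · exact (hb0 h1).elim
    · right; right; left
      rw [hx, h1]; push_cast; field_simp
    · right; right; right; left
      rw [hx, h1]; push_cast; field_simp

end CR

theorem genus4_chabauty_points (x y : ℚ) :
    y ^ 2 = (x ^ 2 + 1) * (x ^ 2 - 2 * x - 1) *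
      (x ^ 6 - 3 * x ^ 4 - 16 * x ^ 3 + 3 * x ^ 2 - 1) ↔
    (x = 0 ∧ y = 1) ∨ (x = 0 ∧ y = -1) ∨
    (x = 1 ∧ y = 8) ∨ (x = 1 ∧ y = -8) ∨
    (x = -1 ∧ y = 8) ∨ (x = -1 ∧ y = -8) ∨
    (x = 3 ∧ y = 40) ∨ (x = 3 ∧ y = -40) ∨
    (x = -1/3 ∧ y = 40/243) ∨ (x = -1/3 ∧ y = -40/243) := by
  constructor
  · intro h
    have hy : ∀ r : ℚ, y ^ 2 = r ^ 2 → y = r ∨ y = -r := fun r hr => sq_eq_sq_iff_eq_or_eq_neg.1 hr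
    rcases CR.xs h with rfl | rfl | rfl | rfl | rfl
    · rcases hy 1 (by rw [h]; norm_num) with h1 | h1 <;> simp [h1]
    · rcases hy 8 (by rw [h]; norm_num) with h1 | h1 <;> simp [h1]
    · rcases hy 8 (by rw [h]; norm_num) with h1 | h1 <;> simp [h1]
    · rcases hy 40 (by rw [h]; norm_num) with h1 | h1 <;> simp [h1]
    · rcases hy (40 / 243) (by rw [h]; norm_num) with h1 | h1
      · simp [h1]
      · right; right; right; right; right; right; right; right; right
        exact ⟨rfl, by rw [h1]; norm_num⟩
  · rintro (⟨rfl, rfl⟩ | ⟨rfl, rfl⟩ | ⟨rfl, rfl⟩ | ⟨rfl, rfl⟩ | ⟨rfl, rfl⟩ | ⟨rfl, rfl⟩ | ⟨rfl, rfl⟩ | ⟨rfl, rfl⟩ | ⟨rfl, rfl⟩ | ⟨rfl, rfl⟩) <;> norm_num
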